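/- Let k be an algebraically closed field of characteristic p > 0, G̃ a finite group, G a normal subgroup of G̃, and B = kG·b a G̃-stable block of kG whose defect groups are cyclic. If every simple kG-module lying in B is G̃-stable, then every indecomposable kG-module lying in B is G̃-stable. -/

import Mathlib

open scoped TensorProduct

namespace Paper

/-! ### Torsion-theoretic notions over an arbitrary ring -/

section Torsion

variable (R : Type) [Ring R]

/-- `FacCl R C` : quotient modules of finite direct sums of modules in `C`. -/
def FacCl (C : ModuleCat.{0} R → Prop) (M : ModuleCat.{0} R) : Prop :=
  ∃ (n : ℕ) (N : Fin n → ModuleCat.{0} R), (∀ i, C (N i)) ∧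
    ∃ f : ((i : Fin n) → N i) →ₗ[R] M, Function.Surjective f

/-- `SubCl R C` : submodules of finite direct sums of modules in `C`. -/
def SubCl (C : ModuleCat.{0} R → Prop) (M : ModuleCat.{0} R) : Prop :=
  ∃ (n : ℕ) (N : Fin n → ModuleCat.{0} R), (∀ i, C (N i)) ∧
    ∃ f : M →ₗ[R] ((i : Fin n) → N i), Function.Injective f

/-- `AddCl R C` : direct summands of finite direct sums of modules in `C`. -/
def AddCl (C : ModuleCat.{0} R → Prop) (M : ModuleCat.{0} R) : Prop :=
  ∃ (n : ℕ) (N : Fin n → ModuleCat.{0} R), (∀ i, C (N i)) ∧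
    ∃ (s : M →ₗ[R] ((i : Fin n) → N i)) (r : ((i : Fin n) → N i) →ₗ[R] M),
      ∀ m : M, r (s m) = m

/-- `FiltCl R C` : modules having a finite filtration with subquotients in `add C`. -/
def FiltCl (C : ModuleCat.{0} R → Prop) (M : ModuleCat.{0} R) : Prop :=
  ∃ (l : ℕ) (F : Fin (l + 1) → Submodule R M),
    Monotone F ∧ F 0 = ⊥ ∧ F (Fin.last l) = ⊤ ∧
      ∀ i : Fin l, AddCl R C (ModuleCat.of R
        (↥(F i.succ) ⧸ Submodule.comap (F i.succ).subtype (F i.castSucc)))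

/-- A torsion class inside the ambient class `Amb` of modules:  a subclass of `Amb`
closed under quotient modules, finite direct sums and extensions. -/
def IsTorsionClassIn (Amb T : ModuleCat.{0} R → Prop) : Prop :=
  (∀ M, T M → Amb M) ∧
  (∀ (M N : ModuleCat.{0} R) (f : M →ₗ[R] N),
      Amb N → Function.Surjective f → T M → T N) ∧
  (∀ (n : ℕ) (N : Fin n → ModuleCat.{0} R), (∀ i, T (N i)) →
      Amb (ModuleCat.of R ((i : Fin n) → N i)) →
      T (ModuleCat.of R ((i : Fin n) → N i))) ∧
  (∀ (M : ModuleCat.{0} R) (A : Submodule R M), Amb M →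
      T (ModuleCat.of R ↥A) → T (ModuleCat.of R (↥M ⧸ A)) → T M)

/-- A torsion-free class inside the ambient class `Amb` of modules. -/
def IsTorsionFreeClassIn (Amb F : ModuleCat.{0} R → Prop) : Prop :=
  (∀ M, F M → Amb M) ∧
  (∀ (M N : ModuleCat.{0} R) (f : M →ₗ[R] N),
      Amb M → Function.Injective f → F N → F M) ∧
  (∀ (n : ℕ) (N : Fin n → ModuleCat.{0} R), (∀ i, F (N i)) →
      Amb (ModuleCat.of R ((i : Fin n) → N i)) →
      F (ModuleCat.of R ((i : Fin n) → N i))) ∧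
  (∀ (M : ModuleCat.{0} R) (A : Submodule R M), Amb M →
      F (ModuleCat.of R ↥A) → F (ModuleCat.of R (↥M ⧸ A)) → F M)

/-- The smallest torsion class (inside `Amb`) containing the class `C`. -/
def TorsClIn (Amb C : ModuleCat.{0} R → Prop) (M : ModuleCat.{0} R) : Prop :=
  ∀ T : ModuleCat.{0} R → Prop, IsTorsionClassIn R Amb T →
    (∀ X, Amb X → C X → T X) → T M

/-- The smallest torsion-free class (inside `Amb`) containing the class `C`. -/
def TorfClIn (Amb C : ModuleCat.{0} R → Prop) (M : ModuleCat.{0} R) : Prop :=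
  ∀ F : ModuleCat.{0} R → Prop, IsTorsionFreeClassIn R Amb F →
    (∀ X, Amb X → C X → F X) → F M

/-- The ambient class of finitely generated modules. -/
def FGMod (M : ModuleCat.{0} R) : Prop := Module.Finite R M

def ContravariantlyFinite (Amb C : ModuleCat.{0} R → Prop) : Prop :=
  ∀ M : ModuleCat.{0} R, Amb M →
    ∃ X : ModuleCat.{0} R, C X ∧ ∃ f : X →ₗ[R] M,
      ∀ Y : ModuleCat.{0} R, C Y → ∀ g : Y →ₗ[R] M,
        ∃ h : Y →ₗ[R] X, ∀ y : Y, f (h y) = g y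

def CovariantlyFinite (Amb C : ModuleCat.{0} R → Prop) : Prop :=
  ∀ M : ModuleCat.{0} R, Amb M →
    ∃ X : ModuleCat.{0} R, C X ∧ ∃ f : M →ₗ[R] X,
      ∀ Y : ModuleCat.{0} R, C Y → ∀ g : M →ₗ[R] Y,
        ∃ h : X →ₗ[R] Y, ∀ m : M, h (f m) = g m

def FunctoriallyFinite (Amb C : ModuleCat.{0} R → Prop) : Prop :=
  ContravariantlyFinite R Amb C ∧ CovariantlyFinite R Amb C

/-- `M` is (isomorphic to) a direct summand of `W`. -/
def IsSummandOf (X W : Type) [AddCommGroup X] [Module R X]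
    [AddCommGroup W] [Module R W] : Prop :=
  ∃ (s : X →ₗ[R] W) (r : W →ₗ[R] X), ∀ x : X, r (s x) = x

/-- An indecomposable module: nonzero and not the direct sum of two nonzero submodules. -/
def IndecMod (M : Type) [AddCommGroup M] [Module R M] : Prop :=
  Nontrivial M ∧ ∀ A B : Submodule R M, IsCompl A B → A = ⊥ ∨ B = ⊥

/-- A projective cover: a surjection from a projective module with superfluous kernel. -/
def IsProjCover {P V : Type} [AddCommGroup P] [Module R P]
    [AddCommGroup V] [Module R V] (π : P →ₗ[R] V) : Prop :=
  Module.Projective R P ∧ Function.Surjective π ∧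
    ∀ L : Submodule R P, LinearMap.ker π ⊔ L = ⊤ → L = ⊤

/-- An injective envelope: an injection into an injective module with essential image. -/
def IsInjEnv {V I : Type} [AddCommGroup V] [Module R V]
    [AddCommGroup I] [Module R I] (ι : V →ₗ[R] I) : Prop :=
  Module.Injective R I ∧ Function.Injective ι ∧
    ∀ L : Submodule R I, L ≠ ⊥ → L ⊓ LinearMap.range ι ≠ ⊥

/-- A central idempotent. -/
def IsCentralIdem (b : R) : Prop :=
  b * b = b ∧ ∀ a : R, a * b = b * a

/-- A block idempotent: a primitive idempotent of the center. -/
def IsBlockIdem (b : R) : Prop :=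
  b ≠ 0 ∧ IsCentralIdem R b ∧
    ∀ c d : R, IsCentralIdem R c → IsCentralIdem R d →
      c * d = 0 → d * c = 0 → b = c + d → c = 0 ∨ d = 0

/-- The module `U` lies in the block determined by the central idempotent `b`. -/
def LiesIn (b : R) (U : Type) [AddCommGroup U] [Module R U] : Prop :=
  ∀ u : U, b • u = u

/-- The `b`-component `b·M` of a module `M`, for a central idempotent `b`. -/
def blockComp (b : R) (hb : ∀ a : R, a * b = b * a)
    (M : Type) [AddCommGroup M] [Module R M] : Submodule R M where
  carrier := {m : M | b • m = m}
  add_mem' := by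
    intro x y hx hy
    simp only [Set.mem_setOf_eq] at *
    rw [smul_add, hx, hy]
  zero_mem' := by simp
  smul_mem' := by
    intro c m hm
    simp only [Set.mem_setOf_eq] at *
    rw [smul_smul, ← hb c, mul_smul, hm]

/-- The ambient class of finitely generated modules lying in the block of `b`. -/
def BlockFG (b : R) : ModuleCat.{0} R → Prop :=
  fun M => Module.Finite R M ∧ LiesIn R b M

end Torsion

/-! ### Bundled modules with a compatible `k`-structure -/

structure BModule (k R : Type) [CommSemiring k] [Ring R] [Algebra k R] : Type 1 where
  carrier : Type
  [isAddCommGroup : AddCommGroup carrier]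
  [isModuleK : Module k carrier]
  [isModuleR : Module R carrier]
  [isTower : IsScalarTower k R carrier]

attribute [instance] BModule.isAddCommGroup BModule.isModuleK BModule.isModuleR
  BModule.isTower

instance (k R : Type) [CommSemiring k] [Ring R] [Algebra k R] :
    CoeSort (BModule k R) Type :=
  ⟨BModule.carrier⟩

section GroupAlg

variable (k : Type) [Field k]

/-- A brick over a `k`-algebra `R`: a nonzero module all of whose `R`-endomorphisms
are given by scalars in `k`. -/
def IsBrickOver (R : Type) [Ring R] [Algebra k R]
    (U : Type) [AddCommGroup U] [Module R U] : Prop :=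
  Nontrivial U ∧ ∀ f : U →ₗ[R] U, ∃ c : k, ∀ u : U, f u = algebraMap k R c • u

/-- A module which is a finite direct sum of bricks with no nonzero homomorphisms
between non-isomorphic summands. -/
def IsSemibrickModule (R : Type) [Ring R] [Algebra k R]
    (M : Type) [AddCommGroup M] [Module R M] : Prop :=
  ∃ (m : ℕ) (T : Fin m → BModule k R),
    Nonempty (M ≃ₗ[R] ((i : Fin m) → ↥(T i))) ∧
    (∀ i, IsBrickOver k R ↥(T i)) ∧
    ∀ i j, IsEmpty (↥(T i) ≃ₗ[R] ↥(T j)) → ∀ f : ↥(T i) →ₗ[R] ↥(T j), f = 0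

/-- `V` is one-dimensional over `k`. -/
def OneDimOver (V : Type) [AddCommGroup V] [Module k V] : Prop :=
  ∃ v : V, v ≠ 0 ∧ ∀ w : V, ∃ c : k, w = c • v

/-- Triviality of the second group cohomology `H²(Q, kˣ)` (trivial action):
every `2`-cocycle is a `2`-coboundary. -/
def H2Trivial (Q : Type) [Group Q] : Prop :=
  ∀ α : Q → Q → kˣ,
    (∀ a b c : Q, α a b * α (a * b) c = α b c * α a (b * c)) →
    ∃ β : Q → kˣ, ∀ a b : Q, α a b = β a * β b * (β (a * b))⁻¹

/-- The `k`-algebra `R` is basic (for `k` algebraically closed this means that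
every simple module is one-dimensional over `k`). -/
def BasicAlg (R : Type) [Ring R] [Algebra k R] : Prop :=
  ∀ V : BModule k R, IsSimpleModule R ↥V → OneDimOver k ↥V

/-- `P` has exactly `n` isomorphism classes of modules satisfying it. -/
def RepClasses (R : Type) [Ring R] [Algebra k R]
    (P : BModule k R → Prop) (n : ℕ) : Prop :=
  ∃ V : Fin n → BModule k R, (∀ i, P (V i)) ∧
    (∀ i j, i ≠ j → IsEmpty (↥(V i) ≃ₗ[R] ↥(V j))) ∧
    ∀ W : BModule k R, P W → ∃ i, Nonempty (↥W ≃ₗ[R] ↥(V i))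

/-- The ring homomorphism `k[A] → k[B]` induced by a group homomorphism `f : A → B`. -/
noncomputable def MapAlong {A B : Type} [Group A] [Group B] (f : A →* B) :
    MonoidAlgebra k A →+* MonoidAlgebra k B :=
  MonoidAlgebra.mapDomainRingHom k f

/-- The `k[B]`-module `W` restricted along `f : A → B` is isomorphic to the
`k[A]`-module `U`; i.e. `W` is an extending module of `U`. -/
def ExtendsAlong {A B : Type} [Group A] [Group B] (f : A →* B)
    (U : Type) [AddCommGroup U] [Module (MonoidAlgebra k A) U]
    (W : Type) [AddCommGroup W] [Module (MonoidAlgebra k B) W] : Prop :=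
  ∃ φ : U ≃+ W, ∀ (a : MonoidAlgebra k A) (u : U),
    φ (a • u) = MapAlong k f a • φ u

/-- `η : U →+ W` exhibits the `k[B]`-module `W` as the module induced along
`f : A → B` from the `k[A]`-module `U`: `η` is `k[A]`-linear into the restriction
of `W`, and has the universal (left-adjoint) property. -/
def IsInducedUnit {A B : Type} [Group A] [Group B] (f : A →* B)
    (U : Type) [AddCommGroup U] [Module (MonoidAlgebra k A) U]
    (W : Type) [AddCommGroup W] [Module (MonoidAlgebra k B) W]
    (η : U →+ W) : Prop :=
  (∀ (a : MonoidAlgebra k A) (u : U), η (a • u) = MapAlong k f a • η u) ∧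
  ∀ (X : BModule k (MonoidAlgebra k B)) (g : U →+ ↥X),
    (∀ (a : MonoidAlgebra k A) (u : U), g (a • u) = MapAlong k f a • g u) →
    ∃! F : W →ₗ[MonoidAlgebra k B] ↥X, ∀ u : U, F (η u) = g u

/-- `W` is (a realization of) the induced module `Ind` of `U` along `f`. -/
def IsInducedAlong {A B : Type} [Group A] [Group B] (f : A →* B)
    (U : Type) [AddCommGroup U] [Module (MonoidAlgebra k A) U]
    (W : Type) [AddCommGroup W] [Module (MonoidAlgebra k B) W] : Prop :=
  ∃ η : U →+ W, IsInducedUnit k f U W η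

variable (Gt : Type) [Group Gt] (G : Subgroup Gt) [G.Normal]

/-- Conjugation `g ↦ x⁻¹ g x` as a homomorphism of the normal subgroup `G`. -/
def conjHom (x : Gt) : ↥G →* ↥G where
  toFun g := ⟨x⁻¹ * ↑g * x, ‹G.Normal›.conj_mem' (↑g) g.2 x⟩
  map_one' := by
    apply Subtype.ext
    simp
  map_mul' g h := by
    apply Subtype.ext
    push_cast
    group

/-- The `kG`-module `U` is stable under conjugation by `x`, i.e. `ˣU ≅ U`. -/
def IsStableAt (x : Gt) (U : Type) [AddCommGroup U]
    [Module (MonoidAlgebra k ↥G) U] : Prop :=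
  ∃ ψ : U ≃+ U, ∀ (a : MonoidAlgebra k ↥G) (u : U),
    ψ (MapAlong k (conjHom Gt G x) a • u) = a • ψ u

/-- The `kG`-module `U` is `G̃`-stable. -/
def IsGtStable (U : Type) [AddCommGroup U]
    [Module (MonoidAlgebra k ↥G) U] : Prop :=
  ∀ x : Gt, IsStableAt k Gt G x U

/-- The inertia group of an element `b ∈ kG` inside `G̃`:
all `x ∈ G̃` with `x b x⁻¹ = b`. -/
def inertia (b : MonoidAlgebra k ↥G) : Subgroup Gt where
  carrier := {x : Gt | Commute (MonoidAlgebra.of k Gt x) (MapAlong k G.subtype b)}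
  one_mem' := by
    simp only [Set.mem_setOf_eq, map_one]
    exact Commute.one_left _
  mul_mem' := by
    intro a c ha hc
    simp only [Set.mem_setOf_eq, map_mul] at *
    exact ha.mul_left hc
  inv_mem' := by
    intro a ha
    simp only [Set.mem_setOf_eq] at *
    have h1 : MonoidAlgebra.of k Gt a⁻¹ * MonoidAlgebra.of k Gt a = 1 := by
      rw [← map_mul, inv_mul_cancel, map_one]
    have h2 : MonoidAlgebra.of k Gt a * MonoidAlgebra.of k Gt a⁻¹ = 1 := by
      rw [← map_mul, mul_inv_cancel, map_one]
    show MonoidAlgebra.of k Gt a⁻¹ * MapAlong k G.subtype b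
        = MapAlong k G.subtype b * MonoidAlgebra.of k Gt a⁻¹
    calc MonoidAlgebra.of k Gt a⁻¹ * MapAlong k G.subtype b
        = MonoidAlgebra.of k Gt a⁻¹ * MapAlong k G.subtype b *
            (MonoidAlgebra.of k Gt a * MonoidAlgebra.of k Gt a⁻¹) := by
          rw [h2, mul_one]
      _ = MonoidAlgebra.of k Gt a⁻¹ * (MapAlong k G.subtype b * MonoidAlgebra.of k Gt a) *
            MonoidAlgebra.of k Gt a⁻¹ := by noncomm_ring
      _ = MonoidAlgebra.of k Gt a⁻¹ * (MonoidAlgebra.of k Gt a * MapAlong k G.subtype b) *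
            MonoidAlgebra.of k Gt a⁻¹ := by rw [← ha.eq]
      _ = (MonoidAlgebra.of k Gt a⁻¹ * MonoidAlgebra.of k Gt a) *
            (MapAlong k G.subtype b * MonoidAlgebra.of k Gt a⁻¹) := by noncomm_ring
      _ = MapAlong k G.subtype b * MonoidAlgebra.of k Gt a⁻¹ := by
          rw [h1, one_mul]

/-- Relative projectivity of a `k[A]`-module with respect to a subgroup `D ≤ A`:
any `k[A]`-linear surjection onto a quotient admitting a `k[D]`-linear splitting of
a lifting problem admits a `k[A]`-linear solution. -/
def RelProj (A : Type) [Group A] (D : Subgroup A)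
    (U : Type) [AddCommGroup U] [Module (MonoidAlgebra k A) U] : Prop :=
  ∀ (M N : BModule k (MonoidAlgebra k A))
    (f : ↥M →ₗ[MonoidAlgebra k A] ↥N) (g : U →ₗ[MonoidAlgebra k A] ↥N),
    Function.Surjective f →
    (∃ h : U →+ ↥M,
        (∀ (c : k) (u : U),
          h (algebraMap k (MonoidAlgebra k A) c • u)
            = algebraMap k (MonoidAlgebra k A) c • h u) ∧
        (∀ (d : ↥D) (u : U),
          h (MonoidAlgebra.of k A ↑d • u) = MonoidAlgebra.of k A ↑d • h u) ∧
        ∀ u : U, f (h u) = g u) →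
    ∃ h' : U →ₗ[MonoidAlgebra k A] ↥M, ∀ u : U, f (h' u) = g u

/-- `D` is a defect group of the block of `b`: `D` is minimal with respect to
inclusion among subgroups such that every module in the block is relatively
`D`-projective. -/
def IsDefectGroup (A : Type) [Group A] (b : MonoidAlgebra k A)
    (D : Subgroup A) : Prop :=
  (∀ U : BModule k (MonoidAlgebra k A),
      LiesIn (MonoidAlgebra k A) b ↥U → RelProj k A D ↥U) ∧
  ∀ D' : Subgroup A, D' ≤ D →
    (∀ U : BModule k (MonoidAlgebra k A),
        LiesIn (MonoidAlgebra k A) b ↥U → RelProj k A D' ↥U) →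
    D' = D

/-- Left finiteness (inside the ambient class `Amb`) of a module `S`: the smallest
torsion class containing `S` is functorially finite. -/
def IsLeftFiniteIn (R : Type) [Ring R] (Amb : ModuleCat.{0} R → Prop)
    (S : Type) [AddCommGroup S] [Module R S] : Prop :=
  FunctoriallyFinite R Amb (TorsClIn R Amb (fun X => Nonempty (↥X ≃ₗ[R] S)))

/-- `W₂` realizes the tensor product `W₁ ⊗ₖ V` with the diagonal `G̃`-action, where
`V` is a `k[G̃/G]`-module viewed as a `k[G̃]`-module via the projection. -/
def DiagTensorIso
    (W₁ : Type) [AddCommGroup W₁] [Module k W₁] [Module (MonoidAlgebra k Gt) W₁]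
    [IsScalarTower k (MonoidAlgebra k Gt) W₁]
    (V : Type) [AddCommGroup V] [Module k V] [Module (MonoidAlgebra k (Gt ⧸ G)) V]
    [IsScalarTower k (MonoidAlgebra k (Gt ⧸ G)) V]
    (W₂ : Type) [AddCommGroup W₂] [Module k W₂] [Module (MonoidAlgebra k Gt) W₂]
    [IsScalarTower k (MonoidAlgebra k Gt) W₂] : Prop :=
  ∃ θ : (W₁ ⊗[k] V) ≃ₗ[k] W₂,
    ∀ (x : Gt) (w : W₁) (v : V),
      θ ((MonoidAlgebra.of k Gt x • w) ⊗ₜ[k]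
          (MonoidAlgebra.of k (Gt ⧸ G) (QuotientGroup.mk x) • v))
        = MonoidAlgebra.of k Gt x • θ (w ⊗ₜ[k] v)

end GroupAlg

/-! ### Relative traces -/

section Traces

open scoped Classical

variable {k : Type} [Field k] {Γ : Type} [Group Γ] [Fintype Γ]
  {M M' : Type} [AddCommGroup M] [Module k M] [AddCommGroup M'] [Module k M']

/-- The image of the trace map `m ↦ ∑ h ∈ H, h m`. -/
noncomputable def nul (σ : Representation k Γ M) (H : Subgroup Γ) : Submodule k M :=
  LinearMap.range (∑ h : H, σ h)

lemma mem_nul {σ : Representation k Γ M} {H : Subgroup Γ} {m : M} :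
    m ∈ nul σ H ↔ ∃ a, ∑ h : H, σ h a = m := by
  simp [nul, LinearMap.mem_range, LinearMap.sum_apply]

/-- The part over `N` of the relative trace from `D` to the whole group. -/
noncomputable def qtrOn (σ : Representation k Γ M) (D N : Subgroup Γ) (m : M) : M :=
  ∑ x : Γ ⧸ D, if x.out ∈ N then σ x.out m else 0

/-- The relative trace from `D` to the whole group. -/
noncomputable def qtr (σ : Representation k Γ M) (D : Subgroup Γ) (m : M) : M :=
  ∑ x : Γ ⧸ D, σ x.out m

omit [Fintype Γ] in
lemma apply_out_eq {X : Type} {D : Subgroup Γ} {F : Γ → X} (hF : ∀ g, ∀ d ∈ D, F (g * d) = F g)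
    (g : Γ) : F (g : Γ ⧸ D).out = F g := by
  obtain ⟨d, hd⟩ := QuotientGroup.mk_out_eq_mul D g
  rw [hd, hF _ _ d.2]

omit [Fintype Γ] in
lemma fix_right {σ : Representation k Γ M} {D : Subgroup Γ} {m : M}
    (hm : ∀ d ∈ D, σ d m = m) (g : Γ) : ∀ d ∈ D, σ (g * d) m = σ g m := by
  intro d hd
  rw [map_mul, Module.End.mul_apply, hm d hd]

/-- Sums over cosets may be reindexed by left translation. -/
lemma sum_coset_smul {D : Subgroup Γ} {F : Γ → M} (hF : ∀ g, ∀ d ∈ D, F (g * d) = F g) (g : Γ) :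
    ∑ x : Γ ⧸ D, F (g * x.out) = ∑ x : Γ ⧸ D, F x.out := by
  refine Fintype.sum_equiv (MulAction.toPerm g) _ _ fun x => ?_
  induction x using QuotientGroup.induction_on with | _ y =>
  rw [MulAction.toPerm_apply, MulAction.Quotient.smul_mk, smul_eq_mul, apply_out_eq hF,
    apply_out_eq (F := fun x => F (g * x)) fun a d hd => by rw [← mul_assoc, hF _ _ hd]]

lemma qtr_fixed {σ : Representation k Γ M} {D : Subgroup Γ} {m : M}
    (hm : ∀ d ∈ D, σ d m = m) (g : Γ) : σ g (qtr σ D m) = qtr σ D m := by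
  rw [qtr, map_sum, ← sum_coset_smul (F := fun g => σ g m) (fix_right hm) g]
  simp

lemma nul_fixed {σ : Representation k Γ M} {H : Subgroup Γ} {m : M} (hm : m ∈ nul σ H) :
    ∀ h ∈ H, σ h m = m := by
  obtain ⟨a, rfl⟩ := mem_nul.1 hm
  intro h hh
  rw [map_sum]
  refine Fintype.sum_equiv (Equiv.mulLeft (⟨h, hh⟩ : H)) _ _ fun x => ?_
  simp

lemma qtr_trace (σ : Representation k Γ M) (D : Subgroup Γ) (a : M) :
    qtr σ D (∑ d : D, σ d a) = ∑ g : Γ, σ g a := by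
  rw [← Finset.sum_fiberwise Finset.univ (fun g : Γ => (g : Γ ⧸ D)), qtr]
  refine Finset.sum_congr rfl fun x _ => ?_
  rw [map_sum]
  refine Finset.sum_bij (fun d _ => x.out * d) ?_ ?_ ?_ ?_
  · intro d _
    simp
  · intro d _ e _ h
    exact Subtype.ext (mul_left_cancel h)
  · intro g hg
    have hg' : ((x.out : Γ) : Γ ⧸ D) = g := by simpa using (Finset.mem_filter.1 hg).2.symm
    exact ⟨⟨_, QuotientGroup.eq.1 hg'⟩, Finset.mem_univ _, by simp⟩
  · intro d _
    simp

lemma map_mem_nul {σ : Representation k Γ M} {σ' : Representation k Γ M'} {H : Subgroup Γ}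
    {T : M →ₗ[k] M'} (hT : ∀ h ∈ H, ∀ m, T (σ h m) = σ' h (T m)) {m : M} (hm : m ∈ nul σ H) :
    T m ∈ nul σ' H := by
  obtain ⟨a, rfl⟩ := mem_nul.1 hm
  refine mem_nul.2 ⟨T a, ?_⟩
  rw [map_sum]
  exact Finset.sum_congr rfl fun h _ => (hT h h.2 a).symm

/-- A sum over a finite `H`-set of an equivariant function vanishing at all points with nontrivial
stabilizer is a trace. -/
lemma sum_mem_nul {σ : Representation k Γ M} {H : Subgroup Γ} {X : Type} [Fintype X]
    [MulAction H X] {F : X → M} (hF : ∀ (h : H) x, F (h • x) = σ h (F x))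
    (h0 : ∀ x (h : H), h • x = x → h ≠ 1 → F x = 0) : ∑ x, F x ∈ nul σ H := by
  rw [← Finset.sum_fiberwise Finset.univ (fun x => (Quotient.mk _ x : MulAction.orbitRel.Quotient H X))]
  refine Submodule.sum_mem _ fun ω _ => ?_
  induction ω using Quotient.inductionOn with | _ y =>
  by_cases hy : ∃ h : H, h • y = y ∧ h ≠ 1
  · obtain ⟨h, h1, h2⟩ := hy
    rw [Finset.sum_eq_zero]
    · exact zero_mem _
    · intro x hx
      obtain ⟨u, rfl⟩ := (Quotient.exact (Finset.mem_filter.1 hx).2 : MulAction.orbitRel H X x y)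
      show F (u • y) = 0
      rw [hF, h0 y h h1 h2, map_zero]
  · push Not at hy
    refine mem_nul.2 ⟨F y, ?_⟩
    refine Finset.sum_bij (fun h _ => h • y) ?_ ?_ ?_ ?_
    · intro h _
      simp only [Finset.mem_filter, Finset.mem_univ, true_and]
      exact Quotient.sound ⟨h, rfl⟩
    · intro a _ c _ hac
      have := hy (c⁻¹ * a) (by rw [mul_smul, hac, inv_smul_smul])
      exact (inv_mul_eq_one.1 this).symm
    · intro x hx
      obtain ⟨u, rfl⟩ := (Quotient.exact (Finset.mem_filter.1 hx).2 : MulAction.orbitRel H X x y)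
      exact ⟨u, Finset.mem_univ _, rfl⟩
    · intro h _
      exact (hF h y).symm

lemma nul_anti {σ : Representation k Γ M} {H K : Subgroup Γ} (hHK : H ≤ K) :
    nul σ K ≤ nul σ H := by
  intro m hm
  obtain ⟨a, rfl⟩ := mem_nul.1 hm
  let _ : MulAction H K := MulAction.compHom K (Subgroup.inclusion hHK)
  refine sum_mem_nul (X := K) (F := fun x => σ x a) (fun h x => ?_) (fun x h hx hne => ?_)
  · show σ ((Subgroup.inclusion hHK h * x : K) : Γ) a = _
    simp
  · exfalso
    have : Subgroup.inclusion hHK h * x = x := hx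
    rw [mul_eq_right] at this
    exact hne (Subgroup.inclusion_injective hHK (by simpa using this))

lemma qtr_sub_qtrOn_mem {σ : Representation k Γ M} {D N : Subgroup Γ} (hDN : D ≤ N)
    (hN : ∀ g, g ∉ N → ∀ d ∈ D, g⁻¹ * d * g ∈ D → d = 1) {m : M} (hm : ∀ d ∈ D, σ d m = m) :
    qtr σ D m - qtrOn σ D N m ∈ nul σ D := by
  have hF : ∀ g, ∀ d ∈ D, (if g * d ∈ N then 0 else σ (g * d) m) = if g ∈ N then 0 else σ g m := by
    intro g d hd
    rw [fix_right hm g d hd, if_congr (N.mul_mem_cancel_right (hDN hd)) rfl rfl]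
  have : qtr σ D m - qtrOn σ D N m = ∑ x : Γ ⧸ D, if x.out ∈ N then 0 else σ x.out m := by
    rw [qtr, qtrOn, ← Finset.sum_sub_distrib]
    refine Finset.sum_congr rfl fun x _ => ?_
    split_ifs <;> simp
  rw [this]
  refine sum_mem_nul (H := D) (fun h x => ?_) (fun x h hx hne => ?_)
  · induction x using QuotientGroup.induction_on with | _ y =>
    have e : h • (y : Γ ⧸ D) = ((h * y : Γ) : Γ ⧸ D) := rfl
    rw [e, apply_out_eq (F := fun g => if g ∈ N then 0 else σ g m) hF,
      apply_out_eq (F := fun g => if g ∈ N then 0 else σ g m) hF,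
      if_congr (N.mul_mem_cancel_left (hDN h.2)) rfl rfl]
    split_ifs <;> simp
  · rw [if_pos]
    by_contra hx'
    refine hne (Subtype.ext (hN _ hx' h h.2 ?_))
    have e : ((h * x.out : Γ) : Γ ⧸ D) = (x.out : Γ) := by
      rw [QuotientGroup.out_eq']; nth_rw 2 [← hx]; nth_rw 2 [← QuotientGroup.out_eq' x]; rfl
    have := D.inv_mem (QuotientGroup.eq.1 e)
    simpa [mul_assoc] using this

/-- The part over `N` of a relative trace, as a sum over cosets inside `N`. -/
lemma sum_subgroupOf {D N : Subgroup Γ} (hDN : D ≤ N) {F : Γ → M}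
    (hF : ∀ g, ∀ d ∈ D, F (g * d) = F g) :
    ∑ x : N ⧸ D.subgroupOf N, F (x.out : N) = ∑ x : Γ ⧸ D, if x.out ∈ N then F x.out else 0 := by
  rw [← Finset.sum_filter]
  refine Finset.sum_bij (fun x _ => ((x.out : N) : Γ)) ?_ ?_ ?_ ?_
  · intro x _
    obtain ⟨d, hd⟩ := QuotientGroup.mk_out_eq_mul D ((x.out : N) : Γ)
    simp only [Finset.mem_filter, Finset.mem_univ, true_and]
    rw [hd]
    exact N.mul_mem (x.out : N).2 (hDN d.2)
  · intro x _ y _ hxy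
    rw [← QuotientGroup.out_eq' x, ← QuotientGroup.out_eq' y]
    exact QuotientGroup.eq.2 (by simpa [Subgroup.mem_subgroupOf] using QuotientGroup.eq.1 hxy)
  · intro y hy
    have hy' := (Finset.mem_filter.1 hy).2
    refine ⟨((⟨y.out, hy'⟩ : N) : N ⧸ D.subgroupOf N), Finset.mem_univ _, ?_⟩
    conv_rhs => rw [← QuotientGroup.out_eq' y]
    refine QuotientGroup.eq.2 ?_
    have := QuotientGroup.eq.1 (QuotientGroup.out_eq' ((⟨y.out, hy'⟩ : N) : N ⧸ D.subgroupOf N))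
    simpa [Subgroup.mem_subgroupOf] using this
  · intro x _
    exact (apply_out_eq hF _).symm

end Traces

/-! ### A reciprocity formula for cocycles -/

section Cocycles

open scoped Classical

variable {k : Type} [Field k] {N : Type} [Group N] [Fintype N]

/-- The double coset of `g` with respect to the subgroup `D`. -/
def dcoset (D : Subgroup N) (g : N) : Set N := {x | ∃ d ∈ D, ∃ e ∈ D, x = d * g * e}

omit [Fintype N] in
lemma dcoset_eq_iff {D : Subgroup N} {g x : N} : dcoset D x = dcoset D g ↔ x ∈ dcoset D g := by
  constructor
  · rintro h
    rw [← h]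
    exact ⟨1, D.one_mem, 1, D.one_mem, by simp⟩
  · rintro ⟨d, hd, e, he, rfl⟩
    ext y
    constructor
    · rintro ⟨a, ha, c, hc, rfl⟩
      exact ⟨a * d, D.mul_mem ha hd, e * c, D.mul_mem he hc, by group⟩
    · rintro ⟨a, ha, c, hc, rfl⟩
      exact ⟨a * d⁻¹, D.mul_mem ha (D.inv_mem hd), e⁻¹ * c, D.mul_mem (D.inv_mem he) hc, by group⟩

omit [Fintype N] in
lemma dcoset_inv (D : Subgroup N) (g : N) : dcoset D g⁻¹ = (fun x => x⁻¹) ⁻¹' dcoset D g := by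
  ext y
  constructor
  · rintro ⟨a, ha, c, hc, rfl⟩
    exact ⟨c⁻¹, D.inv_mem hc, a⁻¹, D.inv_mem ha, by group⟩
  · rintro ⟨a, ha, c, hc, h⟩
    exact ⟨c⁻¹, D.inv_mem hc, a⁻¹, D.inv_mem ha, by
      have h : y⁻¹ = a * g * c := h
      rw [← inv_inv y, h]; group⟩

/-- Summation over the left cosets of a cyclic subgroup contained in a double coset. -/
lemma sum_dcoset {D : Subgroup N} {t : N} (hD : D = Subgroup.zpowers t) {F : N → k}
    (hF : ∀ g, ∀ d ∈ D, F (g * d) = F g) (g : N) :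
    ∑ y : N ⧸ D, (if dcoset (D) y.out =
        dcoset (D) g then F y.out else 0) =
      ∑ i ∈ Finset.range (Function.minimalPeriod (t⁻¹ • ·) (g : N ⧸ D)),
        F ((t ^ i)⁻¹ * g) := by
  subst hD
  rw [← Finset.sum_filter]
  symm
  have key : ∀ i : ℕ, (((t ^ i)⁻¹ * g : N) : N ⧸ Subgroup.zpowers t) =
      (t⁻¹ • ·)^[i] (g : N ⧸ Subgroup.zpowers t) := by
    intro i
    rw [smul_iterate, inv_pow]; rfl
  refine Finset.sum_bij (fun i _ => (((t ^ i)⁻¹ * g : N) : N ⧸ Subgroup.zpowers t)) ?_ ?_ ?_ ?_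
  · intro i _
    simp only [Finset.mem_filter, Finset.mem_univ, true_and]
    rw [dcoset_eq_iff]
    obtain ⟨d, hd⟩ := QuotientGroup.mk_out_eq_mul (Subgroup.zpowers t) ((t ^ i)⁻¹ * g)
    exact ⟨_, Subgroup.inv_mem _ (Subgroup.npow_mem_zpowers t i), d, d.2, hd⟩
  · intro i hi j hj hij
    simp only [key] at hij
    exact Function.iterate_injOn_Iio_minimalPeriod (by simpa using hi) (by simpa using hj) hij
  · intro y hy
    obtain ⟨d, hd, e, he, hy⟩ := dcoset_eq_iff.1 (Finset.mem_filter.1 hy).2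
    have hpos : 0 < Function.minimalPeriod (t⁻¹ • ·) (g : N ⧸ Subgroup.zpowers t) :=
      Function.minimalPeriod_pos_of_mem_periodicPts (Function.Injective.mem_periodicPts
        (MulAction.injective _) _)
    obtain ⟨m, hm⟩ : ∃ m : ℕ, (t⁻¹) ^ m = d := by
      rw [← Subgroup.zpowers_inv, ← mem_powers_iff_mem_zpowers] at hd
      exact hd
    refine ⟨m % Function.minimalPeriod (t⁻¹ • ·) (g : N ⧸ Subgroup.zpowers t),
      Finset.mem_range.2 (Nat.mod_lt _ hpos), ?_⟩
    rw [key, Function.iterate_mod_minimalPeriod_eq, ← key, ← QuotientGroup.out_eq' y, hy, ← inv_pow,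
      hm]
    exact QuotientGroup.eq.2 (by simpa [mul_assoc] using he)
  · intro i _
    exact (apply_out_eq hF _).symm

/-- The hypothesis that `χ` records the action of `N` on the subgroup of order `p` of `⟨t⟩`. -/
def IsModChar (t : N) (p n : ℕ) (χ : N →* k) : Prop :=
  ∀ (g : N) (a : ℕ), g * t ^ p ^ n * g⁻¹ = (t ^ p ^ n) ^ a → χ g = a

omit [Fintype N] in
lemma IsModChar.eq_one {t : N} {p n : ℕ} {χ : N →* k} (hχ : IsModChar t p n χ) :
    ∀ d ∈ Subgroup.zpowers t, χ d = 1 := by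
  rintro _ ⟨i, rfl⟩
  simp only
  have := hχ (t ^ i) 1 (by
    rw [pow_one, mul_inv_eq_iff_eq_mul, ← zpow_natCast, ← zpow_add, ← zpow_add, add_comm])
  simpa using this

lemma exists_pow_eq_gcd (t : N) (r : ℕ) :
    ∃ u : ℕ, t ^ (r * u) = t ^ Nat.gcd (orderOf t) r := by
  have : t ^ Nat.gcd (orderOf t) r ∈ Subgroup.zpowers (t ^ r) := by
    refine ⟨Nat.gcdB (orderOf t) r, ?_⟩
    simp only
    rw [← zpow_natCast, ← zpow_natCast t (Nat.gcd _ _), Nat.gcd_eq_gcd_ab, zpow_add, zpow_mul,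
      zpow_mul, zpow_natCast, zpow_natCast, pow_orderOf_eq_one]
    simp
  obtain ⟨u, hu⟩ := mem_powers_iff_mem_zpowers.2 this
  exact ⟨u, by rw [pow_mul]; exact hu⟩

lemma exists_conj_pow {t : N} {r : ℕ} {g : N} (h : g⁻¹ * t ^ r * g ∈ Subgroup.zpowers t) :
    ∃ a : ℕ, g * t ^ r * g⁻¹ = t ^ (r * a) := by
  obtain ⟨m, hm⟩ := (mem_powers_iff_mem_zpowers (x := t)).2 h
  have hm : t ^ m = g⁻¹ * t ^ r * g := hm
  have ho : orderOf (t ^ m) = orderOf (t ^ r) := by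
    have := orderOf_injective (MulAut.conj g⁻¹).toMonoidHom (MulAut.conj g⁻¹).injective (t ^ r)
    rw [← this, hm]
    simp
  have ht := orderOf_pos t
  have hg : Nat.gcd (orderOf t) m = Nat.gcd (orderOf t) r := by
    rw [orderOf_pow, orderOf_pow] at ho
    rw [← Nat.div_div_self (Nat.gcd_dvd_left (orderOf t) m) ht.ne', ho,
      Nat.div_div_self (Nat.gcd_dvd_left (orderOf t) r) ht.ne']
  obtain ⟨c, hc⟩ := Nat.gcd_dvd_right (orderOf t) r
  obtain ⟨u, hu⟩ := exists_pow_eq_gcd t m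
  have hr : t ^ r = (t ^ m) ^ (u * c) := by
    rw [pow_mul, ← pow_mul t, hu, hg, ← pow_mul, ← hc]
  refine ⟨u * c, ?_⟩
  rw [pow_mul, mul_inv_eq_iff_eq_mul]
  nth_rw 1 [hr]
  have := conj_pow (a := g⁻¹) (b := t ^ r) (i := u * c)
  rw [inv_inv] at this
  rw [hm, this]
  group

lemma isModChar_eq {p : ℕ} [Fact p.Prime] [CharP k p] {n : ℕ} {t : N} (ht : orderOf t = p ^ (n + 1))
    {χ : N →* k} (hχ : IsModChar t p n χ) {r a : ℕ} {g : N} (hr : t ^ r ≠ 1)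
    (h : g * t ^ r * g⁻¹ = t ^ (r * a)) : χ g = a := by
  have hr' : ¬ p ^ (n + 1) ∣ r := by rwa [← ht, orderOf_dvd_iff_pow_eq_one]
  have hd : Nat.gcd (p ^ (n + 1)) r ∣ p ^ n := by
    obtain ⟨j, hj, e⟩ := (Nat.dvd_prime_pow Fact.out).1 (Nat.gcd_dvd_left (p ^ (n + 1)) r)
    rw [e]
    refine pow_dvd_pow p (Nat.lt_succ_iff.1 (lt_of_le_of_ne hj ?_))
    rintro rfl
    exact hr' (e ▸ Nat.gcd_dvd_right _ _)
  obtain ⟨c, hc⟩ := hd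
  obtain ⟨u, hu⟩ := exists_pow_eq_gcd t r
  rw [ht] at hu
  have hz : t ^ p ^ n = (t ^ r) ^ (u * c) := by
    rw [hc, pow_mul, ← hu, ← pow_mul, ← pow_mul, mul_assoc]
  refine hχ g a ?_
  rw [hz, ← conj_pow, h, ← pow_mul, ← pow_mul, ← pow_mul]
  congr 1
  ring

variable {M M₁ M₂ : Type} [AddCommGroup M] [Module k M] [AddCommGroup M₁] [Module k M₁]
  [AddCommGroup M₂] [Module k M₂] {σ : Representation k N M} {σ₁ : Representation k N M₁}
  {σ₂ : Representation k N M₂}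

omit [Fintype N] in
lemma cocycle_pow {γ : N → M} (hγ : ∀ g h, γ (g * h) = γ g + σ g (γ h)) (t : N) (r : ℕ) :
    γ (t ^ r) = ∑ i ∈ Finset.range r, σ (t ^ i) (γ t) := by
  have h1 : γ 1 = 0 := by simpa using hγ 1 1
  induction r with
  | zero => simpa using h1
  | succ r ih => rw [pow_succ, hγ, ih, Finset.sum_range_succ]

/-- Reciprocity for the pairing of a cocycle with elements fixed by a cyclic `p`-subgroup. -/
lemma cocycle_reciprocity {p : ℕ} [Fact p.Prime] [CharP k p] {n : ℕ} {t : N}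
    (ht : orderOf t = p ^ (n + 1)) {χ : N →* k} (hχ : IsModChar t p n χ)
    {β : M →ₗ[k] M₁ →ₗ[k] M₂ →ₗ[k] k}
    (hβ : ∀ g x y w, β (σ g x) (σ₁ g y) (σ₂ g w) = β x y w)
    {γ : N → M} (hγ : ∀ g h, γ (g * h) = γ g + σ g (γ h)) {θ : M₁} {l : M₂}
    (hθ : ∀ d ∈ Subgroup.zpowers t, σ₁ d θ = θ) (hl : ∀ d ∈ Subgroup.zpowers t, σ₂ d l = l) :
    ∑ y : N ⧸ Subgroup.zpowers t, β (γ t) (σ₁ y.out θ) l =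
      ∑ y : N ⧸ Subgroup.zpowers t, χ y.out * β (γ t) θ (σ₂ y.out l) := by
  set D := Subgroup.zpowers t with hD
  have h1 : γ 1 = 0 := by simpa using hγ 1 1
  have hχD : ∀ d ∈ D, χ d = 1 := hχ.eq_one
  have hA : ∀ g, ∀ d ∈ D, β (γ t) (σ₁ (g * d) θ) l = β (γ t) (σ₁ g θ) l := by
    intro g d hd
    rw [fix_right hθ g d hd]
  have hC : ∀ g, ∀ d ∈ D, χ (g * d) * β (γ t) θ (σ₂ (g * d) l) = χ g * β (γ t) θ (σ₂ g l) := by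
    intro g d hd
    rw [fix_right hl g d hd, map_mul, hχD d hd, mul_one]
  let e : Set N ≃ Set N := ⟨fun s => (fun x => x⁻¹) ⁻¹' s, fun s => (fun x => x⁻¹) ⁻¹' s,
    fun s => by ext; simp, fun s => by ext; simp⟩
  rw [← Finset.sum_fiberwise Finset.univ (fun y : N ⧸ D => dcoset D y.out),
    ← Finset.sum_fiberwise Finset.univ (fun y : N ⧸ D => dcoset D y.out)]
  refine Fintype.sum_equiv e _ _ fun s => ?_
  rw [Finset.sum_filter, Finset.sum_filter]
  by_cases hs : ∃ g, s = dcoset D g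
  · obtain ⟨g, rfl⟩ := hs
    have e1 : e (dcoset D g) = dcoset D g⁻¹ := (dcoset_inv D g).symm
    rw [e1, sum_dcoset hD (F := fun g => β (γ t) (σ₁ g θ) l) hA,
      sum_dcoset hD (F := fun g => χ g * β (γ t) θ (σ₂ g l)) hC]
    have hper : ∀ (g : N) (r : ℕ), Function.IsPeriodicPt (t⁻¹ • ·) r (g : N ⧸ D) ↔
        g⁻¹ * t ^ r * g ∈ D := by
      intro g r
      rw [Function.IsPeriodicPt, Function.IsFixedPt, smul_iterate]
      show (((t⁻¹) ^ r * g : N) : N ⧸ D) = g ↔ _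
      rw [QuotientGroup.eq]
      simp [mul_assoc]
    have hper' : ∀ (g : N) (r : ℕ), Function.IsPeriodicPt (t⁻¹ • ·) r (g : N ⧸ D) →
        Function.IsPeriodicPt (t⁻¹ • ·) r ((g⁻¹ : N) : N ⧸ D) := by
      intro g r h
      obtain ⟨a, ha⟩ := exists_conj_pow ((hper g r).1 h)
      rw [hper, inv_inv, ha]
      exact Subgroup.npow_mem_zpowers t _
    have hr : Function.minimalPeriod (t⁻¹ • ·) ((g⁻¹ : N) : N ⧸ D) =
        Function.minimalPeriod (t⁻¹ • ·) (g : N ⧸ D) := by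
      rw [Function.minimalPeriod_eq_minimalPeriod_iff]
      exact fun r => ⟨fun h => by simpa using hper' g⁻¹ r h, hper' g r⟩
    rw [hr]
    set r := Function.minimalPeriod (t⁻¹ • ·) (g : N ⧸ D)
    have hgr : g⁻¹ * t ^ r * g ∈ D := (hper g r).1 (Function.isPeriodicPt_minimalPeriod _ _)
    have hinv : ∀ v ∈ D, g⁻¹ * v * g ∈ D → ∀ X, β (σ v X) (σ₁ g θ) l = β X (σ₁ g θ) l := by
      intro v hv hgv X
      conv_rhs => rw [← hβ v]
      rw [hl v hv, ← Module.End.mul_apply, ← map_mul]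
      conv_rhs => rw [show v * g = g * (g⁻¹ * v * g) by group, fix_right hθ _ _ hgv]
    have hL : ∑ i ∈ Finset.range r, β (γ t) (σ₁ ((t ^ i)⁻¹ * g) θ) l =
        β (γ (t ^ r)) (σ₁ g θ) l := by
      rw [cocycle_pow hγ, map_sum, LinearMap.sum_apply, LinearMap.sum_apply]
      refine Finset.sum_congr rfl fun i _ => ?_
      rw [← hβ (t ^ i), hl _ (Subgroup.npow_mem_zpowers t i), ← Module.End.mul_apply, ← map_mul]
      simp
    have hR : ∑ i ∈ Finset.range r, χ ((t ^ i)⁻¹ * g⁻¹) * β (γ t) θ (σ₂ ((t ^ i)⁻¹ * g⁻¹) l) =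
        χ g⁻¹ * β (σ g (γ (t ^ r))) (σ₁ g θ) l := by
      rw [cocycle_pow hγ, map_sum, map_sum, LinearMap.sum_apply, LinearMap.sum_apply,
        Finset.mul_sum]
      refine Finset.sum_congr rfl fun i _ => ?_
      rw [map_mul, hχD _ (Subgroup.inv_mem _ (Subgroup.npow_mem_zpowers t i)), one_mul]
      conv_lhs => rw [← hβ (t ^ i), hθ _ (Subgroup.npow_mem_zpowers t i), ← hβ g,
        ← Module.End.mul_apply (σ₂ (t ^ i)), ← map_mul, mul_inv_cancel_left,
        ← Module.End.mul_apply (σ₂ g), ← map_mul, mul_inv_cancel, map_one, Module.End.one_apply]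
    rw [hL, hR]
    by_cases htr : t ^ r = 1
    · simp [htr, h1]
    obtain ⟨a, ha⟩ := exists_conj_pow hgr
    have hχa := isModChar_eq ht hχ htr ha
    have hconj : ∀ j, g⁻¹ * (t ^ r) ^ j * g ∈ D := by
      intro j
      have := D.pow_mem hgr j
      have e2 : (g⁻¹ * t ^ r * g) ^ j = g⁻¹ * (t ^ r) ^ j * g := by
        have := conj_pow (a := g⁻¹) (b := t ^ r) (i := j)
        simpa using this
      rwa [e2] at this
    have e3 : σ g (γ (t ^ r)) = γ (t ^ (r * a)) + σ (t ^ (r * a)) (γ g) - γ g := by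
      have := hγ g (t ^ r)
      rw [mul_inv_eq_iff_eq_mul.1 ha, hγ] at this
      rw [this]; abel
    have e4 : β (γ (t ^ (r * a))) (σ₁ g θ) l = a * β (γ (t ^ r)) (σ₁ g θ) l := by
      rw [pow_mul, cocycle_pow hγ, map_sum, LinearMap.sum_apply, LinearMap.sum_apply,
        Finset.sum_congr rfl (fun j _ => hinv ((t ^ r) ^ j)
          (D.pow_mem (Subgroup.npow_mem_zpowers t r) j) (hconj j) (γ (t ^ r)))]
      simp
    have e5 : β (σ (t ^ (r * a)) (γ g)) (σ₁ g θ) l = β (γ g) (σ₁ g θ) l :=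
      hinv _ (Subgroup.npow_mem_zpowers t _) (by
        rw [← ha]
        have : t ^ r ∈ D := Subgroup.npow_mem_zpowers t r
        simpa [mul_assoc] using this) _
    rw [e3, map_sub, map_add, LinearMap.sub_apply, LinearMap.add_apply, LinearMap.sub_apply,
      LinearMap.add_apply, e4, e5, add_sub_cancel_right, ← mul_assoc, ← hχa, ← map_mul]
    simp
  · rw [Finset.sum_eq_zero, Finset.sum_eq_zero]
    · intro y _
      rw [if_neg]
      intro h
      refine hs ⟨y.out⁻¹, ?_⟩
      rw [dcoset_inv, h]
      ext; simp [e]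
    · intro y _
      rw [if_neg]
      exact fun h => hs ⟨_, h.symm⟩

end Cocycles

section CocyclePairing

open scoped Classical

variable {k : Type} [Field k] {N : Type} [Group N] [Fintype N]
  {W E : Type} [AddCommGroup W] [Module k W] [Module.Finite k W]
  [AddCommGroup E] [Module k E] [Module.Finite k E]

/-- The trace pairing `(X, θ, l) ↦ tr (X ∘ θ ∘ l)`. -/
noncomputable def trForm : (W →ₗ[k] E) →ₗ[k] (W →ₗ[k] W) →ₗ[k] (E →ₗ[k] W) →ₗ[k] k :=
  LinearMap.mk₂ k (fun X θ => LinearMap.trace k E ∘ₗ LinearMap.llcomp k E W E (X ∘ₗ θ))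
    (fun _ _ _ => by ext; simp [LinearMap.add_comp]) (fun _ _ _ => by ext; simp [LinearMap.smul_comp])
    (fun _ _ _ => by ext; simp [LinearMap.comp_add])
    (fun _ _ _ => by ext; simp [LinearMap.comp_smul])

omit [Module.Finite k W] [Module.Finite k E] in
lemma trForm_apply (X : W →ₗ[k] E) (θ : W →ₗ[k] W) (l : E →ₗ[k] W) :
    trForm X θ l = LinearMap.trace k E (X ∘ₗ θ ∘ₗ l) := rfl

omit [Module.Finite k W] in
lemma eq_zero_of_trace {l : E →ₗ[k] W}
    (h : ∀ X : W →ₗ[k] E, LinearMap.trace k E (X ∘ₗ l) = 0) : l = 0 := by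
  ext e
  by_contra he
  obtain ⟨f, hf⟩ := Module.Projective.exists_dual_ne_zero k (x := l e) he
  have e1 : f.smulRight e ∘ₗ l = (f ∘ₗ l).smulRight e := by ext; simp
  have := h (f.smulRight e)
  rw [e1, LinearMap.trace_smulRight] at this
  exact hf this

/-- Every functional on `Hom(W, E)` is given by the trace pairing. -/
lemma exists_trace_eq (φ : (W →ₗ[k] E) →ₗ[k] k) :
    ∃ l : E →ₗ[k] W, ∀ X, φ X = LinearMap.trace k E (X ∘ₗ l) := by
  let T : (E →ₗ[k] W) →ₗ[k] ((W →ₗ[k] E) →ₗ[k] k) := (trForm.flip LinearMap.id).flip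
  have hT : ∀ l X, T l X = LinearMap.trace k E (X ∘ₗ l) := fun l X => rfl
  have hinj : Function.Injective T := by
    rw [injective_iff_map_eq_zero]
    exact fun l hl => eq_zero_of_trace fun X => by rw [← hT, hl, LinearMap.zero_apply]
  have hs : Function.Surjective T := by
    rw [← LinearMap.injective_iff_surjective_of_finrank_eq_finrank]
    · exact hinj
    · simp [Module.finrank_linearMap, mul_comm]
  obtain ⟨l, rfl⟩ := hs φ
  exact ⟨l, hT l⟩

lemma cocycle_coboundary {p : ℕ} [Fact p.Prime] [CharP k p] {n : ℕ} {t : N}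
    (ht : orderOf t = p ^ (n + 1)) {χ : N →* k} (hχ : IsModChar t p n χ)
    {ρ : Representation k N W} {τ : Representation k N E} {θ : W →ₗ[k] W}
    (hθ : ∀ d ∈ Subgroup.zpowers t, ρ.linHom ρ d θ = θ)
    (hθ1 : qtr (ρ.linHom ρ) (Subgroup.zpowers t) θ = LinearMap.id)
    {γ : N → W →ₗ[k] E} (hγ : ∀ g h, γ (g * h) = γ g + ρ.linHom τ g (γ h))
    (h0 : ∀ Λ : E →ₗ[k] W, (∀ g, Λ ∘ₗ τ g = χ g • ρ g ∘ₗ Λ) →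
      LinearMap.trace k E (γ t ∘ₗ θ ∘ₗ Λ) = 0) :
    ∃ η : W →ₗ[k] E, ∀ g, γ g = ρ.linHom τ g η - η := by
  set σ := ρ.linHom τ with hσ
  set σ₁ := ρ.linHom ρ with hσ₁
  set σ₂ := τ.linHom ρ with hσ₂
  have hcomp : ∀ g (X : W →ₗ[k] E) (y : W →ₗ[k] W), σ g X ∘ₗ σ₁ g y = σ g (X ∘ₗ y) := by
    intro g X y; ext; simp [hσ, hσ₁]
  have hβ : ∀ g (x : W →ₗ[k] E) (y : W →ₗ[k] W) (w : E →ₗ[k] W),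
      trForm (σ g x) (σ₁ g y) (σ₂ g w) = trForm x y w := by
    intro g x y w
    rw [trForm_apply, trForm_apply]
    have : σ g x ∘ₗ σ₁ g y ∘ₗ σ₂ g w = τ g ∘ₗ ((x ∘ₗ y ∘ₗ w) ∘ₗ τ g⁻¹) := by
      ext; simp [hσ, hσ₁, hσ₂]
    rw [this, LinearMap.trace_comp_comm']
    congr 1
    ext; simp
  have hpair : ∀ l : E →ₗ[k] W, (∀ d ∈ Subgroup.zpowers t, σ₂ d l = l) →
      LinearMap.trace k E (γ t ∘ₗ l) = 0 := by
    intro l hl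
    have hrec := cocycle_reciprocity ht hχ (β := trForm) hβ hγ hθ hl
    let σ' : Representation k N (E →ₗ[k] W) :=
      { toFun := fun g => χ g • σ₂ g
        map_one' := by simp
        map_mul' := fun g h => by rw [map_mul, map_mul, smul_mul_smul_comm] }
    have hl' : ∀ d ∈ Subgroup.zpowers t, σ' d l = l := by
      intro d hd
      show χ d • σ₂ d l = l
      rw [hχ.eq_one d hd, one_smul, hl d hd]
    have e1 : ∑ y : N ⧸ Subgroup.zpowers t, trForm (γ t) (σ₁ y.out θ) l =
        LinearMap.trace k E (γ t ∘ₗ l) := by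
      rw [← LinearMap.sum_apply, ← map_sum]
      have : ∑ y : N ⧸ Subgroup.zpowers t, σ₁ y.out θ = LinearMap.id := hθ1
      rw [this]; rfl
    have e2 : ∑ y : N ⧸ Subgroup.zpowers t, χ y.out * trForm (γ t) θ (σ₂ y.out l) =
        LinearMap.trace k E (γ t ∘ₗ θ ∘ₗ qtr σ' (Subgroup.zpowers t) l) := by
      rw [← trForm_apply, qtr, map_sum]
      refine Finset.sum_congr rfl fun y _ => ?_
      show _ = trForm (γ t) θ (χ y.out • σ₂ y.out l)
      rw [map_smul, smul_eq_mul]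
    rw [← e1, hrec, e2]
    refine h0 _ fun g => ?_
    conv_lhs => rw [← qtr_fixed hl' g]
    show (χ g • σ₂ g _) ∘ₗ τ g = _
    ext; simp [hσ₂]
  obtain ⟨η', hη'⟩ : ∃ η', σ t η' - η' = γ t := by
    by_contra hne
    have hne' : γ t ∉ LinearMap.range (σ t - LinearMap.id) := by
      rintro ⟨a, ha⟩; exact hne ⟨a, ha⟩
    obtain ⟨φ, hφ1, hφ2⟩ := Submodule.exists_dual_map_eq_bot_of_notMem hne' inferInstance
    obtain ⟨l, hl⟩ := exists_trace_eq φ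
    have hφσ : ∀ X, φ (σ t X) = φ X := by
      intro X
      have : φ (σ t X - X) ∈ (LinearMap.range (σ t - LinearMap.id)).map φ := ⟨_, ⟨X, rfl⟩, rfl⟩
      rwa [hφ2, Submodule.mem_bot, map_sub, sub_eq_zero] at this
    have hlt : σ₂ t l = l := by
      rw [← sub_eq_zero]
      refine eq_zero_of_trace fun X => ?_
      have e1 := hβ t (σ t⁻¹ X) LinearMap.id l
      rw [← Module.End.mul_apply, ← map_mul, mul_inv_cancel, map_one, Module.End.one_apply,
        trForm_apply, trForm_apply, LinearMap.id_comp, ← hl, ← hφσ, ← Module.End.mul_apply (σ t),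
        ← map_mul, mul_inv_cancel, map_one, Module.End.one_apply, hl] at e1
      have e2 : σ₁ t LinearMap.id = LinearMap.id := by ext; simp [hσ₁]
      rw [e2, LinearMap.id_comp] at e1
      rw [LinearMap.comp_sub, map_sub, e1, sub_self]
    refine hφ1 ?_
    rw [hl]
    refine hpair l fun d hd => ?_
    obtain ⟨i, rfl⟩ := mem_powers_iff_mem_zpowers.2 hd
    simp only
    rw [map_pow]
    rw [Module.End.pow_apply]
    exact Function.iterate_fixed hlt i
  set γ' : N → W →ₗ[k] E := fun g => γ g - (σ g η' - η') with hγ'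
  have hco : ∀ g h, γ' (g * h) = γ' g + σ g (γ' h) := by
    intro g h
    simp only [hγ', hγ, map_mul, Module.End.mul_apply, map_sub]
    abel
  have hD : ∀ d ∈ Subgroup.zpowers t, γ' d = 0 := by
    intro d hd
    obtain ⟨i, rfl⟩ := mem_powers_iff_mem_zpowers.2 hd
    simp only
    rw [cocycle_pow hco]
    simp [hγ', hη']
  have hright : ∀ g, ∀ d ∈ Subgroup.zpowers t, γ' (g * d) ∘ₗ σ₁ (g * d) θ = γ' g ∘ₗ σ₁ g θ := by
    intro g d hd
    rw [fix_right hθ g d hd, hco, hD d hd, map_zero, add_zero]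
  set ζ := ∑ x : N ⧸ Subgroup.zpowers t, γ' x.out ∘ₗ σ₁ x.out θ with hζ
  have hmain : ∀ g, γ' g = ζ - σ g ζ := by
    intro g
    have e1 := sum_coset_smul (F := fun x => γ' x ∘ₗ σ₁ x θ) hright g
    simp only [hco, LinearMap.add_comp, Finset.sum_add_distrib] at e1
    rw [← hζ] at e1
    rw [eq_sub_iff_add_eq]
    refine Eq.trans ?_ e1
    rw [hζ, map_sum]
    congr 1
    · have e2 : ∑ y : N ⧸ Subgroup.zpowers t, σ₁ (g * y.out) θ = LinearMap.id := by
        simp only [map_mul, Module.End.mul_apply]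
        rw [← map_sum]
        have : ∑ y : N ⧸ Subgroup.zpowers t, σ₁ y.out θ = LinearMap.id := hθ1
        rw [this]
        ext; simp [hσ₁]
      ext w
      have e3 := congrArg (γ' g) (LinearMap.congr_fun e2 w)
      simp only [LinearMap.sum_apply, map_sum, LinearMap.id_apply] at e3
      simpa [LinearMap.sum_apply] using e3.symm
    · refine Finset.sum_congr rfl fun x _ => ?_
      rw [map_mul, Module.End.mul_apply, hcomp]
  refine ⟨η' - ζ, fun g => ?_⟩
  have := hmain g
  simp only [hγ'] at this
  rw [sub_eq_iff_eq_add] at this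
  rw [this, map_sub]
  abel

end CocyclePairing

section ChainModules

variable {k A : Type} [Field k] [Ring A] [Algebra k A]

/-- A module whose submodules form a chain. -/
def IsChainMod (A M : Type) [Ring A] [AddCommGroup M] [Module A M] : Prop :=
  ∀ S T : Submodule A M, S ≤ T ∨ T ≤ S

/-- A module with a greatest proper submodule. -/
def IsLocalMod (A M : Type) [Ring A] [AddCommGroup M] [Module A M] : Prop :=
  ∃ K : Submodule A M, K ≠ ⊤ ∧ ∀ S : Submodule A M, S ≠ ⊤ → S ≤ K

/-- A module on which the element `c` acts injectively. -/
def ActsInj (c : A) (M : Type) [AddCommGroup M] [Module A M] : Prop :=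
  ∀ m : M, c • m = 0 → m = 0

section FiniteDim

variable (k)
variable {M M' : Type} [AddCommGroup M] [Module k M] [Module A M] [IsScalarTower k A M]
  [AddCommGroup M'] [Module k M'] [Module A M'] [IsScalarTower k A M']

lemma finite_sub [Module.Finite k M] (S : Submodule A M) : Module.Finite k S :=
  inferInstanceAs (Module.Finite k (S.restrictScalars k))

lemma isNoetherian_of_fd [Module.Finite k M] : IsNoetherian A M := isNoetherian_of_tower k inferInstance

lemma isArtinian_of_fd [Module.Finite k M] : IsArtinian A M := isArtinian_of_tower k inferInstance

lemma finrank_lt_of_lt_sub [Module.Finite k M] {S T : Submodule A M} (h : S < T) :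
    Module.finrank k S < Module.finrank k T :=
  Submodule.finrank_lt_finrank_of_lt (s := S.restrictScalars k) (t := T.restrictScalars k) h

lemma finrank_le_sub [Module.Finite k M] (S : Submodule A M) :
    Module.finrank k S ≤ Module.finrank k M :=
  Submodule.finrank_le (S.restrictScalars k)

lemma finrank_ker_add_range [Module.Finite k M] (f : M →ₗ[A] M') :
    Module.finrank k (LinearMap.ker f) + Module.finrank k (LinearMap.range f) =
      Module.finrank k M := by
  rw [add_comm]
  exact LinearMap.finrank_range_add_finrank_ker (f.restrictScalars k)

lemma finrank_le_of_surj [Module.Finite k M] (f : M →ₗ[A] M') (hf : Function.Surjective f) :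
    Module.finrank k M' ≤ Module.finrank k M :=
  LinearMap.finrank_le_finrank_of_surjective (f := f.restrictScalars k) hf

lemma finrank_le_of_inj [Module.Finite k M'] (f : M →ₗ[A] M') (hf : Function.Injective f) :
    Module.finrank k M ≤ Module.finrank k M' :=
  LinearMap.finrank_le_finrank_of_injective (f := f.restrictScalars k) hf

lemma surj_of_inj_of_le [Module.Finite k M] [Module.Finite k M'] (f : M →ₗ[A] M')
    (hf : Function.Injective f) (h : Module.finrank k M' ≤ Module.finrank k M) :
    Function.Surjective f :=
  (LinearMap.injective_iff_surjective_of_finrank_eq_finrank (f := f.restrictScalars k)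
    (le_antisymm (finrank_le_of_inj k f hf) h)).1 hf

lemma inj_of_surj_of_le [Module.Finite k M] [Module.Finite k M'] (f : M →ₗ[A] M')
    (hf : Function.Surjective f) (h : Module.finrank k M ≤ Module.finrank k M') :
    Function.Injective f :=
  (LinearMap.injective_iff_surjective_of_finrank_eq_finrank (f := f.restrictScalars k)
    (le_antisymm h (finrank_le_of_surj k f hf))).2 hf

lemma ActsInj.of_injective {c : A} (h : ActsInj c M') (f : M →ₗ[A] M') (hf : Function.Injective f) :
    ActsInj c M := fun m hm => hf <| by
  rw [map_zero]; apply h; rw [← map_smul, hm, map_zero]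

lemma ActsInj.surj [Module.Finite k M] {c : A} (hc : ∀ a : A, a * c = c * a) (h : ActsInj c M)
    (m : M) : ∃ m', c • m' = m := by
  let f : M →ₗ[A] M :=
    { toFun := fun m => c • m
      map_add' := by simp
      map_smul' := fun a m => by simp [smul_smul, hc] }
  exact surj_of_inj_of_le k f ((injective_iff_map_eq_zero f).2 h) le_rfl m

lemma ActsInj.of_surjective [Module.Finite k M] {c : A} (hc : ∀ a : A, a * c = c * a)
    (h : ActsInj c M) (f : M →ₗ[A] M') (hf : Function.Surjective f) : ActsInj c M' := by
  have : Module.Finite k M' := Module.Finite.of_surjective (f.restrictScalars k) hf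
  let g : M' →ₗ[A] M' :=
    { toFun := fun m => c • m
      map_add' := by simp
      map_smul' := fun a m => by simp [smul_smul, hc] }
  have hg : Function.Surjective g := by
    intro m'
    obtain ⟨m, rfl⟩ := hf m'
    obtain ⟨m1, rfl⟩ := h.surj k hc m
    exact ⟨f m1, by simp [g]⟩
  have := inj_of_surj_of_le k g hg le_rfl
  exact fun m hm => this (by rw [map_zero]; exact hm)

lemma bijective_of_not_isNilpotent [Module.Finite k M] (hM : IndecMod A M) {f : Module.End A M}
    (hf : ¬ IsNilpotent f) : Function.Bijective f := by
  have := isNoetherian_of_fd (A := A) k (M := M)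
  have := isArtinian_of_fd (A := A) k (M := M)
  obtain ⟨n, hn⟩ := (LinearMap.eventually_isCompl_ker_pow_range_pow f).exists_forall_of_atTop
  rcases hM.2 _ _ (hn (n + 1) (Nat.le_succ n)) with h | h
  · have hi : Function.Injective f := by
      rw [LinearMap.ker_eq_bot] at h
      rw [pow_succ] at h
      exact Function.Injective.of_comp (f := ⇑(f ^ n)) h
    exact ⟨hi, surj_of_inj_of_le k f hi le_rfl⟩
  · exact absurd ⟨n + 1, LinearMap.range_eq_bot.1 h⟩ hf

end FiniteDim

end ChainModules

section Nakayama

variable {k A : Type} [Field k] [Ring A] [Algebra k A]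

lemma IsChainMod.of_injective {M M' : Type} [AddCommGroup M] [Module A M] [AddCommGroup M']
    [Module A M'] (h : IsChainMod A M') (f : M →ₗ[A] M') (hf : Function.Injective f) :
    IsChainMod A M := by
  intro S T
  rcases h (S.map f) (T.map f) with h | h
  · exact Or.inl ((Submodule.map_le_map_iff_of_injective hf _ _).1 h)
  · exact Or.inr ((Submodule.map_le_map_iff_of_injective hf _ _).1 h)

lemma IsChainMod.of_surjective {M M' : Type} [AddCommGroup M] [Module A M] [AddCommGroup M']
    [Module A M'] (h : IsChainMod A M) (f : M →ₗ[A] M') (hf : Function.Surjective f) :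
    IsChainMod A M' := by
  intro S T
  rcases h (S.comap f) (T.comap f) with h | h
  · exact Or.inl ((Submodule.comap_le_comap_iff_of_surjective hf).1 h)
  · exact Or.inr ((Submodule.comap_le_comap_iff_of_surjective hf).1 h)

/-- Over the class of finite dimensional modules on which `c` is injective, greatest proper
submodules have at most one maximal submodule. -/
def UniqueCoatoms (k A : Type) [Field k] [Ring A] [Algebra k A] (c : A) : Prop :=
  ∀ (Y : Type) [AddCommGroup Y] [Module k Y] [Module A Y] [IsScalarTower k A Y]
    [Module.Finite k Y], ActsInj c Y → ∀ K : Submodule A Y, K ≠ ⊤ →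
    (∀ S : Submodule A Y, S ≠ ⊤ → S ≤ K) →
    ∀ S T : Submodule A K, IsCoatom S → IsCoatom T → S = T

/-- Over the class of finite dimensional modules on which `c` is injective, the quotient by
a least nonzero submodule has at most one minimal submodule. -/
def UniqueAtoms (k A : Type) [Field k] [Ring A] [Algebra k A] (c : A) : Prop :=
  ∀ (Y : Type) [AddCommGroup Y] [Module k Y] [Module A Y] [IsScalarTower k A Y]
    [Module.Finite k Y], ActsInj c Y → ∀ W : Submodule A Y, W ≠ ⊥ →
    (∀ S : Submodule A Y, S ≠ ⊥ → W ≤ S) →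
    ∀ S T : Submodule A (Y ⧸ W), IsAtom S → IsAtom T → S = T

lemma isChainMod_of_isLocalMod {c : A} (hL : UniqueCoatoms k A c) (n : ℕ) :
    ∀ (Y : Type) [AddCommGroup Y] [Module k Y] [Module A Y] [IsScalarTower k A Y]
    [Module.Finite k Y], Module.finrank k Y ≤ n → ActsInj c Y → IsLocalMod A Y →
    IsChainMod A Y := by
  induction n with
  | zero =>
    intro Y _ _ _ _ _ hn _ _ S T
    have : Subsingleton Y := Module.finrank_zero_iff.1 (Nat.le_zero.1 hn)
    exact Or.inl fun x _ => by rw [Subsingleton.elim x 0]; exact T.zero_mem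
  | succ n ih =>
    intro Y _ _ _ _ _ hn hY ⟨K, hK, hmax⟩
    have := finite_sub k K
    have := isNoetherian_of_fd (A := A) k (M := K)
    have hKc : IsChainMod A K := by
      rcases subsingleton_or_nontrivial K with h | h
      · intro S T
        exact Or.inl fun x _ => by rw [Subsingleton.elim x 0]; exact T.zero_mem
      obtain ⟨L, hL1, -⟩ := (eq_top_or_exists_le_coatom (⊥ : Submodule A K)).resolve_left bot_ne_top
      refine ih K ?_ (hY.of_injective K.subtype K.injective_subtype) ⟨L, hL1.1, fun S hS => ?_⟩
      · have := finrank_lt_of_lt_sub k (lt_top_iff_ne_top.2 hK)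
        have := finrank_le_sub k (⊤ : Submodule A Y)
        omega
      · obtain ⟨L', hL', hS'⟩ := (eq_top_or_exists_le_coatom S).resolve_left hS
        rwa [hL Y hY K hK hmax L L' hL1 hL']
    intro S T
    by_cases hS : S = ⊤
    · exact Or.inr (hS ▸ le_top)
    by_cases hT : T = ⊤
    · exact Or.inl (hT ▸ le_top)
    have hS' := hmax S hS
    have hT' := hmax T hT
    rcases hKc (S.comap K.subtype) (T.comap K.subtype) with h | h
    · exact Or.inl fun x hx => h (x := ⟨x, hS' hx⟩) hx
    · exact Or.inr fun x hx => h (x := ⟨x, hT' hx⟩) hx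

lemma isChainMod_of_least {c : A} (hc : ∀ a : A, a * c = c * a) (hR : UniqueAtoms k A c) (n : ℕ) :
    ∀ (Y : Type) [AddCommGroup Y] [Module k Y] [Module A Y] [IsScalarTower k A Y]
    [Module.Finite k Y], Module.finrank k Y ≤ n → ActsInj c Y →
    (∃ W : Submodule A Y, W ≠ ⊥ ∧ ∀ S : Submodule A Y, S ≠ ⊥ → W ≤ S) →
    IsChainMod A Y := by
  induction n with
  | zero =>
    intro Y _ _ _ _ _ hn _ _ S T
    have : Subsingleton Y := Module.finrank_zero_iff.1 (Nat.le_zero.1 hn)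
    exact Or.inl fun x _ => by rw [Subsingleton.elim x 0]; exact T.zero_mem
  | succ n ih =>
    intro Y _ _ _ _ _ hn hY ⟨W, hW, hmin⟩
    have := isArtinian_of_fd (A := A) k (M := Y ⧸ W)
    have hWc : IsChainMod A (Y ⧸ W) := by
      rcases subsingleton_or_nontrivial (Y ⧸ W) with h | h
      · intro S T
        exact Or.inl fun x _ => by rw [Subsingleton.elim x 0]; exact T.zero_mem
      obtain ⟨L, hL1, -⟩ :=
        (eq_bot_or_exists_atom_le (⊤ : Submodule A (Y ⧸ W))).resolve_left top_ne_bot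
      refine ih (Y ⧸ W) ?_ (hY.of_surjective k hc W.mkQ W.mkQ_surjective)
        ⟨L, hL1.1, fun S hS => ?_⟩
      · have h1 := finrank_ker_add_range k W.mkQ
        rw [Submodule.ker_mkQ, Submodule.range_mkQ] at h1
        have h2 := finrank_lt_of_lt_sub k (bot_lt_iff_ne_bot.2 hW)
        have h3 : Module.finrank k (Y ⧸ W) ≤ Module.finrank k (⊤ : Submodule A (Y ⧸ W)) :=
          finrank_le_of_inj k (Submodule.topEquiv (R := A) (M := Y ⧸ W)).symm.toLinearMap
            (LinearEquiv.injective _)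
        omega
      · obtain ⟨L', hL', hS'⟩ := (eq_bot_or_exists_atom_le S).resolve_left hS
        rwa [hR Y hY W hW hmin L L' hL1 hL']
    intro S T
    by_cases hS : S = ⊥
    · exact Or.inl (hS ▸ bot_le)
    by_cases hT : T = ⊥
    · exact Or.inr (hT ▸ bot_le)
    have hS' := hmin S hS
    have hT' := hmin T hT
    have key : ∀ S : Submodule A Y, W ≤ S → (S.map W.mkQ).comap W.mkQ = S := fun S h => by
      rw [Submodule.comap_map_mkQ, sup_eq_right.2 h]
    rcases hWc (S.map W.mkQ) (T.map W.mkQ) with h | h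
    · left
      rw [← key S hS', ← key T hT']
      exact Submodule.comap_mono h
    · right
      rw [← key S hS', ← key T hT']
      exact Submodule.comap_mono h

lemma exists_coatom_of_chain {I : Type} [AddCommGroup I] [Module k I] [Module A I]
    [IsScalarTower k A I] [Module.Finite k I] [Nontrivial I] (hI : IsChainMod A I) :
    ∃ C : Submodule A I, C ≠ ⊤ ∧ ∀ S : Submodule A I, S ≠ ⊤ → S ≤ C := by
  have := isNoetherian_of_fd (A := A) k (M := I)
  obtain ⟨C, hC, -⟩ := (eq_top_or_exists_le_coatom (⊥ : Submodule A I)).resolve_left bot_ne_top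
  refine ⟨C, hC.1, fun S hS => ?_⟩
  rcases hI S C with h | h
  · exact h
  · exact (hC.le_iff.1 h).elim (fun h => absurd h hS) (fun h => h.le)

/-- A surjection onto a nonzero chain module restricts to a surjection from a local submodule. -/
lemma exists_local_surj {Y I : Type} [AddCommGroup Y] [Module k Y] [Module A Y]
    [IsScalarTower k A Y] [Module.Finite k Y] [AddCommGroup I] [Module k I] [Module A I]
    [IsScalarTower k A I] [Module.Finite k I] [Nontrivial I] (hI : IsChainMod A I)
    (g : Y →ₗ[A] I) (P : Submodule A Y) (hP : P.map g = ⊤) :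
    ∃ X ≤ P, X.map g = ⊤ ∧ IsLocalMod A X := by
  have := isArtinian_of_fd (A := A) k (M := Y)
  obtain ⟨C, hC, hmax⟩ := exists_coatom_of_chain (k := k) hI
  obtain ⟨X, ⟨hXP, hXg⟩, hmin⟩ := WellFounded.has_min (wellFounded_lt (α := Submodule A Y))
    {X | X ≤ P ∧ X.map g = ⊤} ⟨P, le_rfl, hP⟩
  refine ⟨X, hXP, hXg, (C.comap g).comap X.subtype, ?_, fun S hS => ?_⟩
  · intro h
    apply hC
    rw [eq_top_iff, ← hXg, Submodule.map_le_iff_le_comap]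
    intro x hx
    have : (⟨x, hx⟩ : X) ∈ (C.comap g).comap X.subtype := h ▸ Submodule.mem_top
    exact this
  · rw [← Submodule.map_le_iff_le_comap, ← Submodule.map_le_iff_le_comap]
    refine hmax _ fun h => ?_
    have hle : S.map X.subtype ≤ X := Submodule.map_subtype_le X S
    refine hmin (S.map X.subtype) ⟨hle.trans hXP, h⟩ (lt_of_le_of_ne hle fun h' => hS ?_)
    rw [eq_top_iff]
    rintro x -
    have : (x : Y) ∈ S.map X.subtype := by rw [h']; exact x.2
    obtain ⟨y, hy, hyx⟩ := this
    rwa [← Subtype.ext hyx]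

lemma isChainMod_of_indec {c : A} (hc : ∀ a : A, a * c = c * a) (hL : UniqueCoatoms k A c)
    (hR : UniqueAtoms k A c) {M : Type} [AddCommGroup M] [Module k M] [Module A M]
    [IsScalarTower k A M] [Module.Finite k M] (hM : IndecMod A M) (hcM : ActsInj c M) :
    IsChainMod A M := by
  have := isNoetherian_of_fd (A := A) k (M := M)
  have := isArtinian_of_fd (A := A) k (M := M)
  have := hM.1
  have hsub : ∀ X : Submodule A M, IsLocalMod A X → IsChainMod A X := fun X hX => by
    have := finite_sub k X
    exact isChainMod_of_isLocalMod hL _ X le_rfl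
      (hcM.of_injective X.subtype X.injective_subtype) hX
  have hatom : ∀ s : Submodule A M, IsAtom s → IsLocalMod A s := by
    intro s hs
    refine ⟨⊥, fun h => hs.1 ?_, fun S hS => ?_⟩
    · rw [eq_bot_iff]
      intro x hx
      have : (⟨x, hx⟩ : s) ∈ (⊥ : Submodule A s) := h ▸ Submodule.mem_top
      simpa using this
    · have hle : S.map s.subtype ≤ s := Submodule.map_subtype_le s S
      rcases hs.le_iff.1 hle with h | h
      · rw [← le_bot_iff, Submodule.map_le_iff_le_comap] at h
        simpa using h
      · refine absurd ?_ hS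
        rw [eq_top_iff]
        rintro x -
        have : (x : M) ∈ S.map s.subtype := by rw [h]; exact x.2
        obtain ⟨y, hy, hyx⟩ := this
        rwa [← Subtype.ext hyx]
  obtain ⟨s0, hs0, -⟩ := (eq_bot_or_exists_atom_le (⊤ : Submodule A M)).resolve_left top_ne_bot
  obtain ⟨X, hX, hXmax⟩ : ∃ X : Submodule A M, IsLocalMod A X ∧
      ∀ X' : Submodule A M, IsLocalMod A X' → Module.finrank k X' ≤ Module.finrank k X := by
    have hfin : {n | ∃ X : Submodule A M, IsLocalMod A X ∧ Module.finrank k X = n}.Finite :=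
      (Set.finite_Iic (Module.finrank k M)).subset (by
        rintro n ⟨X, -, rfl⟩; exact finrank_le_sub k X)
    obtain ⟨n, ⟨X, hX, rfl⟩, hmax⟩ := hfin.exists_maximal ⟨_, s0, hatom s0 hs0, rfl⟩
    refine ⟨X, hX, fun X' hX' => ?_⟩
    by_contra hlt
    exact hlt (hmax ⟨X', hX', rfl⟩ (le_of_lt (not_le.1 hlt)))
  have hXne : X ≠ ⊥ := by
    rintro rfl
    obtain ⟨K, hK, -⟩ := hX
    exact hK (Subsingleton.elim _ _)
  obtain ⟨s, hs, hsX⟩ := (eq_bot_or_exists_atom_le X).resolve_left hXne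
  have hsmin : ∀ S : Submodule A M, S ≤ X → S ≠ ⊥ → s ≤ S := by
    intro S hSX hS
    rcases hsub X hX (S.comap X.subtype) (s.comap X.subtype) with h | h
    · have : S ≤ s := fun x hx => h (x := ⟨x, hSX hx⟩) hx
      exact ((hs.le_iff.1 this).resolve_left hS).ge
    · exact fun x hx => h (x := ⟨x, hsX hx⟩) hx
  obtain ⟨K, hK, hKmax⟩ := WellFounded.has_min (wellFounded_gt (α := Submodule A M))
    {K | ¬ s ≤ K} ⟨⊥, fun h => hs.1 (eq_bot_iff.2 h)⟩
  have hKX : X ⊓ K = ⊥ := by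
    by_contra h
    exact hK ((hsmin _ inf_le_left h).trans inf_le_right)
  have hQnt : Nontrivial (M ⧸ K) := by
    rw [Submodule.Quotient.nontrivial_iff]
    rintro rfl
    exact hK le_top
  have hQ : IsChainMod A (M ⧸ K) := by
    refine isChainMod_of_least hc hR _ (M ⧸ K) le_rfl
      (hcM.of_surjective k hc K.mkQ K.mkQ_surjective) ⟨s.map K.mkQ, fun h => hK ?_, fun S hS => ?_⟩
    · rwa [← le_bot_iff, Submodule.map_le_iff_le_comap, Submodule.comap_bot,
        Submodule.ker_mkQ] at h
    · rw [Submodule.map_le_iff_le_comap]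
      by_contra hlt
      have hle : K ≤ S.comap K.mkQ := by
        intro x hx
        rw [Submodule.mem_comap, Submodule.mkQ_apply, (Submodule.Quotient.mk_eq_zero K).2 hx]
        exact S.zero_mem
      have hne : ¬ K < S.comap K.mkQ := hKmax _ hlt
      have heq : S.comap K.mkQ = K := by
        by_contra h
        exact hne (lt_of_le_of_ne hle (Ne.symm h))
      apply hS
      rw [← Submodule.map_comap_eq_of_surjective K.mkQ_surjective S, heq, Submodule.mkQ_map_self]
  obtain ⟨X', -, hX'K, hX'⟩ := exists_local_surj (k := k) hQ K.mkQ ⊤ (by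
    rw [Submodule.map_top, Submodule.range_mkQ])
  have hinj : Function.Injective (K.mkQ ∘ₗ X.subtype) := by
    rw [← LinearMap.ker_eq_bot, LinearMap.ker_comp, Submodule.ker_mkQ, eq_bot_iff]
    intro x hx
    have : (x : M) ∈ X ⊓ K := ⟨x.2, hx⟩
    rw [hKX] at this
    simpa using this
  have := finite_sub k X
  have := finite_sub k X'
  have hsurj' : Function.Surjective (K.mkQ ∘ₗ X'.subtype) := by
    rw [← LinearMap.range_eq_top, LinearMap.range_comp, Submodule.range_subtype, hX'K]
  have hsurj : Function.Surjective (K.mkQ ∘ₗ X.subtype) :=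
    surj_of_inj_of_le k _ hinj ((finrank_le_of_surj k _ hsurj').trans (hXmax X' hX'))
  have hcompl : IsCompl X K := by
    refine ⟨disjoint_iff.2 hKX, codisjoint_iff.2 ?_⟩
    rw [eq_top_iff]
    rintro m -
    obtain ⟨x, hx⟩ := hsurj (K.mkQ m)
    have hx' : m - x ∈ K := by
      rw [← Submodule.ker_mkQ K, LinearMap.mem_ker, map_sub, sub_eq_zero]
      exact hx.symm
    rw [← add_sub_cancel (x : M) m]
    exact Submodule.add_mem_sup x.2 hx'
  have hK0 := (hM.2 X K hcompl).resolve_left hXne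
  have hXtop : X = ⊤ := by
    have := hcompl.sup_eq_top
    rwa [hK0, sup_bot_eq] at this
  subst hXtop
  exact (hsub _ hX).of_injective (Submodule.topEquiv (R := A) (M := M)).symm.toLinearMap
    (LinearEquiv.injective _)

end Nakayama

section Nakayama

variable {k A : Type} [Field k] [Ring A] [Algebra k A]

/-- In a chain module, a submodule surjecting onto a nonzero quotient is everything. -/
lemma eq_top_of_map_eq_top {V I : Type} [AddCommGroup V] [Module A V] [AddCommGroup I] [Module A I]
    [Nontrivial I] (hV : IsChainMod A V) (h : V →ₗ[A] I) {T : Submodule A V} (hT : T.map h = ⊤) :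
    T = ⊤ := by
  rcases hV T (LinearMap.ker h) with h1 | h1
  · have : T.map h = ⊥ := by
      rwa [← le_bot_iff, Submodule.map_le_iff_le_comap]
    rw [hT] at this
    exact absurd this top_ne_bot
  · rw [eq_top_iff]
    rintro v -
    have : h v ∈ T.map h := hT ▸ Submodule.mem_top
    obtain ⟨t, ht, htv⟩ := this
    have : v - t ∈ T := h1 (by rw [LinearMap.mem_ker, map_sub, htv, sub_self])
    simpa using T.add_mem this ht

lemma nonempty_equiv_of_chain {c : A} (hL : UniqueCoatoms k A c)
    {V V' I : Type} [AddCommGroup V] [Module k V] [Module A V] [IsScalarTower k A V]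
    [Module.Finite k V] [AddCommGroup V'] [Module k V'] [Module A V'] [IsScalarTower k A V']
    [Module.Finite k V'] [AddCommGroup I] [Module k I] [Module A I] [IsScalarTower k A I]
    [Module.Finite k I] [Nontrivial I] (hV : IsChainMod A V) (hV' : IsChainMod A V')
    (hcV : ActsInj c V) (hcV' : ActsInj c V') (hr : Module.finrank k V = Module.finrank k V')
    (h : V →ₗ[A] I) (h' : V' →ₗ[A] I) (hs : Function.Surjective h) (hs' : Function.Surjective h') :
    Nonempty (V ≃ₗ[A] V') := by
  have hI : IsChainMod A I := hV.of_surjective h hs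
  let P : Submodule A (V × V') :=
    LinearMap.eqLocus (h ∘ₗ LinearMap.fst A V V') (h' ∘ₗ LinearMap.snd A V V')
  obtain ⟨Y, hYP, hY, hYloc⟩ := exists_local_surj (k := k) hI (h ∘ₗ LinearMap.fst A V V') P (by
    rw [eq_top_iff]
    rintro i -
    obtain ⟨v, rfl⟩ := hs i
    obtain ⟨v', hv'⟩ := hs' (h v)
    exact ⟨(v, v'), hv'.symm, rfl⟩)
  have := finite_sub k Y
  have hYc : IsChainMod A Y := isChainMod_of_isLocalMod hL _ Y le_rfl
    ((show ActsInj c (V × V') from fun v hv => Prod.ext (hcV _ (congrArg Prod.fst hv))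
      (hcV' _ (congrArg Prod.snd hv))).of_injective Y.subtype Y.injective_subtype) hYloc
  let f : Y →ₗ[A] V := LinearMap.fst A V V' ∘ₗ Y.subtype
  let f' : Y →ₗ[A] V' := LinearMap.snd A V V' ∘ₗ Y.subtype
  have hf : Function.Surjective f := by
    rw [← LinearMap.range_eq_top]
    refine eq_top_of_map_eq_top hV h ?_
    rw [LinearMap.range_comp, Submodule.range_subtype, ← Submodule.map_comp, hY]
  have hf' : Function.Surjective f' := by
    rw [← LinearMap.range_eq_top]
    refine eq_top_of_map_eq_top hV' h' ?_
    rw [LinearMap.range_comp, Submodule.range_subtype, ← Submodule.map_comp, eq_top_iff, ← hY]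
    rintro _ ⟨y, hy, rfl⟩
    exact ⟨y, hy, (hYP hy).symm⟩
  have h1 := finrank_ker_add_range k f
  have h2 := finrank_ker_add_range k f'
  have e1 : Module.finrank k (LinearMap.range f) = Module.finrank k V := by
    refine le_antisymm (finrank_le_sub k _) ?_
    rw [LinearMap.range_eq_top.2 hf]
    exact finrank_le_of_surj k (⊤ : Submodule A V).subtype fun v => ⟨⟨v, trivial⟩, rfl⟩
  have e2 : Module.finrank k (LinearMap.range f') = Module.finrank k V' := by
    refine le_antisymm (finrank_le_sub k _) ?_
    rw [LinearMap.range_eq_top.2 hf']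
    exact finrank_le_of_surj k (⊤ : Submodule A V').subtype fun v => ⟨⟨v, trivial⟩, rfl⟩
  have hker : LinearMap.ker f = LinearMap.ker f' := by
    rcases hYc (LinearMap.ker f) (LinearMap.ker f') with h | h <;>
      by_contra hne
    · have := finrank_lt_of_lt_sub k (lt_of_le_of_ne h hne)
      omega
    · have := finrank_lt_of_lt_sub k (lt_of_le_of_ne h (Ne.symm hne))
      omega
  exact ⟨(f.quotKerEquivOfSurjective hf).symm ≪≫ₗ (Submodule.quotEquivOfEq _ _ hker) ≪≫ₗ
    (f'.quotKerEquivOfSurjective hf')⟩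

/-- An additive submonoid of the endomorphism ring which contains all idempotents with
indecomposable range contains all idempotents. -/
lemma idempotent_mem {M : Type} [AddCommGroup M] [Module k M] [Module A M]
    [IsScalarTower k A M] [Module.Finite k M] (T : AddSubmonoid (Module.End A M))
    (hT : ∀ e : Module.End A M, e * e = e → IndecMod A (LinearMap.range e) → e ∈ T) (n : ℕ) :
    ∀ e : Module.End A M, e * e = e → Module.finrank k (LinearMap.range e) ≤ n → e ∈ T := by
  induction n with
  | zero =>
    intro e he hn
    have := finite_sub k (LinearMap.range e)
    have : Subsingleton (LinearMap.range e) := Module.finrank_zero_iff.1 (Nat.le_zero.1 hn)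
    have : e = 0 := by
      ext x
      exact congrArg Subtype.val (Subsingleton.elim (⟨e x, x, rfl⟩ : LinearMap.range e) 0)
    exact this ▸ T.zero_mem
  | succ n ih =>
    intro e he hn
    by_cases hind : IndecMod A (LinearMap.range e)
    · exact hT e he hind
    have := finite_sub k (LinearMap.range e)
    rcases subsingleton_or_nontrivial (LinearMap.range e) with hs | hs
    · refine ih e he ?_
      rw [Module.finrank_zero_of_subsingleton]
      exact Nat.zero_le n
    have hex : ∃ P Q : Submodule A (LinearMap.range e), IsCompl P Q ∧ P ≠ ⊥ ∧ Q ≠ ⊥ := by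
      by_contra hne
      push Not at hne
      refine hind ⟨hs, fun P Q hPQ => ?_⟩
      by_contra h
      push Not at h
      exact h.2 (hne P Q hPQ h.1)
    obtain ⟨P, Q, hPQ, hP, hQ⟩ := hex
    have hee : ∀ y : LinearMap.range e, e y = y := by
      rintro ⟨_, x, rfl⟩
      exact LinearMap.congr_fun he x
    have hr : ∀ y : LinearMap.range e, e.rangeRestrict y = y := fun y => Subtype.ext (hee y)
    have key : ∀ P Q : Submodule A (LinearMap.range e), ∀ hPQ : IsCompl P Q, Q ≠ ⊥ →
        (LinearMap.range e).subtype ∘ₗ (P.subtype ∘ₗ P.projectionOnto Q hPQ) ∘ₗ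
          e.rangeRestrict ∈ T := by
      intro P Q hPQ hQ
      refine ih _ ?_ (Nat.lt_succ_iff.1 (lt_of_lt_of_le (finrank_lt_of_lt_sub k ?_) hn))
      · ext x
        simp [hr]
      · refine lt_of_le_of_ne ?_ fun h => hQ ?_
        · rintro _ ⟨x, rfl⟩
          exact Subtype.property _
        · have : P = ⊤ := by
            rw [eq_top_iff]
            rintro y -
            obtain ⟨x, hx⟩ := h.ge y.2
            rw [← Subtype.ext hx]
            exact Subtype.property _
          have h2 := hPQ.inf_eq_bot
          rwa [this, top_inf_eq] at h2
    have := T.add_mem (key P Q hPQ hQ) (key Q P hPQ.symm hP)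
    convert this using 1
    ext x
    have h2 := Submodule.projection_add_projection_eq_self hPQ (e.rangeRestrict x)
    exact (congrArg Subtype.val h2).symm

end Nakayama

section GroupModules

variable (k N : Type) [Field k] [Group N]

/-- The representation on a module over the group algebra. -/
noncomputable def rp (Y : Type) [AddCommGroup Y] [Module k Y] [Module (MonoidAlgebra k N) Y]
    [IsScalarTower k (MonoidAlgebra k N) Y] : Representation k N Y :=
  Representation.ofModule' Y

variable {Y Z : Type} [AddCommGroup Y] [Module k Y] [Module (MonoidAlgebra k N) Y]
  [IsScalarTower k (MonoidAlgebra k N) Y] [AddCommGroup Z] [Module k Z]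
  [Module (MonoidAlgebra k N) Z] [IsScalarTower k (MonoidAlgebra k N) Z]

lemma rp_apply (g : N) (y : Y) : rp k N Y g y = MonoidAlgebra.of k N g • y := by
  simp [rp, Representation.ofModule']

lemma map_rp (f : Y →ₗ[MonoidAlgebra k N] Z) (g : N) (y : Y) :
    f (rp k N Y g y) = rp k N Z g (f y) := by
  simp [rp_apply]

lemma coe_rp (S : Submodule (MonoidAlgebra k N) Y) (g : N) (y : S) :
    ((rp k N S g y : S) : Y) = rp k N Y g y := by
  simp [rp_apply]

lemma rp_mem {S : Submodule (MonoidAlgebra k N) Y} (g : N) {y : Y} (hy : y ∈ S) :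
    rp k N Y g y ∈ S := by
  rw [rp_apply]; exact S.smul_mem _ hy

variable {k N}

/-- The linear map over the group algebra given by an equivariant map. -/
noncomputable def linOf (f : Y →ₗ[k] Z) (h : ∀ g y, f (rp k N Y g y) = rp k N Z g (f y)) :
    Y →ₗ[MonoidAlgebra k N] Z :=
  MonoidAlgebra.equivariantOfLinearOfComm f fun g y => by
    simpa [rp_apply] using h g y

lemma linOf_apply (f : Y →ₗ[k] Z) (h : ∀ g y, f (rp k N Y g y) = rp k N Z g (f y)) (y : Y) :
    linOf f h y = f y := rfl

/-- The submodule over the group algebra given by an invariant subspace. -/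
def subOf (S : Submodule k Y) (h : ∀ g, ∀ y ∈ S, rp k N Y g y ∈ S) :
    Submodule (MonoidAlgebra k N) Y where
  carrier := S
  add_mem' := S.add_mem
  zero_mem' := S.zero_mem
  smul_mem' a y hy := by
    refine MonoidAlgebra.induction_on (motive := fun a => a • y ∈ S) a ?_ ?_ ?_
    · intro g
      rw [← rp_apply]; exact h g y hy
    · intro a b ha hb
      rw [add_smul]; exact S.add_mem ha hb
    · intro r a ha
      rw [smul_assoc]; exact S.smul_mem r ha

/-- An equivariant map up to the multiplicative character `χ`. -/
def SemiEq (χ : N →* k) (Λ : Y →ₗ[k] Z) : Prop :=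
  ∀ g, Λ ∘ₗ rp k N Y g = χ g • rp k N Z g ∘ₗ Λ

lemma SemiEq.apply {χ : N →* k} {Λ : Y →ₗ[k] Z} (h : SemiEq χ Λ) (g : N) (y : Y) :
    Λ (rp k N Y g y) = χ g • rp k N Z g (Λ y) := LinearMap.congr_fun (h g) y

lemma char_ne_zero (χ : N →* k) (g : N) : χ g ≠ 0 := by
  intro h
  have := map_mul χ g g⁻¹
  rw [h, zero_mul, mul_inv_cancel, map_one] at this
  exact one_ne_zero this

lemma SemiEq.injective {χ : N →* k} {Λ : Y →ₗ[k] Z} (h : SemiEq χ Λ)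
    [IsSimpleModule (MonoidAlgebra k N) Y] (h0 : Λ ≠ 0) : Function.Injective Λ := by
  let K : Submodule (MonoidAlgebra k N) Y := subOf (LinearMap.ker Λ) fun g y hy => by
    rw [LinearMap.mem_ker] at hy ⊢
    rw [h.apply, hy, map_zero, smul_zero]
  rcases eq_bot_or_eq_top K with hK | hK
  · rw [injective_iff_map_eq_zero]
    intro y hy
    have : y ∈ K := hy
    rwa [hK, Submodule.mem_bot] at this
  · exfalso
    apply h0
    ext y
    have : y ∈ K := hK ▸ Submodule.mem_top
    exact this

lemma SemiEq.surjective {χ : N →* k} {Λ : Y →ₗ[k] Z} (h : SemiEq χ Λ)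
    [IsSimpleModule (MonoidAlgebra k N) Z] (h0 : Λ ≠ 0) : Function.Surjective Λ := by
  let R : Submodule (MonoidAlgebra k N) Z := subOf (LinearMap.range Λ) (by
    rintro g _ ⟨y, rfl⟩
    refine ⟨(χ g)⁻¹ • rp k N Y g y, ?_⟩
    rw [map_smul, h.apply, inv_smul_smul₀ (char_ne_zero χ g)])
  rcases eq_bot_or_eq_top R with hR | hR
  · exfalso
    apply h0
    ext y
    have : Λ y ∈ R := ⟨y, rfl⟩
    rwa [hR, Submodule.mem_bot] at this
  · intro z
    have : z ∈ R := hR ▸ Submodule.mem_top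
    exact this

/-- Schur's lemma. -/
lemma exists_smul_of_comm [IsAlgClosed k] [Module.Finite k Y]
    [IsSimpleModule (MonoidAlgebra k N) Y] (f : Y →ₗ[k] Y)
    (h : ∀ g y, f (rp k N Y g y) = rp k N Y g (f y)) : ∃ s : k, ∀ y, f y = s • y := by
  obtain ⟨s, hs⟩ :=
    (IsSimpleModule.algebraMap_end_bijective_of_isAlgClosed (A := MonoidAlgebra k N) (V := Y) k).2
      (linOf f h)
  refine ⟨s, fun y => ?_⟩
  have := LinearMap.congr_fun hs y
  rw [linOf_apply] at this
  rw [← this]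
  rfl

/-- The cocycle of an extension of modules over the group algebra. -/
lemma exists_cocycle (f : Y →ₗ[MonoidAlgebra k N] Z) (hf : Function.Surjective f)
    (K : Submodule (MonoidAlgebra k N) Y) (hK : ∀ y, y ∈ K ↔ f y = 0) :
    ∃ (s : Z →ₗ[k] Y) (r : Y →ₗ[k] K) (γ : N → Z →ₗ[k] K), (∀ z, f (s z) = z) ∧
      (∀ y, (r y : Y) = y - s (f y)) ∧
      (∀ g z, ((γ g z : K) : Y) = rp k N Y g (s (rp k N Z g⁻¹ z)) - s z) ∧
      ∀ g h, γ (g * h) = γ g + (rp k N Z).linHom (rp k N K) g (γ h) := by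
  obtain ⟨s, hs⟩ := (f.restrictScalars k).exists_rightInverse_of_surjective
    (LinearMap.range_eq_top.2 hf)
  have hs' : ∀ w, f (s w) = w := fun w => LinearMap.congr_fun hs w
  have hmem : ∀ g z, rp k N Y g (s (rp k N Z g⁻¹ z)) - s z ∈ K := by
    intro g z
    rw [hK, map_sub, map_rp, hs', hs', Representation.self_inv_apply, sub_self]
  let γ : N → Z →ₗ[k] K := fun g =>
    { toFun := fun z => ⟨_, hmem g z⟩
      map_add' := fun x y => Subtype.ext <| by simp only [map_add, Submodule.coe_add]; abel
      map_smul' := fun r x => Subtype.ext <| by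
        simp only [map_smul, RingHom.id_apply, ← smul_sub]; rfl }
  have hγ : ∀ g z, ((γ g z : K) : Y) = rp k N Y g (s (rp k N Z g⁻¹ z)) - s z := fun g z => rfl
  have hmem' : ∀ y, y - s (f y) ∈ K := by
    intro y
    rw [hK, map_sub, hs', sub_self]
  have hfs : ∀ (c : k) y, f (c • y) = c • f y := fun c y => (f.restrictScalars k).map_smul c y
  let r : Y →ₗ[k] K :=
    { toFun := fun y => ⟨_, hmem' y⟩
      map_add' := fun x y => Subtype.ext <| by simp only [map_add, Submodule.coe_add]; abel
      map_smul' := fun c x => Subtype.ext <| by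
        simp only [hfs, map_smul, RingHom.id_apply, ← smul_sub]; rfl }
  refine ⟨s, r, γ, hs', fun y => rfl, hγ, fun g h => ?_⟩
  apply LinearMap.ext
  intro z
  apply Subtype.ext
  have e1 : ((((rp k N Z).linHom (rp k N K) g (γ h)) z : K) : Y) =
      rp k N Y g (rp k N Y h (s (rp k N Z h⁻¹ (rp k N Z g⁻¹ z))) - s (rp k N Z g⁻¹ z)) := by
    rw [Representation.linHom_apply, LinearMap.comp_apply, LinearMap.comp_apply, coe_rp, hγ]
  rw [LinearMap.add_apply, Submodule.coe_add, e1, hγ, hγ]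
  rw [map_mul, mul_inv_rev, map_mul, Module.End.mul_apply, Module.End.mul_apply, map_sub]
  abel

variable [Fintype N]

open scoped Classical in
/-- All simple modules on which `c` is injective carry relative trace forms of the identity. -/
def SimpleTrace (c : MonoidAlgebra k N) (D : Subgroup N) : Prop :=
  ∀ (W : Type) [AddCommGroup W] [Module k W] [Module (MonoidAlgebra k N) W]
    [IsScalarTower k (MonoidAlgebra k N) W] [Module.Finite k W]
    [IsSimpleModule (MonoidAlgebra k N) W], ActsInj c W →
    ∃ θ : W →ₗ[k] W, (∀ d ∈ D, (rp k N W).linHom (rp k N W) d θ = θ) ∧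
      qtr ((rp k N W).linHom (rp k N W)) D θ = LinearMap.id

set_option maxHeartbeats 1000000 in
lemma uniqueCoatoms [IsAlgClosed k] {p : ℕ} [Fact p.Prime] [CharP k p] {n : ℕ} {t : N}
    (ht : orderOf t = p ^ (n + 1)) {χ : N →* k} (hχ : IsModChar t p n χ) {c : MonoidAlgebra k N}
    (hc : ∀ a : MonoidAlgebra k N, a * c = c * a)
    (hT : SimpleTrace c (Subgroup.zpowers t)) : UniqueCoatoms k (MonoidAlgebra k N) c := by
  intro Y _ _ _ _ _ hY K hK hmax
  have hKco : IsCoatom K := ⟨hK, fun S hS => by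
    by_contra h
    exact absurd (hmax S h) (not_le_of_gt hS)⟩
  have : IsSimpleModule (MonoidAlgebra k N) (Y ⧸ K) := isSimpleModule_iff_isCoatom.2 hKco
  have := finite_sub k K
  obtain ⟨θ, hθ, hθ1⟩ := hT (Y ⧸ K) (hY.of_surjective k hc K.mkQ K.mkQ_surjective)
  have hmk : ∀ y, y ∈ K ↔ K.mkQ y = 0 := fun y => (Submodule.Quotient.mk_eq_zero K).symm
  obtain ⟨s, r, γ, hs, hr, hγ, hcoc⟩ := exists_cocycle K.mkQ K.mkQ_surjective K hmk
  -- the composite cocycle with a surjective equivariant map is not a coboundary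
  have hA : ∀ (V : Type) [AddCommGroup V] [Module k V] [Nontrivial V] (τ : Representation k N V)
      (M : K →ₗ[k] V), (∀ g x, M (rp k N K g x) = τ g (M x)) → Function.Surjective M →
      ¬ ∃ η : (Y ⧸ K) →ₗ[k] V, ∀ g, M ∘ₗ γ g = (rp k N (Y ⧸ K)).linHom τ g η - η := by
    rintro V _ _ _ τ M hM hMs ⟨η, hη⟩
    have hΦ : ∀ g y, M (r (rp k N Y g y)) + η (K.mkQ (rp k N Y g y)) =
        τ g (M (r y) + η (K.mkQ y)) := by
      intro g y
      have h1 : r (rp k N Y g y) =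
          rp k N K g (r y) + γ g (rp k N (Y ⧸ K) g (K.mkQ y)) := Subtype.ext (by
        rw [Submodule.coe_add, coe_rp, hγ, Representation.inv_self_apply, hr, hr, map_rp, map_sub]
        abel)
      have h2 := LinearMap.congr_fun (hη g) (rp k N (Y ⧸ K) g (K.mkQ y))
      rw [LinearMap.comp_apply, LinearMap.sub_apply, Representation.linHom_apply,
        LinearMap.comp_apply, LinearMap.comp_apply, Representation.inv_self_apply] at h2
      rw [h1, map_add, h2, hM, map_rp, map_add]
      abel
    let Φ : Y →ₗ[k] V := M ∘ₗ r + η ∘ₗ K.mkQ.restrictScalars k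
    have hΦK : ∀ x : K, Φ x = M x := by
      intro x
      have h1 : K.mkQ (x : Y) = 0 := (hmk _).1 x.2
      have h2 : r x = x := Subtype.ext (by rw [hr, h1, map_zero, sub_zero])
      show M (r x) + η (K.mkQ x) = M x
      rw [h2, h1, map_zero, add_zero]
    let S : Submodule (MonoidAlgebra k N) Y := subOf (LinearMap.ker Φ) (fun g y hy => by
      have h1 : M (r y) + η (K.mkQ y) = 0 := hy
      show M (r _) + η (K.mkQ _) = 0
      rw [hΦ, h1, map_zero])
    obtain ⟨v, hv⟩ := exists_ne (0 : V)
    obtain ⟨x, rfl⟩ := hMs v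
    have hS : S ≤ K := hmax S fun h => hv (by
      rw [← hΦK]
      have : (x : Y) ∈ S := h ▸ Submodule.mem_top
      exact this)
    apply hK
    rw [eq_top_iff]
    rintro y -
    obtain ⟨z, hz⟩ := hMs (Φ y)
    have : y - z ∈ S := by
      show Φ _ = 0
      rw [map_sub, hΦK, hz, sub_self]
    simpa using K.add_mem (hS this) z.2
  have hcoc' : ∀ (V : Type) [AddCommGroup V] [Module k V] (τ : Representation k N V)
      (M : K →ₗ[k] V), (∀ g x, M (rp k N K g x) = τ g (M x)) →
      ∀ g h, M ∘ₗ γ (g * h) = M ∘ₗ γ g + (rp k N (Y ⧸ K)).linHom τ g (M ∘ₗ γ h) := by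
    intro V _ _ τ M hM g h
    rw [hcoc, LinearMap.comp_add]
    congr 1
    ext w
    exact hM _ _
  have hex : ∀ S : Submodule (MonoidAlgebra k N) K, IsCoatom S →
      ∃ M : K →ₗ[k] (Y ⧸ K), SemiEq χ M ∧ (∀ x, x ∈ S ↔ M x = 0) ∧ M ≠ 0 := by
    intro S hS
    have : IsSimpleModule (MonoidAlgebra k N) (K ⧸ S) := isSimpleModule_iff_isCoatom.2 hS
    have := IsSimpleModule.nontrivial (MonoidAlgebra k N) (K ⧸ S)
    have hSeq : ∀ g x, (S.mkQ.restrictScalars k) (rp k N K g x) =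
      rp k N (K ⧸ S) g ((S.mkQ.restrictScalars k) x) := fun g x => map_rp k N S.mkQ g x
    by_contra hno
    refine hA (K ⧸ S) (rp k N (K ⧸ S)) (S.mkQ.restrictScalars k) hSeq S.mkQ_surjective
      (cocycle_coboundary ht hχ hθ hθ1 (hcoc' _ _ _ hSeq) fun Λ hΛ => ?_)
    by_cases h0 : Λ = 0
    · simp [h0]
    have hΛ' : SemiEq χ Λ := hΛ
    exfalso
    refine hno ⟨Λ ∘ₗ S.mkQ.restrictScalars k, fun g => ?_, fun x => ?_, fun h => h0 ?_⟩
    · refine LinearMap.ext fun x => ?_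
      rw [LinearMap.comp_apply, LinearMap.comp_apply, hSeq, hΛ'.apply]
      rfl
    · rw [LinearMap.comp_apply, map_eq_zero_iff _ (hΛ'.injective h0)]
      exact (Submodule.Quotient.mk_eq_zero S).symm
    · refine LinearMap.ext fun x => ?_
      obtain ⟨x, rfl⟩ := S.mkQ_surjective x
      exact LinearMap.congr_fun h x
  have hL : ∀ M : K →ₗ[k] (Y ⧸ K), SemiEq χ M → M ≠ 0 →
      LinearMap.trace k K (γ t ∘ₗ θ ∘ₗ M) ≠ 0 := by
    intro M hM hM0 htr
    let τ : Representation k N (Y ⧸ K) :=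
      { toFun := fun g => χ g • rp k N (Y ⧸ K) g
        map_one' := by simp
        map_mul' := fun g h => by rw [map_mul, map_mul, smul_mul_smul_comm] }
    have hMeq : ∀ g x, M (rp k N K g x) = τ g (M x) := fun g x => hM.apply g x
    have := IsSimpleModule.nontrivial (MonoidAlgebra k N) (Y ⧸ K)
    refine hA _ τ M hMeq (hM.surjective hM0)
      (cocycle_coboundary ht hχ hθ hθ1 (hcoc' _ τ M hMeq) fun Λ hΛ => ?_)
    obtain ⟨r, hr⟩ := exists_smul_of_comm Λ fun g y => by
      have := LinearMap.congr_fun (hΛ g) y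
      rw [LinearMap.comp_apply, show τ g y = χ g • rp k N (Y ⧸ K) g y from rfl, map_smul] at this
      exact smul_right_injective _ (char_ne_zero χ g) this
    have : Λ = r • LinearMap.id := by ext y; exact hr y
    rw [this, LinearMap.comp_smul, LinearMap.comp_smul, map_smul, LinearMap.comp_id,
      LinearMap.comp_assoc, LinearMap.trace_comp_comm', LinearMap.comp_assoc, htr, smul_zero]
  intro S T hS hT
  obtain ⟨M1, h1, h1S, h10⟩ := hex S hS
  obtain ⟨M2, h2, h2T, h20⟩ := hex T hT
  set L : (K →ₗ[k] (Y ⧸ K)) → k := fun M => LinearMap.trace k K (γ t ∘ₗ θ ∘ₗ M) with hLdef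
  have hcomb : L M2 • M1 - L M1 • M2 = 0 := by
    by_contra h
    refine hL _ (fun g => ?_) h ?_
    · rw [LinearMap.sub_comp, LinearMap.smul_comp, LinearMap.smul_comp, h1 g, h2 g,
        LinearMap.comp_sub, LinearMap.comp_smul, LinearMap.comp_smul, smul_sub, smul_comm (χ g),
        smul_comm (χ g)]
    · rw [LinearMap.comp_sub, LinearMap.comp_sub, map_sub, LinearMap.comp_smul,
        LinearMap.comp_smul, LinearMap.comp_smul, LinearMap.comp_smul, map_smul, map_smul]
      simp only [hLdef, smul_eq_mul]
      ring
  ext x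
  have hx := LinearMap.congr_fun hcomb x
  rw [LinearMap.sub_apply, LinearMap.smul_apply, LinearMap.smul_apply, LinearMap.zero_apply,
    sub_eq_zero] at hx
  rw [h1S, h2T]
  constructor
  · intro h
    rw [h, smul_zero] at hx
    exact (smul_eq_zero_iff_right (hL M1 h1 h10)).1 hx.symm
  · intro h
    rw [h, smul_zero] at hx
    exact (smul_eq_zero_iff_right (hL M2 h2 h20)).1 hx

end GroupModules

section UniqueAtoms

variable {k N : Type} [Field k] [Group N] [Fintype N]

set_option maxHeartbeats 1000000 in
lemma uniqueAtoms [IsAlgClosed k] {p : ℕ} [Fact p.Prime] [CharP k p] {n : ℕ} {t : N}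
    (ht : orderOf t = p ^ (n + 1)) {χ : N →* k} (hχ : IsModChar t p n χ) {c : MonoidAlgebra k N}
    (hc : ∀ a : MonoidAlgebra k N, a * c = c * a)
    (hT : SimpleTrace c (Subgroup.zpowers t)) : UniqueAtoms k (MonoidAlgebra k N) c := by
  intro Y _ _ _ _ _ hY W hW hmin
  have hWat : IsAtom W := ⟨hW, fun S hS => by
    by_contra h
    exact absurd (hmin S h) (not_le_of_gt hS)⟩
  have : IsSimpleModule (MonoidAlgebra k N) W := isSimpleModule_iff_isAtom.2 hWat
  have := finite_sub k W
  have hQ := hY.of_surjective k hc W.mkQ W.mkQ_surjective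
  have hmk : ∀ y, y ∈ W ↔ W.mkQ y = 0 := fun y => (Submodule.Quotient.mk_eq_zero W).symm
  obtain ⟨s, r, γ, hs, hr, hγ, hcoc⟩ := exists_cocycle W.mkQ W.mkQ_surjective W hmk
  obtain ⟨w, hwW, hw⟩ := W.ne_bot_iff.1 hW
  -- the pulled back cocycle is not a coboundary
  have hA : ∀ (S : Submodule (MonoidAlgebra k N) (Y ⧸ W)), IsAtom S →
      ∀ j : S →ₗ[k] (Y ⧸ W), (∀ g x, j (rp k N S g x) = rp k N (Y ⧸ W) g (j x)) → j ≠ 0 →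
      ¬ ∃ η : S →ₗ[k] W, ∀ g, γ g ∘ₗ j = (rp k N S).linHom (rp k N W) g η - η := by
    rintro S hS j hj hj0 ⟨η, hη⟩
    have : IsSimpleModule (MonoidAlgebra k N) S := isSimpleModule_iff_isAtom.2 hS
    let J : S →ₗ[k] Y := s ∘ₗ j - W.subtype.restrictScalars k ∘ₗ η
    have hJ : ∀ x, J x = s (j x) - (η x : Y) := fun x => rfl
    have hJeq : ∀ g x, J (rp k N S g x) = rp k N Y g (J x) := by
      intro g x
      have h2 := congrArg (Subtype.val) (LinearMap.congr_fun (hη g) (rp k N S g x))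
      rw [LinearMap.comp_apply, hγ, LinearMap.sub_apply, Representation.linHom_apply,
        LinearMap.comp_apply, LinearMap.comp_apply, Representation.inv_self_apply,
        AddSubgroupClass.coe_sub, coe_rp, ← hj, Representation.inv_self_apply] at h2
      rw [hJ, hJ, map_sub]
      have h3 := sub_eq_sub_iff_add_eq_add.1 h2
      rw [sub_eq_sub_iff_add_eq_add, add_comm, ← h3]
    have hJj : ∀ x, W.mkQ (J x) = j x := by
      intro x
      rw [hJ, map_sub, hs, (hmk _).1 (η x).2, sub_zero]
    have hjinj : Function.Injective j := by
      refine SemiEq.injective (N := N) (χ := 1) (fun g => ?_) hj0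
      rw [MonoidHom.one_apply, one_smul]
      exact LinearMap.ext (hj g)
    have hle := hmin (LinearMap.range (linOf J hJeq)) fun h => hj0 <| LinearMap.ext fun x => by
      have : linOf J hJeq x ∈ LinearMap.range (linOf J hJeq) := ⟨x, rfl⟩
      rw [h, Submodule.mem_bot, linOf_apply] at this
      rw [← hJj, this, map_zero, LinearMap.zero_apply]
    obtain ⟨x, hx⟩ := hle hwW
    rw [linOf_apply] at hx
    have h0 := (hmk _).1 hwW
    rw [← hx, hJj] at h0
    apply hw
    rw [← hx, (map_eq_zero_iff _ hjinj).1 h0, map_zero]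
  have hex : ∀ S : Submodule (MonoidAlgebra k N) (Y ⧸ W), IsAtom S →
      ∃ θ : S →ₗ[k] S, ∀ j : S →ₗ[k] (Y ⧸ W),
        (∀ g x, j (rp k N S g x) = rp k N (Y ⧸ W) g (j x)) → j ≠ 0 →
        ∃ Λ : W →ₗ[k] S, SemiEq χ Λ ∧ LinearMap.trace k W (γ t ∘ₗ j ∘ₗ θ ∘ₗ Λ) ≠ 0 := by
    intro S hS
    have : IsSimpleModule (MonoidAlgebra k N) S := isSimpleModule_iff_isAtom.2 hS
    have := finite_sub k S
    obtain ⟨θ, hθ, hθ1⟩ := hT S (hQ.of_injective S.subtype S.injective_subtype)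
    refine ⟨θ, fun j hj hj0 => ?_⟩
    by_contra hno
    refine hA S hS j hj hj0 (cocycle_coboundary ht hχ hθ hθ1 (γ := fun g => γ g ∘ₗ j)
      (fun g h => ?_) fun Λ hΛ => ?_)
    · rw [hcoc, LinearMap.add_comp]
      congr 1
      refine LinearMap.ext fun x => ?_
      rw [LinearMap.comp_apply, Representation.linHom_apply, Representation.linHom_apply,
        LinearMap.comp_apply, LinearMap.comp_apply, LinearMap.comp_apply, LinearMap.comp_apply,
        LinearMap.comp_apply, hj]
    · by_contra h
      exact hno ⟨Λ, hΛ, h⟩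
  intro S T hS hT'
  have : IsSimpleModule (MonoidAlgebra k N) S := isSimpleModule_iff_isAtom.2 hS
  have : IsSimpleModule (MonoidAlgebra k N) T := isSimpleModule_iff_isAtom.2 hT'
  have := finite_sub k S
  have hsub : ∀ U : Submodule (MonoidAlgebra k N) (Y ⧸ W), IsAtom U →
      (∀ g x, (U.subtype.restrictScalars k) (rp k N U g x) =
        rp k N (Y ⧸ W) g ((U.subtype.restrictScalars k) x)) ∧ U.subtype.restrictScalars k ≠ 0 := by
    intro U hU
    refine ⟨fun g x => coe_rp k N U g x, fun h => hU.1 ?_⟩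
    rw [Submodule.eq_bot_iff]
    intro x hx
    exact LinearMap.congr_fun h ⟨x, hx⟩
  obtain ⟨θ, hθ⟩ := hex S hS
  obtain ⟨ΛS, hS1, hS2⟩ := hθ _ (hsub S hS).1 (hsub S hS).2
  obtain ⟨θT, hθT⟩ := hex T hT'
  obtain ⟨ΛT, hT1, hT2⟩ := hθT _ (hsub T hT').1 (hsub T hT').2
  have hS0 : ΛS ≠ 0 := by
    rintro rfl
    simp at hS2
  have hT0 : ΛT ≠ 0 := by
    rintro rfl
    simp at hT2
  let e : W ≃ₗ[k] S := LinearEquiv.ofBijective ΛS ⟨hS1.injective hS0, hS1.surjective hS0⟩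
  have he : ∀ x, e x = ΛS x := fun x => rfl
  have heS : ∀ x, ΛS (e.symm x) = x := fun x => e.apply_symm_apply x
  have hsymm : ∀ g x, e.symm (rp k N S g x) = (χ g)⁻¹ • rp k N W g (e.symm x) := by
    intro g x
    apply e.injective
    rw [e.apply_symm_apply, map_smul, he, hS1.apply, heS, inv_smul_smul₀ (char_ne_zero χ g)]
  have hcomp : ∀ {Z : Type} [AddCommGroup Z] [Module k Z] [Module (MonoidAlgebra k N) Z]
      [IsScalarTower k (MonoidAlgebra k N) Z] (Λ : W →ₗ[k] Z), SemiEq χ Λ →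
      ∀ g x, Λ (e.symm (rp k N S g x)) = rp k N Z g (Λ (e.symm x)) := by
    intro Z _ _ _ _ Λ hΛ g x
    rw [hsymm, map_smul, hΛ.apply, inv_smul_smul₀ (char_ne_zero χ g)]
  let jS : S →ₗ[k] (Y ⧸ W) := S.subtype.restrictScalars k
  let jT : S →ₗ[k] (Y ⧸ W) := T.subtype.restrictScalars k ∘ₗ ΛT ∘ₗ e.symm.toLinearMap
  have hjT : ∀ g x, jT (rp k N S g x) = rp k N (Y ⧸ W) g (jT x) := by
    intro g x
    have h1 := (hsub T hT').1 g (ΛT (e.symm x))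
    rw [← hcomp ΛT hT1] at h1
    exact h1
  let ℓ : (S →ₗ[k] (Y ⧸ W)) → k := fun j => LinearMap.trace k W (γ t ∘ₗ j ∘ₗ θ ∘ₗ ΛS)
  have hjc : ℓ jT • jS - ℓ jS • jT = 0 := by
    by_contra h
    obtain ⟨Λ, h1, h2⟩ := hθ (ℓ jT • jS - ℓ jS • jT) (fun g x => by
      rw [LinearMap.sub_apply, LinearMap.smul_apply, LinearMap.smul_apply, hjT,
        (hsub S hS).1, LinearMap.sub_apply, map_sub, LinearMap.smul_apply, LinearMap.smul_apply,
        map_smul, map_smul]) h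
    obtain ⟨a, ha⟩ := exists_smul_of_comm (Λ ∘ₗ e.symm.toLinearMap) fun g y => hcomp Λ h1 g y
    have hΛ : Λ = a • ΛS := LinearMap.ext fun x => by
      have := ha (e x)
      rw [LinearMap.comp_apply, LinearEquiv.coe_coe, e.symm_apply_apply] at this
      rw [this, he, LinearMap.smul_apply]
    apply h2
    rw [hΛ, LinearMap.comp_smul, LinearMap.comp_smul, LinearMap.comp_smul, map_smul,
      LinearMap.sub_comp, LinearMap.comp_sub, map_sub, LinearMap.smul_comp, LinearMap.smul_comp,
      LinearMap.comp_smul, LinearMap.comp_smul, map_smul, map_smul]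
    show a • (ℓ jT * ℓ jS - ℓ jS * ℓ jT) = 0
    rw [mul_comm, sub_self, smul_zero]
  have hle : T ≤ S := by
    intro y hy
    obtain ⟨x, hx⟩ := hT1.surjective hT0 ⟨y, hy⟩
    have h1 := LinearMap.congr_fun hjc (e x)
    have h2 : jT (e x) = y := by
      show ((ΛT (e.symm (e x)) : T) : Y ⧸ W) = y
      rw [e.symm_apply_apply, hx]
    rw [LinearMap.sub_apply, LinearMap.smul_apply, LinearMap.smul_apply, h2, LinearMap.zero_apply,
      sub_eq_zero] at h1
    have h3 : y = (ℓ jS)⁻¹ • ℓ jT • jS (e x) := by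
      rw [h1, inv_smul_smul₀ hS2]
    rw [h3]
    exact S.smul_of_tower_mem _ (S.smul_of_tower_mem _ (e x).2)
  exact ((hS.le_iff.1 hle).resolve_left hT'.1).symm

end UniqueAtoms

/-! ### Null maps between representations -/

section NullMaps

open scoped Classical

variable {k Γ : Type} [Field k] [Group Γ]
  {U U' U'' : Type} [AddCommGroup U] [Module k U] [AddCommGroup U'] [Module k U']
  [AddCommGroup U''] [Module k U'']
  {ρ : Representation k Γ U} {ρ' : Representation k Γ U'} {ρ'' : Representation k Γ U''}

/-- Equivariance of a linear map over a subgroup. -/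
def EqOn (ρ : Representation k Γ U) (ρ' : Representation k Γ U') (H : Subgroup Γ)
    (f : U →ₗ[k] U') : Prop :=
  ∀ h ∈ H, ∀ u, f (ρ h u) = ρ' h (f u)

lemma EqOn.anti {H K : Subgroup Γ} (hHK : H ≤ K) {f : U →ₗ[k] U'} (hf : EqOn ρ ρ' K f) :
    EqOn ρ ρ' H f := fun h hh => hf h (hHK hh)

lemma EqOn.comp {H : Subgroup Γ} {g : U' →ₗ[k] U''} {f : U →ₗ[k] U'} (hg : EqOn ρ' ρ'' H g)
    (hf : EqOn ρ ρ' H f) : EqOn ρ ρ'' H (g ∘ₗ f) := by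
  intro h hh u
  rw [LinearMap.comp_apply, LinearMap.comp_apply, hf h hh, hg h hh]

lemma EqOn.pow {H : Subgroup Γ} {f : Module.End k U} (hf : EqOn ρ ρ H f) (m : ℕ) :
    EqOn ρ ρ H (f ^ m) := by
  induction m with
  | zero => intro h _ u; simp
  | succ m ih => rw [pow_succ]; exact ih.comp hf

lemma EqOn.fixed {H : Subgroup Γ} {f : U →ₗ[k] U'} (hf : EqOn ρ ρ' H f) :
    ∀ h ∈ H, ρ.linHom ρ' h f = f := by
  intro h hh
  refine LinearMap.ext fun u => ?_
  rw [Representation.linHom_apply, LinearMap.comp_apply, LinearMap.comp_apply, ← hf h hh,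
    Representation.self_inv_apply]

lemma EqOn.of_fixed {H : Subgroup Γ} {f : U →ₗ[k] U'} (hf : ∀ h ∈ H, ρ.linHom ρ' h f = f) :
    EqOn ρ ρ' H f := by
  intro h hh u
  have := LinearMap.congr_fun (hf h hh) (ρ h u)
  rwa [Representation.linHom_apply, LinearMap.comp_apply, LinearMap.comp_apply,
    Representation.inv_self_apply, eq_comm] at this

lemma EqOn.comp_linHom {H : Subgroup Γ} {g : U' →ₗ[k] U''} (hg : EqOn ρ' ρ'' H g) :
    ∀ h ∈ H, ∀ f, g ∘ₗ ρ.linHom ρ' h f = ρ.linHom ρ'' h (g ∘ₗ f) := by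
  intro h hh f
  refine LinearMap.ext fun u => ?_
  rw [LinearMap.comp_apply, Representation.linHom_apply, Representation.linHom_apply,
    LinearMap.comp_apply, LinearMap.comp_apply, LinearMap.comp_apply, LinearMap.comp_apply,
    LinearMap.comp_apply, hg h hh]

lemma EqOn.linHom_comp {H : Subgroup Γ} {f : U →ₗ[k] U'} (hf : EqOn ρ ρ' H f) :
    ∀ h ∈ H, ∀ g, ρ'.linHom ρ'' h g ∘ₗ f = ρ.linHom ρ'' h (g ∘ₗ f) := by
  intro h hh g
  refine LinearMap.ext fun u => ?_
  rw [LinearMap.comp_apply, Representation.linHom_apply, Representation.linHom_apply,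
    LinearMap.comp_apply, LinearMap.comp_apply, LinearMap.comp_apply, LinearMap.comp_apply,
    LinearMap.comp_apply, hf _ (H.inv_mem hh)]

lemma comp_sum_linear {ι : Type} [Fintype ι] (g : U' →ₗ[k] U'') (f : ι → U →ₗ[k] U') :
    g ∘ₗ ∑ i, f i = ∑ i, g ∘ₗ f i :=
  map_sum (LinearMap.llcomp k U U' U'' g) f _

lemma sum_linear_comp {ι : Type} [Fintype ι] (g : ι → U' →ₗ[k] U'') (f : U →ₗ[k] U') :
    (∑ i, g i) ∘ₗ f = ∑ i, g i ∘ₗ f :=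
  map_sum (LinearMap.lcomp k U'' f) g _

variable [Fintype Γ]

lemma EqOn.comp_mem_nul {H : Subgroup Γ} {g : U' →ₗ[k] U''} (hg : EqOn ρ' ρ'' H g)
    {f : U →ₗ[k] U'} (hf : f ∈ nul (ρ.linHom ρ') H) : g ∘ₗ f ∈ nul (ρ.linHom ρ'') H :=
  map_mem_nul (T := LinearMap.llcomp k U U' U'' g) (fun h hh m => hg.comp_linHom h hh m) hf

lemma EqOn.mem_nul_comp {H : Subgroup Γ} {f : U →ₗ[k] U'} (hf : EqOn ρ ρ' H f)
    {g : U' →ₗ[k] U''} (hg : g ∈ nul (ρ'.linHom ρ'') H) : g ∘ₗ f ∈ nul (ρ.linHom ρ'') H :=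
  map_mem_nul (T := LinearMap.lcomp k U'' f) (fun h hh m => hf.linHom_comp h hh m) hg

lemma comp_sub_comp_mem_nul {H : Subgroup Γ} {g g' : U' →ₗ[k] U''} {f f' : U →ₗ[k] U'}
    (hg : EqOn ρ' ρ'' H g) (hf' : EqOn ρ ρ' H f') (hgg : g - g' ∈ nul (ρ'.linHom ρ'') H)
    (hff : f - f' ∈ nul (ρ.linHom ρ') H) : g ∘ₗ f - g' ∘ₗ f' ∈ nul (ρ.linHom ρ'') H := by
  have : g ∘ₗ f - g' ∘ₗ f' = g ∘ₗ (f - f') + (g - g') ∘ₗ f' := by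
    rw [LinearMap.comp_sub, LinearMap.sub_comp, sub_add_sub_cancel]
  rw [this]
  exact add_mem (hg.comp_mem_nul hff) (hf'.mem_nul_comp hgg)

lemma pow_sub_pow_mem_nul {H : Subgroup Γ} {f g : Module.End k U} (hf : EqOn ρ ρ H f)
    (hg : EqOn ρ ρ H g) (h : f - g ∈ nul (ρ.linHom ρ) H) (m : ℕ) :
    f ^ m - g ^ m ∈ nul (ρ.linHom ρ) H := by
  induction m with
  | zero => rw [pow_zero, pow_zero, sub_self]; exact zero_mem _
  | succ m ih =>
    rw [pow_succ, pow_succ]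
    exact comp_sub_comp_mem_nul (hf.pow m) hg ih h

lemma EqOn.qtr_comp {D : Subgroup Γ} {f : U →ₗ[k] U'} (hf : EqOn ρ ρ' ⊤ f) (g : U' →ₗ[k] U'') :
    qtr (ρ'.linHom ρ'') D g ∘ₗ f = qtr (ρ.linHom ρ'') D (g ∘ₗ f) := by
  rw [qtr, qtr, sum_linear_comp]
  exact Finset.sum_congr rfl fun x _ => hf.linHom_comp _ trivial g

lemma EqOn.comp_qtrOn {D N : Subgroup Γ} {g : U' →ₗ[k] U''} (hg : EqOn ρ' ρ'' N g)
    (f : U →ₗ[k] U') :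
    g ∘ₗ qtrOn (ρ.linHom ρ') D N f = qtrOn (ρ.linHom ρ'') D N (g ∘ₗ f) := by
  rw [qtrOn, qtrOn, comp_sum_linear]
  refine Finset.sum_congr rfl fun x _ => ?_
  split_ifs with h
  · exact hg.comp_linHom _ h f
  · exact LinearMap.comp_zero g

/-- Maps over the local subgroup `N` lift to maps over the whole group modulo null maps. -/
lemma exists_green {D N : Subgroup Γ} (hDN : D ≤ N)
    (hN : ∀ g, g ∉ N → ∀ d ∈ D, g⁻¹ * d * g ∈ D → d = 1) {θ : U →ₗ[k] U}
    (hθ : ∀ d ∈ D, ρ.linHom ρ d θ = θ) (hθ1 : qtr (ρ.linHom ρ) D θ = LinearMap.id)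
    {f : U →ₗ[k] U'} (hf : EqOn ρ ρ' N f) :
    ∃ F, EqOn ρ ρ' ⊤ F ∧ F - f ∈ nul (ρ.linHom ρ') D := by
  have hfD : EqOn ρ ρ' D f := hf.anti hDN
  have hfθ : ∀ d ∈ D, ρ.linHom ρ' d (f ∘ₗ θ) = f ∘ₗ θ := (hfD.comp (.of_fixed hθ)).fixed
  refine ⟨qtr (ρ.linHom ρ') D (f ∘ₗ θ), .of_fixed fun h _ => qtr_fixed hfθ h, ?_⟩
  have h1 := qtr_sub_qtrOn_mem hDN hN hfθ
  have h2 := hfD.comp_mem_nul (qtr_sub_qtrOn_mem hDN hN hθ)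
  rw [hθ1, LinearMap.comp_sub, hf.comp_qtrOn, LinearMap.comp_id] at h2
  have := sub_mem h1 h2
  rwa [sub_sub_sub_cancel_right] at this

/-- An equivariant null map is a trace from the trivial subgroup. -/
lemma exists_sum_eq_of_mem_nul {D : Subgroup Γ} {θ : U' →ₗ[k] U'}
    (hθ : ∀ d ∈ D, ρ'.linHom ρ' d θ = θ) (hθ1 : qtr (ρ'.linHom ρ') D θ = LinearMap.id)
    {f : U →ₗ[k] U'} (hf : EqOn ρ ρ' ⊤ f) (h : f ∈ nul (ρ.linHom ρ') D) :
    ∃ a, ∑ g : Γ, ρ.linHom ρ' g a = f := by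
  obtain ⟨a, ha⟩ := mem_nul.1 ((EqOn.of_fixed hθ).comp_mem_nul h)
  refine ⟨a, ?_⟩
  rw [← qtr_trace _ D, ha, ← hf.qtr_comp, hθ1, LinearMap.id_comp]

lemma EqOn.of_sum (a : U →ₗ[k] U') : EqOn ρ ρ' ⊤ (∑ g : Γ, ρ.linHom ρ' g a) :=
  .of_fixed fun h _ => nul_fixed (H := ⊤) (mem_nul.2 ⟨a,
    Fintype.sum_equiv Subgroup.topEquiv.toEquiv _ _ fun _ => rfl⟩) h trivial

/-- Traces from the trivial subgroup lift along surjections. -/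
lemma exists_lift_of_sum {f : U →ₗ[k] U''} (hf : ∃ a, ∑ g : Γ, ρ.linHom ρ'' g a = f)
    {π : U' →ₗ[k] U''} (hπ : EqOn ρ' ρ'' ⊤ π) (hs : Function.Surjective π) :
    ∃ F : U →ₗ[k] U', EqOn ρ ρ' ⊤ F ∧ π ∘ₗ F = f ∧ ∃ a, ∑ g : Γ, ρ.linHom ρ' g a = F := by
  obtain ⟨a, rfl⟩ := hf
  obtain ⟨s, hs⟩ := π.exists_rightInverse_of_surjective (LinearMap.range_eq_top.2 hs)
  refine ⟨∑ g : Γ, ρ.linHom ρ' g (s ∘ₗ a), .of_sum _, ?_, _, rfl⟩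
  rw [comp_sum_linear]
  refine Finset.sum_congr rfl fun g _ => ?_
  rw [hπ.comp_linHom g trivial, ← LinearMap.comp_assoc, hs, LinearMap.id_comp]

lemma EqOn.comp_sum {g : U' →ₗ[k] U''} (hg : EqOn ρ' ρ'' ⊤ g)
    {f : U →ₗ[k] U'} (hf : ∃ a, ∑ x : Γ, ρ.linHom ρ' x a = f) :
    ∃ a, ∑ x : Γ, ρ.linHom ρ'' x a = g ∘ₗ f := by
  obtain ⟨a, rfl⟩ := hf
  refine ⟨g ∘ₗ a, ?_⟩
  rw [comp_sum_linear]
  exact Finset.sum_congr rfl fun x _ => (hg.comp_linHom x trivial a).symm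

end NullMaps

/-! ### Local subgroups of cyclic `p`-subgroups -/

section LocalSubgroup

variable {Γ : Type} [Group Γ] [Finite Γ]

/-- The normalizer of the cyclic group generated by `z`. -/
def locNorm (z : Γ) : Subgroup Γ where
  carrier := {g | g * z * g⁻¹ ∈ Subgroup.zpowers z}
  one_mem' := by simp
  mul_mem' := by
    rintro g h hg ⟨i, hi⟩
    obtain ⟨j, hj⟩ := hg
    refine ⟨j * i, ?_⟩
    simp only at hi hj ⊢
    rw [zpow_mul, hj, conj_zpow, hi]
    group
  inv_mem' := by
    intro g hg
    have hm : ∀ m : ℕ, g ^ m * z * (g ^ m)⁻¹ ∈ Subgroup.zpowers z := by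
      intro m
      induction m with
      | zero => simp
      | succ m ih =>
        obtain ⟨j, hj⟩ := hg
        obtain ⟨i, hi⟩ := ih
        refine ⟨j * i, ?_⟩
        simp only at hi hj ⊢
        rw [zpow_mul, hj, conj_zpow, hi, pow_succ']
        group
    obtain ⟨m, hm'⟩ := (mem_powers_iff_mem_zpowers (x := g)).2
      ((Subgroup.zpowers g).inv_mem (Subgroup.mem_zpowers g))
    have hm' : g ^ m = g⁻¹ := hm'
    have := hm m
    rwa [hm'] at this

lemma mem_locNorm {z g : Γ} : g ∈ locNorm z ↔ g * z * g⁻¹ ∈ Subgroup.zpowers z := Iff.rfl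

variable {p n : ℕ} [Fact p.Prime] {t : Γ}

lemma zpowers_le_locNorm (t : Γ) (m : ℕ) : Subgroup.zpowers t ≤ locNorm (t ^ m) := by
  rw [Subgroup.zpowers_le, mem_locNorm]
  rw [show t * t ^ m * t⁻¹ = t ^ m by rw [← pow_succ', pow_succ, mul_inv_cancel_right]]
  exact Subgroup.mem_zpowers _

lemma mem_zpowers_of_ne_one (ht : orderOf t = p ^ (n + 1)) {d : Γ}
    (hd : d ∈ Subgroup.zpowers t) (h1 : d ≠ 1) : t ^ p ^ n ∈ Subgroup.zpowers d := by
  obtain ⟨r, rfl⟩ := (mem_powers_iff_mem_zpowers (x := t)).2 hd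
  have h1 : t ^ r ≠ 1 := h1
  have hr' : ¬ p ^ (n + 1) ∣ r := by rwa [← ht, orderOf_dvd_iff_pow_eq_one]
  have hd : Nat.gcd (p ^ (n + 1)) r ∣ p ^ n := by
    obtain ⟨j, hj, e⟩ := (Nat.dvd_prime_pow Fact.out).1 (Nat.gcd_dvd_left (p ^ (n + 1)) r)
    rw [e]
    refine pow_dvd_pow p (Nat.lt_succ_iff.1 (lt_of_le_of_ne hj ?_))
    rintro rfl
    exact hr' (e ▸ Nat.gcd_dvd_right _ _)
  obtain ⟨c, hc⟩ := hd
  have := Fintype.ofFinite Γ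
  obtain ⟨u, hu⟩ := exists_pow_eq_gcd t r
  rw [ht] at hu
  rw [hc, pow_mul, ← hu]
  rw [pow_mul]
  exact Subgroup.pow_mem _ (Subgroup.pow_mem _ (Subgroup.mem_zpowers (t ^ r)) _) _

lemma mem_zpowers_of_pow_eq_one (ht : orderOf t = p ^ (n + 1)) {d : Γ}
    (hd : d ∈ Subgroup.zpowers t) (h1 : d ^ p = 1) : d ∈ Subgroup.zpowers (t ^ p ^ n) := by
  obtain ⟨r, rfl⟩ := (mem_powers_iff_mem_zpowers (x := t)).2 hd
  have h1 : (t ^ r) ^ p = 1 := h1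
  rw [← pow_mul, ← orderOf_dvd_iff_pow_eq_one, ht, pow_succ] at h1
  obtain ⟨c, rfl⟩ := Nat.dvd_of_mul_dvd_mul_right (Fact.out : p.Prime).pos h1
  show t ^ (p ^ n * c) ∈ _
  rw [pow_mul]
  exact Subgroup.pow_mem _ (Subgroup.mem_zpowers _) _

omit [Finite Γ] [Fact p.Prime] in
lemma pow_prime_eq_one (ht : orderOf t = p ^ (n + 1)) : (t ^ p ^ n) ^ p = 1 := by
  rw [← pow_mul, ← pow_succ, ← ht, pow_orderOf_eq_one]

omit [Finite Γ] in
lemma orderOf_pow_prime (ht : orderOf t = p ^ (n + 1)) : orderOf (t ^ p ^ n) = p := by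
  refine orderOf_eq_prime (pow_prime_eq_one ht) fun h => ?_
  rw [← orderOf_dvd_iff_pow_eq_one, ht] at h
  exact absurd (Nat.pow_dvd_pow_iff_le_right (Fact.out : p.Prime).one_lt |>.1 h) (by omega)

/-- If a nontrivial element of `⟨t⟩` is mapped into `⟨t⟩` by a homomorphism, then so is the
generator of the socle of `⟨t⟩`. -/
lemma map_mem_zpowers (ht : orderOf t = p ^ (n + 1)) (f : Γ →* Γ) {d : Γ}
    (hd : d ∈ Subgroup.zpowers t) (h1 : d ≠ 1) (hf : f d ∈ Subgroup.zpowers t) :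
    f (t ^ p ^ n) ∈ Subgroup.zpowers (t ^ p ^ n) := by
  refine mem_zpowers_of_pow_eq_one ht ?_ ?_
  · obtain ⟨i, hi⟩ := mem_zpowers_of_ne_one ht hd h1
    simp only at hi
    rw [← hi, map_zpow]
    exact Subgroup.zpow_mem _ hf i
  · rw [← map_pow, pow_prime_eq_one ht, map_one]

lemma eq_one_of_not_mem_locNorm (ht : orderOf t = p ^ (n + 1)) :
    ∀ g, g ∉ locNorm (t ^ p ^ n) → ∀ d ∈ Subgroup.zpowers t,
      g⁻¹ * d * g ∈ Subgroup.zpowers t → d = 1 := by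
  intro g hg d hd h
  by_contra h1
  refine hg ((locNorm (t ^ p ^ n)).inv_mem_iff.1 ?_)
  rw [mem_locNorm, inv_inv]
  have := map_mem_zpowers ht (MulAut.conj g⁻¹).toMonoidHom hd h1 (by simpa using h)
  simpa using this

lemma exists_isModChar (k : Type) [Field k] [CharP k p] (ht : orderOf t = p ^ (n + 1)) :
    ∃ χ : locNorm (t ^ p ^ n) →* k,
      IsModChar (⟨t, zpowers_le_locNorm t _ (Subgroup.mem_zpowers t)⟩ : locNorm (t ^ p ^ n))
        p n χ := by
  set z := t ^ p ^ n with hz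
  have hex : ∀ g : locNorm z, ∃ a : ℕ, (g : Γ) * z * (g : Γ)⁻¹ = z ^ a := fun g => by
    obtain ⟨a, ha⟩ := (mem_powers_iff_mem_zpowers (x := z)).2 (mem_locNorm.1 g.2)
    exact ⟨a, ha.symm⟩
  choose a ha using hex
  have huniq : ∀ i j : ℕ, z ^ i = z ^ j → (i : k) = j := by
    intro i j hij
    rw [CharP.natCast_eq_natCast k p, ← orderOf_pow_prime ht]
    exact pow_eq_pow_iff_modEq.1 hij
  refine ⟨⟨⟨fun g => a g, ?_⟩, fun g h => ?_⟩, fun g i hi => ?_⟩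
  · rw [← Nat.cast_one]
    refine huniq _ _ ?_
    rw [← ha]
    simp
  · simp only
    rw [← Nat.cast_mul]
    refine huniq _ _ ?_
    rw [← ha, pow_mul, ← ha g, conj_pow, ← ha h]
    simp [mul_assoc]
  · refine huniq _ _ ?_
    rw [← ha]
    exact congrArg Subtype.val hi

lemma exists_restrict (α : Γ ≃* Γ) {z : Γ} (hα : α z ∈ Subgroup.zpowers z) :
    ∃ β : locNorm z ≃* locNorm z, ∀ g, (β g : Γ) = α g := by
  have hpow : ∃ i : ℤ, (α z) ^ i = z := by
    obtain ⟨a, ha⟩ := (mem_powers_iff_mem_zpowers (x := z)).2 hα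
    have ha : z ^ a = α z := ha
    have hco : Nat.Coprime (orderOf z) a := by
      have h1 : orderOf (z ^ a) = orderOf z := by
        rw [ha]; exact orderOf_injective α.toMonoidHom α.injective z
      rw [orderOf_pow] at h1
      exact (Nat.div_eq_self.1 h1).resolve_left (orderOf_pos z).ne'
    have := Fintype.ofFinite Γ
    obtain ⟨u, hu⟩ := exists_pow_eq_gcd z a
    refine ⟨u, ?_⟩
    rw [zpow_natCast, ← ha, ← pow_mul, hu, hco.gcd_eq_one, pow_one]
  obtain ⟨i, hi⟩ := hpow
  obtain ⟨j, hj⟩ := hα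
  simp only at hj
  have hmem : ∀ g, g ∈ locNorm z ↔ α g ∈ locNorm z := by
    intro g
    rw [mem_locNorm, mem_locNorm]
    constructor
    · rintro ⟨m, hm⟩
      simp only at hm
      have : α g * z * (α g)⁻¹ = z ^ (j * m * i) := by
        rw [zpow_mul, zpow_mul, hj, ← map_zpow, hm, map_mul, map_mul, map_inv, conj_zpow, hi]
      exact this ▸ Subgroup.zpow_mem _ (Subgroup.mem_zpowers z) _
    · rintro ⟨m, hm⟩
      simp only at hm
      have : α (g * z * g⁻¹) = α (z ^ (i * (m * j))) := by
        rw [map_mul, map_mul, map_inv, map_zpow, zpow_mul, hi, zpow_mul, hm, conj_zpow, hj]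
      rw [α.injective this]
      exact Subgroup.zpow_mem _ (Subgroup.mem_zpowers z) _
  refine ⟨⟨⟨fun g => ⟨α g, (hmem g).1 g.2⟩, fun g => ⟨α.symm g, (hmem _).2 (by simp)⟩,
    fun g => by simp, fun g => by simp⟩, fun g h => Subtype.ext (by simp)⟩, fun g => rfl⟩

end LocalSubgroup

/-! ### Twists by automorphisms -/

section Twist

open scoped Classical

variable {k Γ : Type} [Field k] [Group Γ]

/-- The twist of a representation by an endomorphism of the group. -/
def tw {U : Type} [AddCommGroup U] [Module k U] (ρ : Representation k Γ U) (α : Γ →* Γ) :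
    Representation k Γ U := MonoidHom.comp ρ α

lemma tw_apply {U : Type} [AddCommGroup U] [Module k U] (ρ : Representation k Γ U) (α : Γ →* Γ)
    (g : Γ) : tw ρ α g = ρ (α g) := rfl

/-- A module isomorphic to its twist by `α`. -/
def TwStable (k : Type) [Field k] (α : Γ →* Γ) (U : Type) [AddCommGroup U] [Module k U]
    [Module (MonoidAlgebra k Γ) U] [IsScalarTower k (MonoidAlgebra k Γ) U] : Prop :=
  ∃ ψ : U ≃ₗ[k] U, ∀ g u, ψ (rp k Γ U (α g) u) = rp k Γ U g (ψ u)

variable {U U' : Type} [AddCommGroup U] [Module k U] [AddCommGroup U'] [Module k U']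
  {ρ : Representation k Γ U} {ρ' : Representation k Γ U'}

lemma linHom_tw (α : Γ →* Γ) (g : Γ) (f : U →ₗ[k] U') :
    (tw ρ α).linHom (tw ρ' α) g f = ρ.linHom ρ' (α g) f := by
  rw [Representation.linHom_apply, Representation.linHom_apply, tw_apply, tw_apply, map_inv]

lemma EqOn.tw {f : U →ₗ[k] U'} (hf : EqOn ρ ρ' ⊤ f) (α : Γ →* Γ) :
    EqOn (Paper.tw ρ α) (Paper.tw ρ' α) ⊤ f := fun h _ u => hf (α h) trivial u

lemma sum_linHom_tw [Fintype Γ] (α : Γ ≃* Γ) (a : U →ₗ[k] U') :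
    ∑ g : Γ, (Paper.tw ρ α).linHom (Paper.tw ρ' α) g a = ∑ g : Γ, ρ.linHom ρ' g a :=
  Fintype.sum_equiv α.toEquiv _ _ fun g => linHom_tw (α : Γ →* Γ) g a

lemma EqOn.symm {f : U ≃ₗ[k] U'} {H : Subgroup Γ} (hf : EqOn ρ ρ' H (f : U →ₗ[k] U')) :
    EqOn ρ' ρ H (f.symm : U' →ₗ[k] U) := by
  intro h hh u
  have := hf h hh (f.symm u)
  rw [LinearEquiv.coe_coe, LinearEquiv.apply_symm_apply] at this
  rw [LinearEquiv.coe_coe, LinearEquiv.symm_apply_eq, this]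

lemma not_isNilpotent_of_comp_eq [Nontrivial U'] {π : U →ₗ[k] U'} (hs : Function.Surjective π)
    {F : Module.End k U} (hF : π ∘ₗ F = π) : ¬ IsNilpotent F := by
  rintro ⟨m, hm⟩
  have h : ∀ m : ℕ, π ∘ₗ (F ^ m) = π := by
    intro m
    induction m with
    | zero => rfl
    | succ m ih => rw [pow_succ', Module.End.mul_eq_comp, ← LinearMap.comp_assoc, hF, ih]
  have h0 := h m
  rw [hm, LinearMap.comp_zero] at h0
  obtain ⟨y, hy⟩ := exists_ne (0 : U')
  obtain ⟨u, rfl⟩ := hs y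
  exact hy (by rw [← h0, LinearMap.zero_apply])

end Twist

section Stability

open scoped Classical

variable {k Γ : Type} [Field k] [Group Γ]
  {U S : Type} [AddCommGroup U] [Module k U] [Module (MonoidAlgebra k Γ) U]
  [IsScalarTower k (MonoidAlgebra k Γ) U] [Module.Finite k U]
  [AddCommGroup S] [Module k S] [Module (MonoidAlgebra k Γ) S]
  [IsScalarTower k (MonoidAlgebra k Γ) S]

lemma bijective_of_eqOn (hU : IndecMod (MonoidAlgebra k Γ) U) {F : Module.End k U}
    (hF : EqOn (rp k Γ U) (rp k Γ U) ⊤ F) (hn : ¬ IsNilpotent F) : Function.Bijective F := by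
  have h : ∀ g u, F (rp k Γ U g u) = rp k Γ U g (F u) := fun g u => hF g trivial u
  refine bijective_of_not_isNilpotent k hU (f := linOf F h) ?_
  rintro ⟨m, hm⟩
  refine hn ⟨m, LinearMap.ext fun u => ?_⟩
  have : ∀ m : ℕ, (linOf F h ^ m) u = (F ^ m) u := by
    intro m
    induction m with
    | zero => rfl
    | succ m ih => rw [pow_succ', pow_succ', Module.End.mul_apply, ih, linOf_apply]; rfl
  rw [← this, hm]
  rfl

lemma twStable_of_comp (hU : IndecMod (MonoidAlgebra k Γ) U) {α : Γ ≃* Γ} {F F' : Module.End k U}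
    (hF : EqOn (rp k Γ U) (tw (rp k Γ U) (α : Γ →* Γ)) ⊤ F)
    (hF' : EqOn (tw (rp k Γ U) (α : Γ →* Γ)) (rp k Γ U) ⊤ F')
    (hn : ¬ IsNilpotent (F' * F)) : TwStable k (α : Γ →* Γ) U := by
  have hb := bijective_of_eqOn hU (hF'.comp hF) hn
  have hi : Function.Injective F := by
    have := hb.1
    exact Function.Injective.of_comp (f := F') this
  let e : U ≃ₗ[k] U := LinearEquiv.ofInjectiveEndo F hi
  have he : EqOn (rp k Γ U) (tw (rp k Γ U) (α : Γ →* Γ)) ⊤ (e : U →ₗ[k] U) := hF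
  exact ⟨e.symm, fun g u => he.symm g trivial u⟩

lemma exists_eqOn_of_twStable {α : Γ →* Γ} (hS : TwStable k α S) :
    ∃ ψ : S ≃ₗ[k] S, EqOn (tw (rp k Γ S) α) (rp k Γ S) ⊤ (ψ : S →ₗ[k] S) := by
  obtain ⟨ψ, h⟩ := hS
  exact ⟨ψ, fun g _ u => h g u⟩

omit [Module.Finite k U] in
lemma eqOn_of_linear (f : U →ₗ[MonoidAlgebra k Γ] S) :
    EqOn (rp k Γ U) (rp k Γ S) ⊤ (f.restrictScalars k) := fun g _ u => map_rp k Γ f g u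

variable [Fintype Γ] [Nontrivial S]

lemma twStable_of_sum_eq_id (hU : IndecMod (MonoidAlgebra k Γ) U) {α : Γ ≃* Γ}
    (hid : ∃ a, ∑ g : Γ, (rp k Γ U).linHom (rp k Γ U) g a = LinearMap.id)
    {π : U →ₗ[MonoidAlgebra k Γ] S} (hs : Function.Surjective π)
    (hS : TwStable k (α : Γ →* Γ) S) : TwStable k (α : Γ →* Γ) U := by
  obtain ⟨ψ, hψ⟩ := exists_eqOn_of_twStable hS
  have hπ := eqOn_of_linear π
  have hπ' := hπ.tw (α : Γ →* Γ)
  have hid' : ∃ a, ∑ g : Γ, (tw (rp k Γ U) (α : Γ →* Γ)).linHom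
      (tw (rp k Γ U) (α : Γ →* Γ)) g a = LinearMap.id := by
    obtain ⟨a, ha⟩ := hid
    exact ⟨a, (sum_linHom_tw α a).trans ha⟩
  obtain ⟨F, hF, h1, -⟩ := exists_lift_of_sum ((hψ.symm.comp hπ).comp_sum hid) hπ' hs
  obtain ⟨F', hF', h2, -⟩ := exists_lift_of_sum ((hψ.comp hπ').comp_sum hid') hπ hs
  refine twStable_of_comp hU hF hF' (not_isNilpotent_of_comp_eq (π := π.restrictScalars k) hs ?_)
  rw [Module.End.mul_eq_comp, ← LinearMap.comp_assoc, h2, LinearMap.comp_id, LinearMap.comp_assoc,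
    h1, LinearMap.comp_id]
  exact LinearMap.ext fun u => ψ.apply_symm_apply _

lemma not_mem_nul_of_surjective (hU : IndecMod (MonoidAlgebra k Γ) U) {D : Subgroup Γ}
    {θ : S →ₗ[k] S} (hθ : ∀ d ∈ D, (rp k Γ S).linHom (rp k Γ S) d θ = θ)
    (hθ1 : qtr ((rp k Γ S).linHom (rp k Γ S)) D θ = LinearMap.id)
    (hid : ¬ ∃ a, ∑ g : Γ, (rp k Γ U).linHom (rp k Γ U) g a = LinearMap.id)
    {π : U →ₗ[MonoidAlgebra k Γ] S} (hs : Function.Surjective π) :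
    π.restrictScalars k ∉ nul ((rp k Γ U).linHom (rp k Γ S)) D := by
  intro h
  have hπ := eqOn_of_linear π
  obtain ⟨F, hF, h1, h2⟩ := exists_lift_of_sum (exists_sum_eq_of_mem_nul hθ hθ1 hπ h) hπ hs
  have hb := bijective_of_eqOn hU hF
    (not_isNilpotent_of_comp_eq (π := π.restrictScalars k) hs h1)
  let e : U ≃ₗ[k] U := LinearEquiv.ofBijective F hb
  have he : EqOn (rp k Γ U) (rp k Γ U) ⊤ (e : U →ₗ[k] U) := hF
  refine hid ?_
  have := he.symm.comp_sum h2
  rwa [show (e.symm : U →ₗ[k] U) ∘ₗ F = LinearMap.id from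
    LinearMap.ext fun u => e.symm_apply_apply u] at this

end Stability

/-! ### Traces over cyclic `p`-groups -/

section CyclicTrace

open scoped Classical

variable {k : Type} [Field k] {p n : ℕ} [Fact p.Prime] [CharP k p]

lemma sum_pow_prime_pow {A : Type} [Ring A] [Algebra k A] (T : A) :
    ∑ i ∈ Finset.range (p ^ n), T ^ i = (T - 1) ^ (p ^ n - 1) := by
  have h : ∑ i ∈ Finset.range (p ^ n), (Polynomial.X : Polynomial k) ^ i =
      (Polynomial.X - 1) ^ (p ^ n - 1) := by
    have h0 : (Polynomial.X - 1 : Polynomial k) ≠ 0 := by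
      simpa using Polynomial.X_sub_C_ne_zero (1 : k)
    refine mul_right_cancel₀ h0 ?_
    rw [geom_sum_mul, pow_sub_one_mul (pow_pos (Fact.out : p.Prime).pos n).ne',
      sub_pow_char_pow, one_pow]
  simpa using congrArg (Polynomial.aeval T) h

lemma pow_prime_pow_sub_one {A : Type} [Ring A] [Algebra k A] (T : A) :
    T ^ p ^ n - 1 = (T - 1) ^ p ^ n := by
  have h : (Polynomial.X - 1 : Polynomial k) ^ p ^ n = Polynomial.X ^ p ^ n - 1 := by
    rw [sub_pow_char_pow, one_pow]
  simpa using (congrArg (Polynomial.aeval T) h).symm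

lemma sum_zpowers {Γ M : Type} [Group Γ] [Fintype Γ] [AddCommGroup M] (t : Γ) (F : Γ → M) :
    ∑ d : Subgroup.zpowers t, F d = ∑ i ∈ Finset.range (orderOf t), F (t ^ i) := by
  rw [← Fin.sum_univ_eq_sum_range (fun i => F (t ^ i))]
  exact (Fintype.sum_equiv (finEquivZPowers (isOfFinOrder_of_finite t)) _ _ fun i => by
    simp [finEquivZPowers_apply]).symm

/-- If the identity is a trace from the trivial subgroup to the socle of a cyclic `p`-group,
it is a trace from the trivial subgroup to the whole cyclic group. -/
lemma id_mem_nul_zpowers {Γ S : Type} [Group Γ] [Fintype Γ] [AddCommGroup S] [Module k S]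
    {σ : Representation k Γ S} {t : Γ} (ht : orderOf t = p ^ (n + 1))
    (h : LinearMap.id ∈ nul (σ.linHom σ) (Subgroup.zpowers (t ^ p ^ n))) :
    LinearMap.id ∈ nul (σ.linHom σ) (Subgroup.zpowers t) := by
  obtain ⟨a, ha⟩ := mem_nul.1 h
  rw [sum_zpowers _ (fun g => σ.linHom σ g a), orderOf_pow_prime ht] at ha
  set T : Module.End k (Module.End k S) := σ.linHom σ t with hT
  have hTp : ∀ i, σ.linHom σ (t ^ i) = T ^ i := fun i => map_pow _ _ _
  have hmul : ∀ i (f g : Module.End k S), (T ^ i) (f * g) = (T ^ i) f * (T ^ i) g := by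
    intro i f g
    rw [← hTp]
    refine LinearMap.ext fun u => ?_
    simp only [Representation.linHom_apply, LinearMap.comp_apply, Module.End.mul_apply,
      Representation.inv_self_apply]
  have hone : T 1 = 1 := by
    refine LinearMap.ext fun u => ?_
    simp [hT, Representation.linHom_apply]
  have hp := (Fact.out : p.Prime).two_le
  have hq : 0 < p ^ n := pow_pos (by omega) n
  have ha' : ∑ j ∈ Finset.range p, (T ^ p ^ n) ^ j = (T - 1) ^ (p ^ n * (p - 1)) := by
    have := sum_pow_prime_pow (k := k) (p := p) (n := 1) (T ^ p ^ n)
    rw [pow_one, pow_prime_pow_sub_one (k := k), ← pow_mul] at this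
    exact this
  have ha1 : ((T - 1) ^ (p ^ n * (p - 1))) a = 1 := by
    rw [← ha', LinearMap.sum_apply]
    refine Eq.trans (Finset.sum_congr rfl fun j _ => ?_) ha
    rw [map_pow, hTp]
  have hle : p ^ n - 1 ≤ p ^ n * (p - 1) :=
    (Nat.sub_le _ _).trans (Nat.le_mul_of_pos_right _ (by omega))
  set v := ((T - 1) ^ (p ^ n * (p - 1) - (p ^ n - 1))) a with hv
  have hv1 : ((T - 1) ^ (p ^ n - 1)) v = 1 := by
    rw [hv, ← Module.End.mul_apply, ← pow_add, Nat.add_sub_cancel' hle, ha1]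
  have hv2 : (T ^ p ^ n) v = v := by
    rw [← sub_eq_zero]
    have : (T ^ p ^ n - 1) v = 0 := by
      rw [pow_prime_pow_sub_one (k := k), show p ^ n = p ^ n - 1 + 1 from
        (Nat.sub_add_cancel hq).symm, pow_succ', Module.End.mul_apply, hv1, LinearMap.sub_apply, hone, Module.End.one_apply, sub_self]
    exact this
  have hv3 : ∀ j : ℕ, (T ^ (p ^ n * j)) v = v := by
    intro j
    induction j with
    | zero => rfl
    | succ j ih => rw [mul_add, mul_one, pow_add, Module.End.mul_apply, hv2, ih]
  refine mem_nul.2 ⟨a * v, ?_⟩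
  have hfac : ∑ i ∈ Finset.range (p ^ (n + 1)), T ^ i =
      (T - 1) ^ (p ^ n - 1) * ∑ j ∈ Finset.range p, (T ^ p ^ n) ^ j := by
    rw [sum_pow_prime_pow (k := k), ha', ← pow_add]
    congr 1
    rw [pow_succ, Nat.mul_sub, mul_one]
    have := Nat.le_mul_of_pos_right (p ^ n) (show 0 < p by omega)
    omega
  have hav : (∑ j ∈ Finset.range p, (T ^ p ^ n) ^ j) (a * v) = v := by
    rw [LinearMap.sum_apply]
    calc ∑ j ∈ Finset.range p, ((T ^ p ^ n) ^ j) (a * v)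
        = ∑ j ∈ Finset.range p, σ.linHom σ ((t ^ p ^ n) ^ j) a * v :=
          Finset.sum_congr rfl fun j _ => by
            rw [← pow_mul, ← pow_mul, hmul, hv3, hTp]
      _ = v := by
          rw [← Finset.sum_mul, ha]
          exact one_mul v
  rw [sum_zpowers _ (fun g => σ.linHom σ g (a * v)), ht]
  have := congrArg (fun f : Module.End k (Module.End k S) => f (a * v)) hfac
  simp only [Module.End.mul_apply, hav, hv1, LinearMap.sum_apply] at this
  refine Eq.trans (Finset.sum_congr rfl fun j _ => ?_) this
  rw [hTp]

end CyclicTrace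

/-! ### Class functions acting on representations -/

section ClassFunctions

open scoped Classical

variable {k Γ : Type} [Field k] [Group Γ] [Fintype Γ]

/-- The action of a function on the group on a representation. -/
noncomputable def wact {U : Type} [AddCommGroup U] [Module k U] (w : Γ → k)
    (ρ : Representation k Γ U) : Module.End k U := ∑ g, w g • ρ g

/-- The restriction of a function on the group to a subgroup, as an element of the group
algebra. -/
noncomputable def locElt (w : Γ → k) (N : Subgroup Γ) : MonoidAlgebra k N :=
  ∑ n : N, MonoidAlgebra.single n (w n)

lemma locElt_smul (w : Γ → k) (N : Subgroup Γ) {Y : Type} [AddCommGroup Y] [Module k Y]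
    [Module (MonoidAlgebra k N) Y] [IsScalarTower k (MonoidAlgebra k N) Y] (y : Y) :
    locElt w N • y = ∑ n : N, w n • rp k N Y n y := by
  rw [locElt, Finset.sum_smul]
  refine Finset.sum_congr rfl fun n _ => ?_
  rw [rp_apply, ← smul_assoc, MonoidAlgebra.of_apply, MonoidAlgebra.smul_single, smul_eq_mul,
    mul_one]

lemma locElt_comm {w : Γ → k} (hw : ∀ g h, w (g * h * g⁻¹) = w h) (N : Subgroup Γ)
    (a : MonoidAlgebra k N) : a * locElt w N = locElt w N * a := by
  refine MonoidAlgebra.induction_linear a ?_ ?_ ?_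
  · rw [zero_mul, mul_zero]
  · intro a b ha hb
    rw [add_mul, mul_add, ha, hb]
  · intro g r
    rw [locElt, Finset.mul_sum, Finset.sum_mul]
    refine Fintype.sum_equiv (MulAut.conj g).toEquiv _ _ fun n => ?_
    have h1 : (MulAut.conj g).toEquiv n = g * n * g⁻¹ := rfl
    rw [h1, MonoidAlgebra.single_mul_single, MonoidAlgebra.single_mul_single,
      inv_mul_cancel_right]
    congr 1
    rw [mul_comm r]
    congr 1
    exact (hw g n).symm

/-- On modules in the block, the local part of the block idempotent acts as the identity up to
null maps. -/
lemma id_sub_mem_nul {U : Type} [AddCommGroup U] [Module k U] {ρ : Representation k Γ U}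
    {w : Γ → k} (hw : ∀ g h, w (g * h * g⁻¹) = w h) {D N : Subgroup Γ} (hDN : D ≤ N)
    (hN : ∀ g, g ∉ N → ∀ d ∈ D, g⁻¹ * d * g ∈ D → d = 1) :
    wact w ρ - ∑ n : N, w n • ρ n ∈ nul (ρ.linHom ρ) D := by
  have h1 : ∑ n : N, w n • ρ n = ∑ g : Γ, if g ∈ N then w g • ρ g else 0 := by
    rw [← Finset.sum_filter]
    exact (Finset.sum_subtype _ (by simp) (fun g => w g • ρ g)).symm
  have h2 : wact w ρ - ∑ n : N, w n • ρ n = ∑ g : Γ, if g ∈ N then 0 else w g • ρ g := by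
    rw [h1, wact, ← Finset.sum_sub_distrib]
    refine Finset.sum_congr rfl fun g _ => ?_
    split_ifs <;> simp
  rw [h2]
  let _ : MulAction D Γ := MulAction.compHom (M := MulAut Γ) Γ (MulAut.conj.comp D.subtype)
  have hact : ∀ (d : D) (x : Γ), d • x = d * x * (d : Γ)⁻¹ := fun d x => rfl
  refine sum_mem_nul (X := Γ) (F := fun g => if g ∈ N then 0 else w g • ρ g) ?_ ?_
  · intro d x
    have hdN := hDN d.2
    have h : (d : Γ) * x * (d : Γ)⁻¹ ∈ N ↔ x ∈ N := by
      rw [N.mul_mem_cancel_right (N.inv_mem hdN), N.mul_mem_cancel_left hdN]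
    simp only [hact, h, hw]
    split_ifs
    · rw [map_zero]
    · rw [map_smul, Representation.linHom_apply, map_mul, map_mul]
      rfl
  · intro x d hx hd
    rw [if_pos]
    by_contra hxN
    refine hd (Subtype.ext (hN x hxN d d.2 ?_))
    rw [hact] at hx
    have : x⁻¹ * (d : Γ) * x = d := by
      rw [mul_assoc, inv_mul_eq_iff_eq_mul]
      exact eq_mul_of_mul_inv_eq hx
    rw [this]
    exact d.2

/-- An automorphism fixing a non-null representation up to isomorphism maps the socle of the
cyclic group `⟨t⟩` to a conjugate. -/
lemma exists_conj_mem {p n : ℕ} [Fact p.Prime] {t : Γ} (ht : orderOf t = p ^ (n + 1))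
    {S : Type} [AddCommGroup S] [Module k S] {σ : Representation k Γ S} {α : Γ →* Γ}
    {ψ : S ≃ₗ[k] S} (hψ : EqOn (tw σ α) σ ⊤ (ψ : S →ₗ[k] S)) {θ : S →ₗ[k] S}
    (hθ : ∀ d ∈ Subgroup.zpowers t, σ.linHom σ d θ = θ)
    (hθ1 : qtr (σ.linHom σ) (Subgroup.zpowers t) θ = LinearMap.id)
    (hid : LinearMap.id ∉ nul (σ.linHom σ) (Subgroup.zpowers t)) :
    ∃ y, y * α (t ^ p ^ n) * y⁻¹ ∈ Subgroup.zpowers (t ^ p ^ n) := by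
  by_contra hcon
  refine hid ?_
  have h : LinearMap.id ∈ nul ((tw σ α).linHom (tw σ α)) (Subgroup.zpowers t) := by
    rw [← hθ1, qtr]
    let _ : MulAction (Subgroup.zpowers t) (Γ ⧸ Subgroup.zpowers t) :=
      MulAction.compHom (M := Γ) _ (α.comp (Subgroup.zpowers t).subtype)
    have hact : ∀ (d : Subgroup.zpowers t) (x : Γ ⧸ Subgroup.zpowers t),
      d • x = (α d : Γ) • x := fun d x => rfl
    refine sum_mem_nul (F := fun x : Γ ⧸ Subgroup.zpowers t => σ.linHom σ x.out θ) ?_ ?_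
    · intro d x
      rw [hact, linHom_tw]
      induction x using QuotientGroup.induction_on with | _ y =>
      rw [MulAction.Quotient.smul_mk, smul_eq_mul,
        apply_out_eq (F := fun g => σ.linHom σ g θ) (fix_right hθ),
        apply_out_eq (F := fun g => σ.linHom σ g θ) (fix_right hθ), map_mul]
      rfl
    · intro x d hx hd
      exfalso
      refine hcon ⟨x.out⁻¹, ?_⟩
      have h1 : x.out⁻¹ * α d * x.out ∈ Subgroup.zpowers t := by
        rw [hact] at hx
        rw [mul_assoc, ← QuotientGroup.eq, ← smul_eq_mul (α (d : Γ)), ← MulAction.Quotient.smul_mk,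
          QuotientGroup.out_eq', hx]
      have := map_mem_zpowers ht ((MulAut.conj x.out⁻¹).toMonoidHom.comp α) d.2
        (fun h => hd (Subtype.ext h)) (by simpa using h1)
      simpa using this
  have := hψ.symm.anti (le_top (a := Subgroup.zpowers t)) |>.mem_nul_comp
    ((hψ.anti le_top).comp_mem_nul h)
  rwa [LinearMap.comp_id, show (ψ : S →ₗ[k] S) ∘ₗ (ψ.symm : S →ₗ[k] S) = LinearMap.id from
    LinearMap.ext fun u => ψ.apply_symm_apply u] at this

end ClassFunctions

/-! ### Relative traces over the local subgroup -/

section LocalTrace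

open scoped Classical

lemma subgroupOf_zpowers {Γ : Type} [Group Γ] {N : Subgroup Γ} {t : Γ} (htN : t ∈ N) :
    (Subgroup.zpowers t).subgroupOf N = Subgroup.zpowers (⟨t, htN⟩ : N) := by
  ext x
  rw [Subgroup.mem_subgroupOf]
  constructor
  · rintro ⟨i, hi⟩
    exact ⟨i, Subtype.ext hi⟩
  · rintro ⟨i, rfl⟩
    exact ⟨i, rfl⟩

variable {k : Type} [Field k] {p : ℕ} [Fact p.Prime] [CharP k p]

/-- A normal element of order `p` acts trivially on simple modules in characteristic `p`. -/
lemma rp_eq_one_of_simple {N W : Type} [Group N] [AddCommGroup W] [Module k W]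
    [Module (MonoidAlgebra k N) W] [IsScalarTower k (MonoidAlgebra k N) W]
    [IsSimpleModule (MonoidAlgebra k N) W] {z : N} (hz : z ^ p = 1)
    (hn : ∀ g : N, g⁻¹ * z * g ∈ Subgroup.zpowers z) : rp k N W z = 1 := by
  let T : Module.End k W := rp k N W z
  let K : Submodule (MonoidAlgebra k N) W :=
    subOf (LinearMap.ker (T - 1)) fun g y hy => by
      rw [LinearMap.mem_ker, LinearMap.sub_apply, sub_eq_zero] at hy ⊢
      obtain ⟨i, hi⟩ := hn g
      have hi : z ^ i = g⁻¹ * z * g := hi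
      have hzy : ∀ i : ℤ, rp k N W (z ^ i) y = y := by
        have hs : Subgroup.zpowers z ≤
            { carrier := {h | rp k N W h y = y}
              mul_mem' := fun {a b} ha hb => by
                simp only [Set.mem_ofPred_eq] at ha hb ⊢
                rw [map_mul, Module.End.mul_apply, hb, ha]
              one_mem' := by simp
              inv_mem' := fun {a} ha => by
                simp only [Set.mem_ofPred_eq] at ha ⊢
                conv_lhs => rw [← ha]
                exact Representation.inv_self_apply _ _ _ } :=
          (Subgroup.zpowers_le).2 hy
        exact fun i => hs ⟨i, rfl⟩
      have hzg : z * g = g * z ^ i := by rw [hi]; group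
      show rp k N W z (rp k N W g y) = rp k N W g y
      rw [← Module.End.mul_apply, ← map_mul, hzg, map_mul, Module.End.mul_apply, hzy]
  have hK : K = ⊤ := by
    refine (eq_bot_or_eq_top K).resolve_left fun hK => ?_
    have hinj : Function.Injective (T - 1 : Module.End k W) := by
      rw [← LinearMap.ker_eq_bot, eq_bot_iff]
      intro y hy
      have : y ∈ K := hy
      rwa [hK] at this
    have hpow : (T - 1) ^ p = 0 := by
      have := pow_prime_pow_sub_one (k := k) (p := p) (n := 1) T
      rw [pow_one] at this
      rw [← this, ← map_pow (rp k N W), hz, map_one, sub_self]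
    have : Nontrivial W := IsSimpleModule.nontrivial (MonoidAlgebra k N) W
    obtain ⟨y, hy⟩ := exists_ne (0 : W)
    refine hy (hinj.iterate p ?_)
    rw [← Module.End.coe_pow, hpow]
    rfl
  refine LinearMap.ext fun y => ?_
  have : y ∈ K := hK ▸ Submodule.mem_top
  exact sub_eq_zero.1 this

variable {n : ℕ} {Γ : Type} [Group Γ] [Fintype Γ] {t : Γ}

lemma exists_trace_of_extension (ht : orderOf t = p ^ (n + 1)) {N : Subgroup Γ}
    (hN : N = locNorm (t ^ p ^ n)) {w : Γ → k} {W I : Type} [AddCommGroup W] [Module k W]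
    [Module (MonoidAlgebra k N) W] [IsScalarTower k (MonoidAlgebra k N) W]
    [IsSimpleModule (MonoidAlgebra k N) W]
    [AddCommGroup I] [Module k I] {ρ : Representation k Γ I} {θ : I →ₗ[k] I}
    (hθ : ∀ d ∈ Subgroup.zpowers t, ρ.linHom ρ d θ = θ)
    (hθ1 : qtr (ρ.linHom ρ) (Subgroup.zpowers t) θ = wact w ρ)
    {ev : I →ₗ[k] W} {ι : W →ₗ[k] I}
    (hev : ∀ (g : N) f, ev (ρ g f) = rp k N W g (ev f))
    (hι : ∀ (g : N) v, ι (rp k N W g v) = ρ g (ι v)) :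
    ∃ θ' : W →ₗ[k] W,
      (∀ d ∈ (Subgroup.zpowers t).subgroupOf N, (rp k N W).linHom (rp k N W) d θ' = θ') ∧
      qtr ((rp k N W).linHom (rp k N W)) ((Subgroup.zpowers t).subgroupOf N) θ' =
        ev ∘ₗ wact w ρ ∘ₗ ι := by
  let D := Subgroup.zpowers t
  have hDN : D ≤ N := hN ▸ zpowers_le_locNorm t _
  let P : Module.End k I →ₗ[k] Module.End k W :=
    (LinearMap.lcomp k W ι) ∘ₗ (LinearMap.llcomp k I I W ev)
  have hP : ∀ f, P f = ev ∘ₗ f ∘ₗ ι := fun f => rfl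
  have hPeq : ∀ (g : N) f, P (ρ.linHom ρ g f) = (rp k N W).linHom (rp k N W) g (P f) := by
    intro g f
    refine LinearMap.ext fun v => ?_
    simp only [hP, LinearMap.comp_apply, Representation.linHom_apply, hev, hι,
      ← Subgroup.coe_inv]
  have hDfix : ∀ d ∈ D.subgroupOf N, (rp k N W).linHom (rp k N W) d (P θ) = P θ := by
    intro d hd
    rw [← hPeq, hθ _ (Subgroup.mem_subgroupOf.1 hd)]
  refine ⟨P θ, hDfix, ?_⟩
  have h0 : P (qtr (ρ.linHom ρ) D θ - qtrOn (ρ.linHom ρ) D N θ) = 0 := by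
    obtain ⟨a, ha⟩ := mem_nul.1
      (qtr_sub_qtrOn_mem hDN (hN ▸ eq_one_of_not_mem_locNorm ht) hθ)
    have hnul : P (qtr (ρ.linHom ρ) D θ - qtrOn (ρ.linHom ρ) D N θ) ∈
        nul ((rp k N W).linHom (rp k N W)) (D.subgroupOf N) := by
      refine mem_nul.2 ⟨P a, ?_⟩
      rw [← ha, map_sum]
      refine Fintype.sum_equiv (Subgroup.subgroupOfEquivOfLe hDN).toEquiv _ _ fun d => ?_
      exact (hPeq d a).symm
    have hzN : t ^ p ^ n ∈ N := hDN (Subgroup.npow_mem_zpowers t _)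
    have hle : Subgroup.zpowers (⟨_, hzN⟩ : N) ≤ D.subgroupOf N := by
      rw [Subgroup.zpowers_le, Subgroup.mem_subgroupOf]
      exact Subgroup.npow_mem_zpowers t _
    obtain ⟨a', ha'⟩ := mem_nul.1 (nul_anti hle hnul)
    have hz1 : rp k N W ⟨_, hzN⟩ = 1 := by
      refine rp_eq_one_of_simple (p := p) (Subtype.ext (pow_prime_eq_one ht)) fun g => ?_
      have := mem_locNorm.1 (hN ▸ (g⁻¹).2 : ((g⁻¹ : N) : Γ) ∈ locNorm (t ^ p ^ n))
      obtain ⟨i, hi⟩ := this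
      refine ⟨i, Subtype.ext ?_⟩
      simpa using hi
    have ho : orderOf (⟨_, hzN⟩ : N) = p := by
      rw [Subgroup.orderOf_mk]; exact orderOf_pow_prime ht
    rw [← ha', sum_zpowers _ (fun g => (rp k N W).linHom (rp k N W) g a'), ho]
    have hfix : ∀ i : ℕ, (rp k N W).linHom (rp k N W) ((⟨_, hzN⟩ : N) ^ i) a' = a' := by
      intro i
      refine LinearMap.ext fun v => ?_
      rw [Representation.linHom_apply, LinearMap.comp_apply, LinearMap.comp_apply, map_pow, hz1,
        one_pow, Module.End.one_apply]
      congr 1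
      have h2 : rp k N W ((⟨_, hzN⟩ : N) ^ i) = 1 := by rw [map_pow, hz1, one_pow]
      have h3 := Representation.inv_self_apply (rp k N W) ((⟨_, hzN⟩ : N) ^ i) v
      rwa [h2] at h3
    rw [Finset.sum_congr rfl fun i _ => hfix i, Finset.sum_const, Finset.card_range,
      ← Nat.cast_smul_eq_nsmul k, CharP.cast_eq_zero, zero_smul]
  have h1 : P (qtrOn (ρ.linHom ρ) D N θ) =
      qtr ((rp k N W).linHom (rp k N W)) (D.subgroupOf N) (P θ) := by
    rw [qtrOn, ← sum_subgroupOf hDN (F := fun g => ρ.linHom ρ g θ) (fix_right hθ), map_sum, qtr]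
    exact Finset.sum_congr rfl fun x _ => hPeq _ _
  rw [← h1, ← hP, ← hθ1]
  rw [map_sub, sub_eq_zero] at h0
  exact h0.symm

end LocalTrace

/-! ### Trace forms for simple modules of the local subgroup -/

section LocalSimple

open scoped Classical

variable {k : Type} [Field k] {Γ : Type} [Group Γ] [Fintype Γ]

/-- Every representation has a `t`-equivariant endomorphism whose relative trace is the action
of `w`. -/
def HasTraces (k : Type) [Field k] {Γ : Type} [Group Γ] [Fintype Γ] (t : Γ) (w : Γ → k) : Prop :=
  ∀ (V : Type) [AddCommGroup V] [Module k V] (ρ : Representation k Γ V),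
    ∃ θ : V →ₗ[k] V, (∀ d ∈ Subgroup.zpowers t, ρ.linHom ρ d θ = θ) ∧
      qtr (ρ.linHom ρ) (Subgroup.zpowers t) θ = wact w ρ

/-- The functions supported on a subgroup inside the coinduced module. -/
noncomputable def coindUnit {N : Subgroup Γ} {W : Type} [AddCommGroup W] [Module k W]
    (σ : Representation k N W) : W →ₗ[k] Representation.coindV N.subtype σ where
  toFun v := ⟨fun g => if h : g ∈ N then σ ⟨g, h⟩ v else 0, fun n g => by
    by_cases h : g ∈ N
    · have h' : N.subtype n * g ∈ N := N.mul_mem n.2 h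
      simp only [dif_pos h, dif_pos h']
      rw [← Module.End.mul_apply, ← map_mul]
      rfl
    · have h' : N.subtype n * g ∉ N := fun h' => h ((N.mul_mem_cancel_left n.2).1 h')
      simp only [dif_neg h, dif_neg h', map_zero]⟩
  map_add' v w := by
    refine Subtype.ext (funext fun g => ?_)
    by_cases h : g ∈ N <;> simp [h]
  map_smul' r v := by
    refine Subtype.ext (funext fun g => ?_)
    by_cases h : g ∈ N <;> simp [h]

omit [Fintype Γ] in
lemma coindUnit_apply {N : Subgroup Γ} {W : Type} [AddCommGroup W] [Module k W]
    (σ : Representation k N W) (v : W) (g : Γ) :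
    (coindUnit σ v : Γ → W) g = if h : g ∈ N then σ ⟨g, h⟩ v else 0 := rfl

lemma simpleTrace [IsAlgClosed k] {p n : ℕ} [Fact p.Prime] [CharP k p] {t : Γ}
    (ht : orderOf t = p ^ (n + 1)) {w : Γ → k} (hw : ∀ g h, w (g * h * g⁻¹) = w h)
    (hT : HasTraces k t w) {N : Subgroup Γ} (hN : N = locNorm (t ^ p ^ n)) (htN : t ∈ N) :
    SimpleTrace (locElt w N) (Subgroup.zpowers (⟨t, htN⟩ : N)) := by
  intro W _ _ _ _ _ _ hW
  obtain ⟨θ, hθ, hθ1⟩ := hT _ (Representation.coind N.subtype (rp k N W))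
  let ev : Representation.coindV N.subtype (rp k N W) →ₗ[k] W :=
    (LinearMap.proj (1 : Γ)) ∘ₗ (Representation.coindV N.subtype (rp k N W)).subtype
  have hev0 : ∀ (g : Γ) f, ev (Representation.coind N.subtype (rp k N W) g f) = f.1 g := by
    intro g f
    show f.1 (1 * g) = f.1 g
    rw [one_mul]
  obtain ⟨θ', hθ', hθ1'⟩ := exists_trace_of_extension ht hN hθ hθ1 (ev := ev)
    (ι := coindUnit (rp k N W))
    (fun g f => by
      rw [hev0]
      have := f.2 g 1
      rwa [mul_one] at this)
    (fun g v => by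
      refine Subtype.ext (funext fun x => ?_)
      show (coindUnit (rp k N W) (rp k N W g v) : Γ → W) x =
        (coindUnit (rp k N W) v : Γ → W) (x * g)
      rw [coindUnit_apply, coindUnit_apply]
      by_cases h : x ∈ N
      · have h' : x * g ∈ N := N.mul_mem h g.2
        rw [dif_pos h, dif_pos h', ← Module.End.mul_apply, ← map_mul]
        rfl
      · have h' : x * g ∉ N := fun h' => h ((N.mul_mem_cancel_right g.2).1 h')
        rw [dif_neg h, dif_neg h'])
  have hact : ∀ v, (ev ∘ₗ wact w (Representation.coind N.subtype (rp k N W)) ∘ₗ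
      coindUnit (rp k N W)) v = locElt w N • v := by
    intro v
    have h0 : (ev ∘ₗ wact w (Representation.coind N.subtype (rp k N W)) ∘ₗ
        coindUnit (rp k N W)) v = ev (wact w (Representation.coind N.subtype (rp k N W))
          (coindUnit (rp k N W) v)) := rfl
    rw [h0, wact, LinearMap.sum_apply, map_sum, locElt_smul]
    have : ∀ g : Γ, ev ((w g • Representation.coind N.subtype (rp k N W) g)
        (coindUnit (rp k N W) v)) = if h : g ∈ N then w g • rp k N W ⟨g, h⟩ v else 0 := by
      intro g
      rw [LinearMap.smul_apply, map_smul, hev0, coindUnit_apply]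
      split_ifs
      · rfl
      · rw [smul_zero]
    rw [Finset.sum_congr rfl fun g _ => this g]
    let G : Γ → W := fun g => if h : g ∈ N then w g • rp k N W ⟨g, h⟩ v else 0
    have h2 : ∑ g : Γ, G g = ∑ g : N, G g := by
      rw [← Finset.sum_subtype (Finset.univ.filter (· ∈ N)) (by simp) G, Finset.sum_filter]
      refine Finset.sum_congr rfl fun g _ => ?_
      by_cases h : g ∈ N
      · rw [if_pos h]
      · rw [if_neg h]
        exact dif_neg h
    exact h2.trans (Finset.sum_congr rfl fun g _ => dif_pos g.2)
  have : Nontrivial W := IsSimpleModule.nontrivial (MonoidAlgebra k N) W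
  obtain ⟨s, hs⟩ := exists_smul_of_comm (k := k) (N := N) (Y := W)
    (ev ∘ₗ wact w (Representation.coind N.subtype (rp k N W)) ∘ₗ coindUnit (rp k N W))
    (fun g y => by
      rw [hact, hact, rp_apply, rp_apply, smul_smul, smul_smul, locElt_comm hw])
  obtain ⟨y, hy⟩ := exists_ne (0 : W)
  have hs0 : s ≠ 0 := by
    rintro rfl
    refine hy (hW y ?_)
    rw [← hact, hs, zero_smul]
  refine ⟨s⁻¹ • θ', fun d hd => ?_, ?_⟩
  · rw [map_smul, hθ' d]
    rwa [subgroupOf_zpowers htN]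
  · refine LinearMap.ext fun v => ?_
    have h1 : qtr ((rp k N W).linHom (rp k N W)) (Subgroup.zpowers (⟨t, htN⟩ : N)) (s⁻¹ • θ') =
        s⁻¹ • qtr ((rp k N W).linHom (rp k N W)) (Subgroup.zpowers (⟨t, htN⟩ : N)) θ' := by
      simp only [qtr, map_smul, Finset.smul_sum]
    rw [h1, ← subgroupOf_zpowers htN, hθ1', LinearMap.smul_apply, hs, smul_smul,
      inv_mul_cancel₀ hs0, one_smul, LinearMap.id_apply]

end LocalSimple

/-! ### Semilinear automorphisms of chain modules -/

section Semilinear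

variable {k N : Type} [Field k] [Group N]

lemma rp_asModule {V : Type} [AddCommGroup V] [Module k V] (ρ : Representation k N V) (g : N)
    (v : V) : rp k N ρ.asModule g (ρ.asModuleEquiv.symm v) = ρ.asModuleEquiv.symm (ρ g v) := by
  rw [rp_apply, MonoidAlgebra.of_apply, ← ρ.asModuleEquiv.symm_apply_apply
    (MonoidAlgebra.single g (1 : k) • _), Representation.asModuleEquiv_map_smul,
    Representation.asAlgebraHom_single_one, LinearEquiv.apply_symm_apply]

variable {V V1 V' : Type} [AddCommGroup V] [Module k V] [Module (MonoidAlgebra k N) V]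
  [IsScalarTower k (MonoidAlgebra k N) V] [AddCommGroup V1] [Module k V1]
  [Module (MonoidAlgebra k N) V1] [IsScalarTower k (MonoidAlgebra k N) V1]
  [AddCommGroup V'] [Module k V'] [Module (MonoidAlgebra k N) V']
  [IsScalarTower k (MonoidAlgebra k N) V'] {α : N ≃* N}

lemma IsChainMod.of_semilinear (hV : IsChainMod (MonoidAlgebra k N) V) (e : V ≃ₗ[k] V1)
    (he : ∀ n v, rp k N V1 n (e v) = e (rp k N V (α n) v)) :
    IsChainMod (MonoidAlgebra k N) V1 := by
  let C : Submodule (MonoidAlgebra k N) V1 → Submodule (MonoidAlgebra k N) V := fun S =>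
    subOf ((S.restrictScalars k).comap (e : V →ₗ[k] V1)) fun g y hy => by
      have h1 := he (α.symm g) y
      rw [MulEquiv.apply_symm_apply] at h1
      show e (rp k N V g y) ∈ S
      rw [← h1]
      exact rp_mem k N _ hy
  have hC : ∀ S T, C S ≤ C T → S ≤ T := fun S T h x hx => by
    have h1 : e.symm x ∈ C S := show e (e.symm x) ∈ S by rwa [e.apply_symm_apply]
    have h2 : e (e.symm x) ∈ T := h h1
    rwa [e.apply_symm_apply] at h2
  intro S T
  exact (hV (C S) (C T)).imp (hC S T) (hC T S)

variable [Module.Finite k V] [Module.Finite k V1] [Module.Finite k V']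

lemma exists_equiv_of_semilinear {c : MonoidAlgebra k N}
    (hL : UniqueCoatoms k (MonoidAlgebra k N) c) (hV : IsChainMod (MonoidAlgebra k N) V)
    (hV' : IsChainMod (MonoidAlgebra k N) V') (hcV : ActsInj c V) (e : V ≃ₗ[k] V1)
    (he : ∀ n v, rp k N V1 n (e v) = e (rp k N V (α n) v)) (hce : ∀ v, c • e v = e (c • v))
    (β : V' ≃ₗ[k] V') (hβ : ∀ n v, β (rp k N V' n v) = rp k N V' (α n) (β v))
    (h : V →ₗ[MonoidAlgebra k N] V') (h0 : h ≠ 0) :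
    ∃ μ : V ≃ₗ[k] V, ∀ n v, μ (rp k N V n v) = rp k N V (α n) (μ v) := by
  let J : Submodule (MonoidAlgebra k N) V' :=
    subOf (((LinearMap.range h).restrictScalars k).comap (β : V' →ₗ[k] V')) fun g y hy => by
      show β (rp k N V' g y) ∈ LinearMap.range h
      rw [hβ]
      exact rp_mem k N _ hy
  have hJ : ∀ y, y ∈ J ↔ β y ∈ LinearMap.range h := fun y => Iff.rfl
  have hJI : J = LinearMap.range h := by
    have hr : Module.finrank k J = Module.finrank k (LinearMap.range h) := by
      have e1 := LinearEquiv.finrank_map_eq β (J.restrictScalars k)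
      have e2 : (J.restrictScalars k).map (β : V' →ₗ[k] V') =
          (LinearMap.range h).restrictScalars k := by
        ext x
        constructor
        · rintro ⟨y, hy, rfl⟩
          exact hy
        · intro hx
          refine ⟨β.symm x, ?_, β.apply_symm_apply x⟩
          show β (β.symm x) ∈ LinearMap.range h
          rwa [β.apply_symm_apply]
      have e3 : Module.finrank k ((J.restrictScalars k).map (β : V' →ₗ[k] V')) =
        Module.finrank k (LinearMap.range h) := by rw [e2]; rfl
      exact e1.symm.trans e3
    rcases hV' J (LinearMap.range h) with hl | hl
    · refine hl.antisymm ?_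
      by_contra hcon
      exact absurd hr (finrank_lt_of_lt_sub k (lt_of_le_not_ge hl hcon)).ne
    · refine le_antisymm ?_ hl
      by_contra hcon
      exact absurd hr (finrank_lt_of_lt_sub k (lt_of_le_not_ge hl hcon)).ne'
  have hmem : ∀ v, β.symm (h v) ∈ LinearMap.range h := fun v => by
    rw [← hJI, hJ, β.apply_symm_apply]
    exact ⟨v, rfl⟩
  let q : V1 →ₗ[k] LinearMap.range h :=
    { toFun := fun v => ⟨β.symm (h (e.symm v)), hmem _⟩
      map_add' := fun v w => Subtype.ext (by simp)
      map_smul' := fun r v => Subtype.ext (by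
        have := (h.restrictScalars k).map_smul r (e.symm v)
        simp only [LinearMap.coe_restrictScalars] at this
        simp [this]) }
  have hq : ∀ g y, q (rp k N V1 g y) = rp k N (LinearMap.range h) g (q y) := fun g y => by
    obtain ⟨v, rfl⟩ := e.surjective y
    refine Subtype.ext ?_
    rw [coe_rp, he]
    show β.symm (h (e.symm (e _))) = rp k N V' g (β.symm (h (e.symm (e v))))
    rw [e.symm_apply_apply, e.symm_apply_apply, map_rp, β.symm_apply_eq, hβ, β.apply_symm_apply]
  have hqs : Function.Surjective (linOf q hq) := by
    rintro ⟨x, hx⟩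
    rw [← hJI, hJ] at hx
    obtain ⟨v, hv⟩ := hx
    refine ⟨e v, Subtype.ext ?_⟩
    show β.symm (h (e.symm (e v))) = x
    rw [e.symm_apply_apply, hv, β.symm_apply_apply]
  have : Nontrivial (LinearMap.range h) := by
    rw [Submodule.nontrivial_iff_ne_bot]
    exact fun hb => h0 (LinearMap.range_eq_bot.1 hb)
  have := finite_sub k (LinearMap.range h)
  have hcV1 : ActsInj c V1 := fun y hy => by
    obtain ⟨v, rfl⟩ := e.surjective y
    rw [hce, LinearEquiv.map_eq_zero_iff] at hy
    rw [hcV v hy, map_zero]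
  obtain ⟨φ⟩ := nonempty_equiv_of_chain hL hV (hV.of_semilinear e he) hcV hcV1 e.finrank_eq
    h.rangeRestrict (linOf q hq) h.surjective_rangeRestrict hqs
  refine ⟨(φ.restrictScalars k).trans e.symm, fun n v => ?_⟩
  show e.symm (φ (rp k N V n v)) = rp k N V (α n) (e.symm (φ v))
  have h1 := map_rp k N (φ : V →ₗ[MonoidAlgebra k N] V1) n v
  rw [LinearEquiv.coe_coe] at h1
  rw [h1, e.symm_apply_eq, ← he, e.apply_symm_apply]

/-- A chain module with a nonzero map to a module that is stable under an automorphism is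
stable itself. -/
lemma exists_semi_of_chain {c : MonoidAlgebra k N}
    (hL : UniqueCoatoms k (MonoidAlgebra k N) c) (hV : IsChainMod (MonoidAlgebra k N) V)
    (hV' : IsChainMod (MonoidAlgebra k N) V') (hcV : ActsInj c V)
    (hcα : MonoidAlgebra.mapDomainRingHom k (α : N →* N) c = c)
    (β : V' ≃ₗ[k] V') (hβ : ∀ n v, β (rp k N V' n v) = rp k N V' (α n) (β v))
    (h : V →ₗ[MonoidAlgebra k N] V') (h0 : h ≠ 0) :
    ∃ μ : V ≃ₗ[k] V, ∀ n v, μ (rp k N V n v) = rp k N V (α n) (μ v) := by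
  let σ : Representation k N V := MonoidHom.comp (rp k N V) (α : N →* N)
  have he : ∀ n v, rp k N σ.asModule n (σ.asModuleEquiv.symm v) =
      σ.asModuleEquiv.symm (rp k N V (α n) v) := fun n v => rp_asModule σ n v
  have : Module.Finite k σ.asModule := Module.Finite.equiv σ.asModuleEquiv.symm
  refine exists_equiv_of_semilinear hL hV hV' hcV σ.asModuleEquiv.symm he ?_ β hβ h h0
  intro v
  have key : ∀ (a : MonoidAlgebra k N) v, a • σ.asModuleEquiv.symm v =
      σ.asModuleEquiv.symm (MonoidAlgebra.mapDomainRingHom k (α : N →* N) a • v) := by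
    intro a v
    refine MonoidAlgebra.induction_on (motive := fun a => a • σ.asModuleEquiv.symm v =
      σ.asModuleEquiv.symm (MonoidAlgebra.mapDomainRingHom k (α : N →* N) a • v)) a ?_ ?_ ?_
    · intro g
      rw [← rp_apply, he]
      simp [rp_apply]
    · intro a b ha hb
      rw [add_smul, map_add, add_smul, map_add, ha, hb]
    · intro r a ha
      have : MonoidAlgebra.mapDomainRingHom k (α : N →* N) (r • a) =
          r • MonoidAlgebra.mapDomainRingHom k (α : N →* N) a :=
        map_smul (MonoidAlgebra.mapDomainAlgHom k k (α : N →* N)) r a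
      rw [this, smul_assoc, smul_assoc, map_smul, ha]
  rw [key, hcα]

end Semilinear

section Conjugation

variable {k Γ : Type} [Field k] [Group Γ]

lemma TwStable.conj {U : Type} [AddCommGroup U] [Module k U] [Module (MonoidAlgebra k Γ) U]
    [IsScalarTower k (MonoidAlgebra k Γ) U] {α β : Γ →* Γ} (hU : TwStable k α U) (y : Γ)
    (hβ : ∀ g, β g = y * α g * y⁻¹) : TwStable k β U := by
  obtain ⟨ψ, hψ⟩ := hU
  let e : U ≃ₗ[k] U := LinearEquiv.ofLinearMap (rp k Γ U y⁻¹) (rp k Γ U y)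
    (LinearMap.ext fun u => Representation.inv_self_apply (rp k Γ U) y u)
    (LinearMap.ext fun u => Representation.self_inv_apply (rp k Γ U) y u)
  refine ⟨e.trans ψ, fun g u => ?_⟩
  show ψ (rp k Γ U y⁻¹ (rp k Γ U (β g) u)) = rp k Γ U g (ψ (rp k Γ U y⁻¹ u))
  rw [← hψ, ← Module.End.mul_apply, ← map_mul, ← Module.End.mul_apply (rp k Γ U (α g)),
    ← map_mul, hβ]
  congr 3
  group

end Conjugation

/-! ### Local summands detecting a map -/

section LocalSummands

open scoped Classical

variable {k : Type} [Field k]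

lemma exists_indec_idempotent {A M : Type} [Ring A] [Algebra k A] [AddCommGroup M] [Module k M]
    [Module A M] [IsScalarTower k A M] [Module.Finite k M] (T : AddSubmonoid (Module.End A M))
    (h1 : 1 ∉ T) : ∃ e : Module.End A M, e * e = e ∧ IndecMod A (LinearMap.range e) ∧ e ∉ T := by
  by_contra! hcon
  exact h1 (idempotent_mem (k := k) T hcon _ 1 (one_mul 1) le_rfl)

variable {Γ : Type} [Group Γ] {N D : Subgroup Γ} {U S : Type}
  [AddCommGroup U] [Module k U] [Module (MonoidAlgebra k N) U]
  [IsScalarTower k (MonoidAlgebra k N) U]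
  [AddCommGroup S] [Module k S] [Module (MonoidAlgebra k N) S]
  [IsScalarTower k (MonoidAlgebra k N) S]
  {ρ : Representation k Γ U} {σ : Representation k Γ S}

lemma eqOn_of_local (hρ : ∀ (n : N) u, rp k N U n u = ρ n u)
    (hσ : ∀ (n : N) u, rp k N S n u = σ n u) (f : U →ₗ[MonoidAlgebra k N] S) :
    EqOn ρ σ N (f.restrictScalars k) := by
  intro g hg u
  rw [← hρ ⟨g, hg⟩, ← hσ ⟨g, hg⟩]
  exact map_rp k N f _ _

variable [Fintype Γ] [Module.Finite k U] [Module.Finite k S]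

lemma exists_summands (hDN : D ≤ N) (hρ : ∀ (n : N) u, rp k N U n u = ρ n u)
    (hσ : ∀ (n : N) u, rp k N S n u = σ n u) {π : U →ₗ[k] S}
    (hπ : EqOn ρ σ ⊤ π) (hnul : π ∉ nul (ρ.linHom σ) D) :
    ∃ (e : Module.End (MonoidAlgebra k N) U) (f : Module.End (MonoidAlgebra k N) S),
      e * e = e ∧ IndecMod (MonoidAlgebra k N) (LinearMap.range e) ∧
      f * f = f ∧ IndecMod (MonoidAlgebra k N) (LinearMap.range f) ∧
      e.restrictScalars k ∉ nul (ρ.linHom ρ) D ∧ f.restrictScalars k ∉ nul (σ.linHom σ) D ∧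
      f.restrictScalars k ∘ₗ π ∘ₗ e.restrictScalars k ≠ 0 := by
  obtain ⟨e, he, heI, heT⟩ := exists_indec_idempotent (k := k) (A := MonoidAlgebra k N) (M := U)
    { carrier := {e | π ∘ₗ e.restrictScalars k ∈ nul (ρ.linHom σ) D}
      add_mem' := fun {a b} ha hb => by
        have : π ∘ₗ (a + b).restrictScalars k =
          π ∘ₗ a.restrictScalars k + π ∘ₗ b.restrictScalars k :=
          LinearMap.ext fun u => map_add π (a u) (b u)
        simpa only [Set.mem_ofPred_eq, this] using add_mem ha hb
      zero_mem' := by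
        have : π ∘ₗ (0 : Module.End (MonoidAlgebra k N) U).restrictScalars k = 0 :=
          LinearMap.comp_zero _
        simp only [Set.mem_ofPred_eq, this, zero_mem] } hnul
  have heT : π ∘ₗ e.restrictScalars k ∉ nul (ρ.linHom σ) D := heT
  obtain ⟨f, hf, hfI, hfT⟩ := exists_indec_idempotent (k := k) (A := MonoidAlgebra k N) (M := S)
    { carrier := {f | f.restrictScalars k ∘ₗ π ∘ₗ e.restrictScalars k ∈ nul (ρ.linHom σ) D}
      add_mem' := fun {a b} ha hb => by
        have : (a + b).restrictScalars k ∘ₗ π ∘ₗ e.restrictScalars k =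
          a.restrictScalars k ∘ₗ π ∘ₗ e.restrictScalars k +
            b.restrictScalars k ∘ₗ π ∘ₗ e.restrictScalars k :=
          LinearMap.ext fun u => rfl
        simpa only [Set.mem_ofPred_eq, this] using add_mem ha hb
      zero_mem' := by
        have : (0 : Module.End (MonoidAlgebra k N) S).restrictScalars k ∘ₗ π ∘ₗ
          e.restrictScalars k = 0 := LinearMap.zero_comp _
        simp only [Set.mem_ofPred_eq, this, zero_mem] } heT
  have hfT : f.restrictScalars k ∘ₗ π ∘ₗ e.restrictScalars k ∉ nul (ρ.linHom σ) D := hfT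
  have heD := (eqOn_of_local hρ hρ e).anti hDN
  have hfD := (eqOn_of_local hσ hσ f).anti hDN
  have hπD := hπ.anti (le_top (a := D))
  exact ⟨e, f, he, heI, hf, hfI,
    fun h => hfT (hfD.comp_mem_nul (hπD.comp_mem_nul h)),
    fun h => hfT ((hπD.comp heD).mem_nul_comp h),
    fun h => hfT (h ▸ zero_mem _)⟩

omit [Module.Finite k S] in
lemma actsInj_of_indec {w : Γ → k} (hw : ∀ g h, w (g * h * g⁻¹) = w h) (hDN : D ≤ N)
    (hN : ∀ g, g ∉ N → ∀ d ∈ D, g⁻¹ * d * g ∈ D → d = 1)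
    (hρ : ∀ (n : N) u, rp k N U n u = ρ n u) (hb : wact w ρ = LinearMap.id)
    {e : Module.End (MonoidAlgebra k N) U}
    (heI : IndecMod (MonoidAlgebra k N) (LinearMap.range e))
    (hnul : e.restrictScalars k ∉ nul (ρ.linHom ρ) D) :
    ActsInj (locElt w N) (LinearMap.range e) := by
  have hlin : ∀ {Y : Type} [AddCommGroup Y] [Module (MonoidAlgebra k N) Y]
      (a : MonoidAlgebra k N) (y : Y), locElt w N • a • y = a • locElt w N • y := by
    intro Y _ _ a y
    rw [smul_smul, smul_smul, locElt_comm hw]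
  let C : Module.End (MonoidAlgebra k N) (LinearMap.range e) :=
    { toFun := fun y => locElt w N • y
      map_add' := fun y z => smul_add _ _ _
      map_smul' := fun a y => hlin a y }
  let C' : Module.End (MonoidAlgebra k N) U :=
    { toFun := fun y => locElt w N • y
      map_add' := fun y z => smul_add _ _ _
      map_smul' := fun a y => hlin a y }
  have := finite_sub k (LinearMap.range e)
  by_cases hC : IsNilpotent C
  · exfalso
    obtain ⟨m, hm⟩ := hC
    have hsum : C'.restrictScalars k = ∑ n : N, w n • ρ n := by
      refine LinearMap.ext fun u => ?_
      show locElt w N • u = _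
      rw [locElt_smul, LinearMap.sum_apply]
      exact Finset.sum_congr rfl fun n _ => by rw [hρ, LinearMap.smul_apply]
    have h1 : (LinearMap.id : Module.End k U) - C'.restrictScalars k ∈ nul (ρ.linHom ρ) D := by
      rw [hsum, ← hb]
      exact id_sub_mem_nul hw hDN hN
    have hid : EqOn ρ ρ D (LinearMap.id : Module.End k U) := fun _ _ _ => rfl
    have heD := (eqOn_of_local hρ hρ e).anti hDN
    have h2 := heD.mem_nul_comp (pow_sub_pow_mem_nul hid
      ((eqOn_of_local hρ hρ C').anti hDN) h1 m)
    have h3 : ∀ m (v : LinearMap.range e), (((C ^ m) v : LinearMap.range e) : U) =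
        ((C'.restrictScalars k : Module.End k U) ^ m) v := by
      intro m
      induction m with
      | zero => intro v; rfl
      | succ m ih => intro v; rw [pow_succ, pow_succ, Module.End.mul_apply, ih]; rfl
    refine hnul ?_
    convert h2 using 1
    refine LinearMap.ext fun u => ?_
    have h4 := h3 m ⟨e u, u, rfl⟩
    rw [hm] at h4
    have h5 : ((C'.restrictScalars k : Module.End k U) ^ m) (e u) = 0 := h4.symm
    have h6 : (LinearMap.id : Module.End k U) ^ m = 1 := one_pow m
    show e u = ((LinearMap.id : Module.End k U) ^ m -
      (C'.restrictScalars k : Module.End k U) ^ m) (e u)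
    rw [h6, LinearMap.sub_apply, h5, sub_zero, Module.End.one_apply]
  · have hbij := bijective_of_not_isNilpotent k heI hC
    intro y hy
    exact hbij.1 (hy.trans (smul_zero (locElt w N)).symm)

end LocalSummands

/-! ### Stability of local summands of a stable simple module -/

section LocalStable

open scoped Classical

variable {k : Type} [Field k] {Γ : Type} [Group Γ] [Fintype Γ]

lemma nul_of_twist {S : Type} [AddCommGroup S] [Module k S] {σ : Representation k Γ S}
    {α : Γ ≃* Γ} {z : Γ} (hα : α z ∈ Subgroup.zpowers z) {ψ : S ≃ₗ[k] S}
    (hψ : EqOn (tw σ (α : Γ →* Γ)) σ ⊤ (ψ : S →ₗ[k] S)) {f : Module.End k S}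
    (hf : (ψ : S →ₗ[k] S) ∘ₗ f ∘ₗ (ψ.symm : S →ₗ[k] S) ∈
      nul (σ.linHom σ) (Subgroup.zpowers z)) :
    f ∈ nul (σ.linHom σ) (Subgroup.zpowers z) := by
  have h1 : f = (ψ.symm : S →ₗ[k] S) ∘ₗ ((ψ : S →ₗ[k] S) ∘ₗ f ∘ₗ (ψ.symm : S →ₗ[k] S)) ∘ₗ
      (ψ : S →ₗ[k] S) := LinearMap.ext fun u => by simp
  have hψ' := hψ.anti (le_top (a := Subgroup.zpowers z))
  have h2 : f ∈ nul ((tw σ (α : Γ →* Γ)).linHom (tw σ (α : Γ →* Γ))) (Subgroup.zpowers z) := by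
    rw [h1]
    exact hψ'.symm.comp_mem_nul (hψ'.mem_nul_comp hf)
  obtain ⟨a, ha⟩ := mem_nul.1 h2
  refine mem_nul.2 ⟨a, ?_⟩
  have hmap : ∀ d : Subgroup.zpowers z, α d ∈ Subgroup.zpowers z := by
    rintro ⟨d, i, rfl⟩
    have : α (z ^ i) = α z ^ i := map_zpow α z i
    exact this ▸ Subgroup.zpow_mem _ hα i
  let φ : Subgroup.zpowers z → Subgroup.zpowers z := fun d => ⟨α d, hmap d⟩
  have hφ : Function.Bijective φ := Finite.injective_iff_bijective.1 fun a b hab =>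
    Subtype.ext (α.injective (congrArg Subtype.val hab))
  rw [← ha]
  exact (Fintype.sum_equiv (Equiv.ofBijective φ hφ) _ _ fun d =>
    linHom_tw (α : Γ →* Γ) (d : Γ) a).symm

variable [IsAlgClosed k] {p n : ℕ} [Fact p.Prime] [CharP k p] {t : Γ} {N : Subgroup Γ}
  {S : Type} [AddCommGroup S] [Module k S] [Module.Finite k S]
  [Module (MonoidAlgebra k Γ) S] [IsScalarTower k (MonoidAlgebra k Γ) S]
  [IsSimpleModule (MonoidAlgebra k Γ) S]

omit [CharP k p] in
lemma exists_scalar (ht : orderOf t = p ^ (n + 1)) (hN : N = locNorm (t ^ p ^ n))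
    {θ : S →ₗ[k] S}
    (hθ : ∀ d ∈ Subgroup.zpowers t, (rp k Γ S).linHom (rp k Γ S) d θ = θ)
    (hθ1 : qtr ((rp k Γ S).linHom (rp k Γ S)) (Subgroup.zpowers t) θ = LinearMap.id)
    {f : Module.End k S} (hf : EqOn (rp k Γ S) (rp k Γ S) N f) :
    ∃ s : k, f - s • 1 ∈ nul ((rp k Γ S).linHom (rp k Γ S)) (Subgroup.zpowers t) := by
  obtain ⟨F, hF, hFf⟩ := exists_green (hN ▸ zpowers_le_locNorm t _)
    (hN ▸ eq_one_of_not_mem_locNorm ht) hθ hθ1 hf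
  obtain ⟨s, hs⟩ := exists_smul_of_comm F fun g y => hF g trivial y
  refine ⟨s, ?_⟩
  have : F = s • (1 : Module.End k S) := LinearMap.ext hs
  rw [← this, ← neg_sub]
  exact neg_mem hFf

variable [Module (MonoidAlgebra k N) S] [IsScalarTower k (MonoidAlgebra k N) S]

lemma exists_local_twist (ht : orderOf t = p ^ (n + 1)) (hN : N = locNorm (t ^ p ^ n))
    {θ : S →ₗ[k] S}
    (hθ : ∀ d ∈ Subgroup.zpowers t, (rp k Γ S).linHom (rp k Γ S) d θ = θ)
    (hθ1 : qtr ((rp k Γ S).linHom (rp k Γ S)) (Subgroup.zpowers t) θ = LinearMap.id)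
    {α : Γ ≃* Γ} (hα : α (t ^ p ^ n) ∈ Subgroup.zpowers (t ^ p ^ n)) {β : N ≃* N}
    (hβ : ∀ g, (β g : Γ) = α g) (hS : TwStable k (α : Γ →* Γ) S)
    (hσ : ∀ (g : N) u, rp k N S g u = rp k Γ S g u)
    {f : Module.End (MonoidAlgebra k N) S}
    (hfI : IndecMod (MonoidAlgebra k N) (LinearMap.range f))
    (hnul : f.restrictScalars k ∉ nul ((rp k Γ S).linHom (rp k Γ S)) (Subgroup.zpowers t)) :
    ∃ b : LinearMap.range f ≃ₗ[k] LinearMap.range f, ∀ g v,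
      b (rp k N (LinearMap.range f) g v) = rp k N (LinearMap.range f) (β g) (b v) := by
  obtain ⟨ψ, hψ⟩ := exists_eqOn_of_twStable hS
  have hDN : Subgroup.zpowers t ≤ N := hN ▸ zpowers_le_locNorm t _
  let f0 : Module.End k S := f.restrictScalars k
  let f1 : Module.End k S := (ψ : S →ₗ[k] S) ∘ₗ f0 ∘ₗ (ψ.symm : S →ₗ[k] S)
  have hf0 : EqOn (rp k Γ S) (rp k Γ S) N f0 := eqOn_of_local hσ hσ f
  have hψs : ∀ (g : N) u, ψ.symm (rp k Γ S g u) = rp k Γ S (β g) (ψ.symm u) := fun g u => by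
    rw [hβ]
    exact hψ.symm g trivial u
  have hf1 : EqOn (rp k Γ S) (rp k Γ S) N f1 := fun g hg u => by
    show ψ (f0 (ψ.symm (rp k Γ S g u))) = rp k Γ S g (ψ (f0 (ψ.symm u)))
    rw [hψs ⟨g, hg⟩, hf0 _ (β ⟨g, hg⟩).2, hβ]
    exact hψ g trivial _
  obtain ⟨r, hr⟩ := exists_scalar ht hN hθ hθ1 hf0
  obtain ⟨s, hs⟩ := exists_scalar ht hN hθ hθ1 hf1
  have hr0 : r ≠ 0 := by
    rintro rfl
    rw [zero_smul, sub_zero] at hr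
    exact hnul hr
  have hs0 : s ≠ 0 := by
    rintro rfl
    rw [zero_smul, sub_zero] at hs
    have hle : Subgroup.zpowers (t ^ p ^ n) ≤ Subgroup.zpowers t := by
      rw [Subgroup.zpowers_le]
      exact Subgroup.npow_mem_zpowers t _
    have h1 := nul_of_twist hα hψ (nul_anti hle hs)
    have h2 := sub_mem h1 (nul_anti hle hr)
    rw [sub_sub_cancel] at h2
    have h3 : (LinearMap.id : Module.End k S) ∈
        nul ((rp k Γ S).linHom (rp k Γ S)) (Subgroup.zpowers (t ^ p ^ n)) := by
      have := (nul _ _).smul_mem r⁻¹ h2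
      rwa [smul_smul, inv_mul_cancel₀ hr0, one_smul] at this
    have h4 := (hf0.anti hDN).comp_mem_nul (id_mem_nul_zpowers ht h3)
    rw [LinearMap.comp_id] at h4
    exact hnul h4
  have hid : ∀ H, EqOn (rp k Γ S) (rp k Γ S) H (1 : Module.End k S) := fun _ _ _ _ => rfl
  have hrs : f0 * f1 - (r * s) • (1 : Module.End k S) ∈
      nul ((rp k Γ S).linHom (rp k Γ S)) (Subgroup.zpowers t) := by
    have h1 := (hf0.anti hDN).comp_mem_nul hs
    have h2 := (nul ((rp k Γ S).linHom (rp k Γ S)) (Subgroup.zpowers t)).smul_mem s hr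
    convert add_mem h1 h2 using 1
    rw [LinearMap.comp_sub, LinearMap.comp_smul, smul_sub, smul_smul, mul_comm s r]
    show _ = f0 * f1 - s • (f0 * 1) + _
    rw [mul_one, sub_add_sub_cancel]
  have hmem : ∀ v, f v ∈ LinearMap.range f := fun v => ⟨v, rfl⟩
  let B : LinearMap.range f →ₗ[k] LinearMap.range f :=
    { toFun := fun v => ⟨f (ψ.symm v), hmem _⟩
      map_add' := fun v w => Subtype.ext (by simp)
      map_smul' := fun c v => Subtype.ext (by
        have := f0.map_smul c (ψ.symm v)
        show f (ψ.symm (c • (v : S))) = c • f (ψ.symm v)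
        rw [map_smul]
        exact this) }
  let C : LinearMap.range f →ₗ[k] LinearMap.range f :=
    { toFun := fun v => ⟨f (ψ v), hmem _⟩
      map_add' := fun v w => Subtype.ext (by simp)
      map_smul' := fun c v => Subtype.ext (by
        have := f0.map_smul c (ψ v)
        show f (ψ (c • (v : S))) = c • f (ψ v)
        rw [map_smul]
        exact this) }
  have hCB : ∀ v : LinearMap.range f, (((C ∘ₗ B) v : LinearMap.range f) : S) = (f0 * f1) v :=
    fun v => rfl
  let E : Module.End (MonoidAlgebra k N) (LinearMap.range f) := linOf (C ∘ₗ B) fun g y => by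
    refine Subtype.ext ?_
    rw [hCB, coe_rp, coe_rp, hCB, hσ, hσ]
    exact (hf0.comp hf1) g g.2 _
  have hE : ∀ m (v : LinearMap.range f), (((E ^ m) v : LinearMap.range f) : S) =
      ((f0 * f1) ^ m) v := by
    intro m
    induction m with
    | zero => intro v; rfl
    | succ m ih => intro v; rw [pow_succ, pow_succ, Module.End.mul_apply, ih]; rfl
  have hEn : ¬ IsNilpotent E := by
    rintro ⟨m, hm⟩
    have h1 := pow_sub_pow_mem_nul ((hf0.comp hf1).anti hDN)
      (g := (r * s) • (1 : Module.End k S))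
      (fun g _ u => ((rp k Γ S g).map_smul (r * s) u).symm) hrs m
    have h2 := (hf0.anti hDN).mem_nul_comp h1
    have h3 : ((f0 * f1) ^ m - ((r * s) • (1 : Module.End k S)) ^ m) ∘ₗ f0 =
        -((r * s) ^ m • f0) := by
      refine LinearMap.ext fun u => ?_
      have h4 := hE m ⟨f u, hmem u⟩
      rw [hm] at h4
      have h5 : ((f0 * f1) ^ m) (f0 u) = 0 := h4.symm
      rw [LinearMap.comp_apply, LinearMap.sub_apply, h5, smul_pow, one_pow, zero_sub]
      rfl
    have h2 : ((f0 * f1) ^ m - ((r * s) • (1 : Module.End k S)) ^ m) ∘ₗ f0 ∈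
      nul ((rp k Γ S).linHom (rp k Γ S)) (Subgroup.zpowers t) := h2
    rw [h3, neg_mem_iff] at h2
    have h6 := (nul ((rp k Γ S).linHom (rp k Γ S)) (Subgroup.zpowers t)).smul_mem
      ((r * s) ^ m)⁻¹ h2
    rw [smul_smul, inv_mul_cancel₀ (pow_ne_zero _ (mul_ne_zero hr0 hs0)), one_smul] at h6
    exact hnul h6
  have := finite_sub k (LinearMap.range f)
  have hEb := bijective_of_not_isNilpotent k hfI hEn
  have hBi : Function.Injective B := by
    have h1 : Function.Injective (C ∘ B) := hEb.1
    exact h1.of_comp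
  refine ⟨LinearEquiv.ofInjectiveEndo B hBi, fun g v => Subtype.ext ?_⟩
  show f (ψ.symm ((rp k N (LinearMap.range f) g v : LinearMap.range f) : S)) =
    ((rp k N (LinearMap.range f) (β g) (B v) : LinearMap.range f) : S)
  rw [coe_rp, coe_rp, hσ, hψs, hσ]
  exact hf0 _ (β g).2 _

end LocalStable

/-! ### Stability of modules with a non-projective map to a stable simple module -/

section LocalToGlobal

open scoped Classical

variable {k : Type} [Field k] {Γ : Type} [Group Γ] [Fintype Γ]

lemma wact_tw {U : Type} [AddCommGroup U] [Module k U] (ρ : Representation k Γ U) {w : Γ → k}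
    {α : Γ ≃* Γ} (hwα : ∀ g, w (α g) = w g) : wact w (tw ρ (α : Γ →* Γ)) = wact w ρ :=
  Fintype.sum_equiv α.toEquiv _ _ fun g => by
    rw [← hwα g]
    rfl

lemma map_locElt {w : Γ → k} {N : Subgroup Γ} {α : Γ ≃* Γ} (hwα : ∀ g, w (α g) = w g)
    {β : N ≃* N} (hβ : ∀ g, (β g : Γ) = α g) :
    MonoidAlgebra.mapDomainRingHom k (β : N →* N) (locElt w N) = locElt w N := by
  rw [locElt, map_sum]
  refine Fintype.sum_equiv β.toEquiv _ _ fun n => ?_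
  rw [MonoidAlgebra.mapDomainRingHom_apply, MonoidAlgebra.mapDomain_single]
  show MonoidAlgebra.single (β n) _ = MonoidAlgebra.single (β n) (w (β n : Γ))
  rw [hβ, hwα]

variable [IsAlgClosed k] {p n : ℕ} [Fact p.Prime] [CharP k p] {t : Γ} {N : Subgroup Γ}
  {U : Type} [AddCommGroup U] [Module k U] [Module.Finite k U]
  [Module (MonoidAlgebra k Γ) U] [IsScalarTower k (MonoidAlgebra k Γ) U]
  {S : Type} [AddCommGroup S] [Module k S] [Module.Finite k S]
  [Module (MonoidAlgebra k Γ) S] [IsScalarTower k (MonoidAlgebra k Γ) S]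
  [IsSimpleModule (MonoidAlgebra k Γ) S]

section

variable [Module (MonoidAlgebra k N) U] [IsScalarTower k (MonoidAlgebra k N) U]
  [Module (MonoidAlgebra k N) S] [IsScalarTower k (MonoidAlgebra k N) S]

lemma exists_summand_twist (ht : orderOf t = p ^ (n + 1)) (hN : N = locNorm (t ^ p ^ n))
    {w : Γ → k} (hw : ∀ g h, w (g * h * g⁻¹) = w h) (hT : HasTraces k t w)
    {α : Γ ≃* Γ} (hwα : ∀ g, w (α g) = w g)
    {β : N ≃* N} (hβ : ∀ g, (β g : Γ) = α g)
    (hα : α (t ^ p ^ n) ∈ Subgroup.zpowers (t ^ p ^ n))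
    (hwU : wact w (rp k Γ U) = LinearMap.id) (hwS : wact w (rp k Γ S) = LinearMap.id)
    (hρ : ∀ (g : N) u, rp k N U g u = rp k Γ U g u)
    (hσ : ∀ (g : N) u, rp k N S g u = rp k Γ S g u)
    (hS : TwStable k (α : Γ →* Γ) S) {π : U →ₗ[k] S} (hπ : EqOn (rp k Γ U) (rp k Γ S) ⊤ π)
    (hnul : π ∉ nul ((rp k Γ U).linHom (rp k Γ S)) (Subgroup.zpowers t)) :
    ∃ e : Module.End (MonoidAlgebra k N) U, e * e = e ∧
      e.restrictScalars k ∉ nul ((rp k Γ U).linHom (rp k Γ U)) (Subgroup.zpowers t) ∧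
      ∃ μ : LinearMap.range e ≃ₗ[k] LinearMap.range e, ∀ g v,
        μ (rp k N (LinearMap.range e) g v) = rp k N (LinearMap.range e) (β g) (μ v) := by
  have hDN : Subgroup.zpowers t ≤ N := hN ▸ zpowers_le_locNorm t _
  have hloc : ∀ g, g ∉ N → ∀ d ∈ Subgroup.zpowers t, g⁻¹ * d * g ∈ Subgroup.zpowers t → d = 1 :=
    hN ▸ eq_one_of_not_mem_locNorm ht
  have htN : t ∈ N := hDN (Subgroup.mem_zpowers t)
  obtain ⟨e, f, he, heI, hf, hfI, hen, hfn, hne⟩ := exists_summands hDN hρ hσ hπ hnul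
  obtain ⟨θ, hθ, hθ1⟩ := hT S (rp k Γ S)
  rw [hwS] at hθ1
  obtain ⟨b, hb⟩ := exists_local_twist ht hN hθ hθ1 hα hβ hS hσ hfI hfn
  have hce := actsInj_of_indec hw hDN hloc hρ hwU heI hen
  have hcf := actsInj_of_indec hw hDN hloc hσ hwS hfI hfn
  have htN' : orderOf (⟨t, htN⟩ : N) = p ^ (n + 1) := by
    rw [← ht, Subgroup.orderOf_mk]
  obtain ⟨χ, hχ⟩ : ∃ χ : N →* k, IsModChar (⟨t, htN⟩ : N) p n χ := by
    subst hN
    exact exists_isModChar k ht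
  have hst := simpleTrace ht hw hT hN htN
  have hL := uniqueCoatoms htN' hχ (locElt_comm hw N) hst
  have hR := uniqueAtoms htN' hχ (locElt_comm hw N) hst
  have := finite_sub k (LinearMap.range e)
  have := finite_sub k (LinearMap.range f)
  have hV := isChainMod_of_indec (locElt_comm hw N) hL hR heI hce
  have hV' := isChainMod_of_indec (locElt_comm hw N) hL hR hfI hcf
  have hmem : ∀ v, f v ∈ LinearMap.range f := fun v => ⟨v, rfl⟩
  let h0 : LinearMap.range e →ₗ[k] LinearMap.range f :=
    { toFun := fun v => ⟨f (π v), hmem _⟩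
      map_add' := fun v w => Subtype.ext (by simp)
      map_smul' := fun c v => Subtype.ext (by
        show f (π (c • (v : U))) = c • f (π v)
        rw [map_smul]
        exact (f.restrictScalars k).map_smul c _) }
  have hlin : ∀ g y, h0 (rp k N (LinearMap.range e) g y) = rp k N (LinearMap.range f) g (h0 y) := by
    intro g y
    refine Subtype.ext ?_
    show f (π ((rp k N (LinearMap.range e) g y : LinearMap.range e) : U)) = _
    rw [coe_rp, coe_rp, hρ, hπ g trivial, ← hσ, map_rp]
    rfl
  obtain ⟨μ, hμ⟩ := exists_semi_of_chain hL hV hV' hce (map_locElt hwα hβ) b hb (linOf h0 hlin)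
    (fun h => hne (LinearMap.ext fun u => by
      have h1 := congrArg Subtype.val (LinearMap.congr_fun h ⟨e u, u, rfl⟩)
      exact h1))
  exact ⟨e, he, hen, μ, hμ⟩

omit [IsAlgClosed k] [CharP k p] in
lemma twStable_of_summand_twist (ht : orderOf t = p ^ (n + 1)) (hN : N = locNorm (t ^ p ^ n))
    {w : Γ → k} (hT : HasTraces k t w) {α : Γ ≃* Γ} (hwα : ∀ g, w (α g) = w g)
    {β : N ≃* N} (hβ : ∀ g, (β g : Γ) = α g)
    (hwU : wact w (rp k Γ U) = LinearMap.id)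
    (hρ : ∀ (g : N) u, rp k N U g u = rp k Γ U g u) (hU : IndecMod (MonoidAlgebra k Γ) U)
    {e : Module.End (MonoidAlgebra k N) U} (he : e * e = e)
    (hen : e.restrictScalars k ∉ nul ((rp k Γ U).linHom (rp k Γ U)) (Subgroup.zpowers t))
    (μ : LinearMap.range e ≃ₗ[k] LinearMap.range e)
    (hμ : ∀ g v, μ (rp k N (LinearMap.range e) g v) = rp k N (LinearMap.range e) (β g) (μ v)) :
    TwStable k (α : Γ →* Γ) U := by
  have hDN : Subgroup.zpowers t ≤ N := hN ▸ zpowers_le_locNorm t _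
  have hloc : ∀ g, g ∉ N → ∀ d ∈ Subgroup.zpowers t, g⁻¹ * d * g ∈ Subgroup.zpowers t → d = 1 :=
    hN ▸ eq_one_of_not_mem_locNorm ht
  let e0 : Module.End k U := e.restrictScalars k
  have he0 : EqOn (rp k Γ U) (rp k Γ U) N e0 := eqOn_of_local hρ hρ e
  have hmem : ∀ v, e v ∈ LinearMap.range e := fun v => ⟨v, rfl⟩
  let e' : U →ₗ[k] LinearMap.range e :=
    { toFun := fun v => ⟨e v, hmem v⟩
      map_add' := fun v w => Subtype.ext (by simp)
      map_smul' := fun c v => Subtype.ext (e0.map_smul c v) }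
  have he' : ∀ (g : N) u, e' (rp k Γ U g u) = rp k N (LinearMap.range e) g (e' u) := fun g u => by
    refine Subtype.ext ?_
    rw [coe_rp, hρ]
    exact he0 g g.2 u
  let i : LinearMap.range e →ₗ[k] U := (LinearMap.range e).subtype.restrictScalars k
  have hi : ∀ (g : N) v, i (rp k N (LinearMap.range e) g v) = rp k Γ U g (i v) := fun g v => by
    rw [← hρ]
    exact coe_rp k N _ g v
  have hei : ∀ v, e' (i v) = v := by
    rintro ⟨v, u, rfl⟩
    exact Subtype.ext (LinearMap.congr_fun he u)
  have hμs : ∀ (g : N) v, μ.symm (rp k N (LinearMap.range e) (β g) v) =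
      rp k N (LinearMap.range e) g (μ.symm v) := fun g v => by
    rw [μ.symm_apply_eq, hμ, μ.apply_symm_apply]
  let m1 : Module.End k U := i ∘ₗ (μ : LinearMap.range e →ₗ[k] LinearMap.range e) ∘ₗ e'
  let m2 : Module.End k U := i ∘ₗ (μ.symm : LinearMap.range e →ₗ[k] LinearMap.range e) ∘ₗ e'
  have h1 : EqOn (rp k Γ U) (tw (rp k Γ U) (α : Γ →* Γ)) N m1 := fun g hg u => by
    show i (μ (e' (rp k Γ U g u))) = rp k Γ U (α g) (i (μ (e' u)))
    rw [he' ⟨g, hg⟩, hμ, hi, hβ]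
  have h2 : EqOn (tw (rp k Γ U) (α : Γ →* Γ)) (rp k Γ U) N m2 := fun g hg u => by
    show i (μ.symm (e' (rp k Γ U (α g) u))) = rp k Γ U g (i (μ.symm (e' u)))
    rw [← hβ ⟨g, hg⟩, he', hμs, hi]
  have h21 : m2 ∘ₗ m1 = e0 := LinearMap.ext fun u => by
    show i (μ.symm (e' (i (μ (e' u))))) = e u
    rw [hei, μ.symm_apply_apply]
    rfl
  obtain ⟨θ, hθ, hθ1⟩ := hT U (rp k Γ U)
  rw [hwU] at hθ1
  obtain ⟨θ', hθ', hθ1'⟩ := hT U (tw (rp k Γ U) (α : Γ →* Γ))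
  rw [wact_tw _ hwα, hwU] at hθ1'
  obtain ⟨F, hF, hFm⟩ := exists_green hDN hloc hθ hθ1 h1
  obtain ⟨F', hF', hFm'⟩ := exists_green hDN hloc hθ' hθ1' h2
  have hFF := comp_sub_comp_mem_nul (hF'.anti (le_top (a := Subgroup.zpowers t)))
    (h1.anti hDN) hFm' hFm
  rw [h21] at hFF
  refine twStable_of_comp hU hF hF' ?_
  rintro ⟨m, hm⟩
  have h3 := pow_sub_pow_mem_nul (he0.anti hDN)
    ((hF'.comp hF).anti (le_top (a := Subgroup.zpowers t))) (by rw [← neg_sub]; exact neg_mem hFF)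
    (m + 1)
  have h4 : (F' ∘ₗ F) ^ (m + 1) = 0 := by
    rw [pow_succ]
    show (F' * F) ^ m * (F' * F) = 0
    rw [hm, zero_mul]
  have h5 : e0 ^ (m + 1) = e0 := IsIdempotentElem.pow_succ_eq m
    (show e0 * e0 = e0 from LinearMap.ext fun u => LinearMap.congr_fun he u)
  rw [h4, h5, sub_zero] at h3
  exact hen h3

end

lemma twStable_of_notMem_nul (ht : orderOf t = p ^ (n + 1))
    {w : Γ → k} (hw : ∀ g h, w (g * h * g⁻¹) = w h) (hT : HasTraces k t w)
    {α : Γ ≃* Γ} (hwα : ∀ g, w (α g) = w g)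
    (hα : α (t ^ p ^ n) ∈ Subgroup.zpowers (t ^ p ^ n))
    (hwU : wact w (rp k Γ U) = LinearMap.id) (hwS : wact w (rp k Γ S) = LinearMap.id)
    (hU : IndecMod (MonoidAlgebra k Γ) U)
    (hS : TwStable k (α : Γ →* Γ) S) {π : U →ₗ[k] S} (hπ : EqOn (rp k Γ U) (rp k Γ S) ⊤ π)
    (hnul : π ∉ nul ((rp k Γ U).linHom (rp k Γ S)) (Subgroup.zpowers t)) :
    TwStable k (α : Γ →* Γ) U := by
  obtain ⟨β, hβ⟩ := exists_restrict α hα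
  let f := MonoidAlgebra.mapDomainRingHom k (locNorm (t ^ p ^ n)).subtype
  have hf : ∀ (c : k) a, f (c • a) = c • f a := fun c a =>
    map_smul (MonoidAlgebra.mapDomainAlgHom k k (locNorm (t ^ p ^ n)).subtype) c a
  let _ : Module (MonoidAlgebra k (locNorm (t ^ p ^ n))) U := Module.compHom U f
  let _ : Module (MonoidAlgebra k (locNorm (t ^ p ^ n))) S := Module.compHom S f
  have : IsScalarTower k (MonoidAlgebra k (locNorm (t ^ p ^ n))) U := ⟨fun c a u => by
    show f (c • a) • u = c • f a • u
    rw [hf, smul_assoc]⟩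
  have : IsScalarTower k (MonoidAlgebra k (locNorm (t ^ p ^ n))) S := ⟨fun c a u => by
    show f (c • a) • u = c • f a • u
    rw [hf, smul_assoc]⟩
  have hfg : ∀ g : locNorm (t ^ p ^ n), f (MonoidAlgebra.of k _ g) = MonoidAlgebra.of k Γ g :=
    fun g => by simp [f]
  have hρ : ∀ (g : locNorm (t ^ p ^ n)) u, rp k _ U g u = rp k Γ U g u := fun g u => by
    rw [rp_apply, rp_apply, ← hfg]
    rfl
  have hσ : ∀ (g : locNorm (t ^ p ^ n)) u, rp k _ S g u = rp k Γ S g u := fun g u => by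
    rw [rp_apply, rp_apply, ← hfg]
    rfl
  obtain ⟨e, he, hen, μ, hμ⟩ := exists_summand_twist ht rfl hw hT hwα hβ hα hwU hwS hρ hσ hS hπ hnul
  exact twStable_of_summand_twist ht rfl hT hwα hβ hwU hρ hU he hen μ hμ

end LocalToGlobal

section Stable

open scoped Classical

variable {k : Type} [Field k] {Γ : Type} [Group Γ] [Fintype Γ]

lemma mem_nul_bot {M : Type} [AddCommGroup M] [Module k M] (σ : Representation k Γ M) (m : M) :
    m ∈ nul σ ⊥ :=
  mem_nul.2 ⟨m, by
    rw [Finset.sum_eq_single 1 (fun x _ hx => absurd (Subsingleton.elim x 1) hx)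
      fun h => absurd (@Finset.mem_univ _ (_) _) h, Subgroup.coe_one, map_one, Module.End.one_apply]⟩

variable [IsAlgClosed k] {p j : ℕ} [Fact p.Prime] [CharP k p] {t : Γ}
  {U : Type} [AddCommGroup U] [Module k U] [Module.Finite k U]
  [Module (MonoidAlgebra k Γ) U] [IsScalarTower k (MonoidAlgebra k Γ) U]
  {S : Type} [AddCommGroup S] [Module k S] [Module.Finite k S]
  [Module (MonoidAlgebra k Γ) S] [IsScalarTower k (MonoidAlgebra k Γ) S]
  [IsSimpleModule (MonoidAlgebra k Γ) S]

/-- An indecomposable module is stable under an automorphism if one of its simple quotients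
is. -/
lemma twStable_of_simple_quotient (ht : orderOf t = p ^ j)
    {w : Γ → k} (hw : ∀ g h, w (g * h * g⁻¹) = w h) (hT : HasTraces k t w)
    {α : Γ ≃* Γ} (hwα : ∀ g, w (α g) = w g)
    (hwU : wact w (rp k Γ U) = LinearMap.id) (hwS : wact w (rp k Γ S) = LinearMap.id)
    (hU : IndecMod (MonoidAlgebra k Γ) U) {π : U →ₗ[MonoidAlgebra k Γ] S}
    (hπ : Function.Surjective π) (hS : TwStable k (α : Γ →* Γ) S) :
    TwStable k (α : Γ →* Γ) U := by
  have : Nontrivial S := IsSimpleModule.nontrivial (MonoidAlgebra k Γ) S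
  by_cases hid : ∃ a, ∑ g : Γ, (rp k Γ U).linHom (rp k Γ U) g a = LinearMap.id
  · exact twStable_of_sum_eq_id hU hid hπ hS
  obtain ⟨θ, hθ, hθ1⟩ := hT S (rp k Γ S)
  rw [hwS] at hθ1
  have hnul := not_mem_nul_of_surjective hU hθ hθ1 hid hπ
  have hπe := eqOn_of_linear (k := k) π
  obtain rfl | ⟨n, rfl⟩ : j = 0 ∨ ∃ n, j = n + 1 := by
    cases j with
    | zero => exact Or.inl rfl
    | succ n => exact Or.inr ⟨n, rfl⟩
  · rw [pow_zero, orderOf_eq_one_iff] at ht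
    rw [ht, Subgroup.zpowers_one_eq_bot] at hnul
    exact absurd (mem_nul_bot _ _) hnul
  obtain ⟨ψ, hψ⟩ := exists_eqOn_of_twStable hS
  obtain ⟨y, hy⟩ := exists_conj_mem ht hψ hθ hθ1 fun h =>
    hnul ((hπe.anti le_top).mem_nul_comp h)
  let α' : Γ ≃* Γ := α.trans (MulAut.conj y)
  have hα' : ∀ g, α' g = y * α g * y⁻¹ := fun g => rfl
  have hS' : TwStable k (α' : Γ →* Γ) S := hS.conj y hα'
  have hU' : TwStable k (α' : Γ →* Γ) U :=
    twStable_of_notMem_nul ht hw hT (fun g => by rw [hα', hw, hwα])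
      (by rw [hα']; exact hy) hwU hwS hU hS' hπe hnul
  refine hU'.conj y⁻¹ fun g => ?_
  show α g = y⁻¹ * (y * α g * y⁻¹) * y⁻¹⁻¹
  group

end Stable

/-! ### Relative projectivity and relative traces -/

section RelProjective

open scoped Classical

variable {k : Type} [Field k] {Γ : Type} [Group Γ]

lemma RelProj.zpowers_pow {W : Type} [AddCommGroup W] [Module (MonoidAlgebra k Γ) W] {d : Γ}
    {m : ℕ} (hm : (m : k) ≠ 0) (h : RelProj k Γ (Subgroup.zpowers d) W) :
    RelProj k Γ (Subgroup.zpowers (d ^ m)) W := by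
  intro M N f g hf ⟨h0, hc, hd, hfg⟩
  have hd' : ∀ v, h0 (MonoidAlgebra.of k Γ (d ^ m) • v) = MonoidAlgebra.of k Γ (d ^ m) • h0 v :=
    fun v => hd ⟨d ^ m, Subgroup.mem_zpowers _⟩ v
  let a : Γ → MonoidAlgebra k Γ := MonoidAlgebra.of k Γ
  have ha : ∀ x y, a (x * y) = a x * a y := fun x y => map_mul _ x y
  have ha1 : a 1 = 1 := map_one _
  let s : ℕ → W → ↥M := fun i u => a (d ^ i) • h0 (a (d ^ i)⁻¹ • u)
  have hcc : ∀ (c : k) (x : MonoidAlgebra k Γ),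
      x * algebraMap k (MonoidAlgebra k Γ) c = algebraMap k (MonoidAlgebra k Γ) c * x :=
    fun c x => (Algebra.commutes c x).symm
  let h1 : W →+ ↥M :=
    { toFun := fun u => algebraMap k (MonoidAlgebra k Γ) (m : k)⁻¹ • ∑ i ∈ Finset.range m, s i u
      map_zero' := by simp [s]
      map_add' := fun u v => by simp [s, smul_add, Finset.sum_add_distrib] }
  have hh1 : ∀ u, h1 u =
    algebraMap k (MonoidAlgebra k Γ) (m : k)⁻¹ • ∑ i ∈ Finset.range m, s i u := fun u => rfl
  have hstep : ∀ u, h1 (a d • u) = a d • h1 u := fun u => by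
    have hs : ∀ i, a d • s i u = s (i + 1) (a d • u) := fun i => by
      show a d • a (d ^ i) • h0 (a (d ^ i)⁻¹ • u) = a (d ^ (i + 1)) • h0 (a (d ^ (i + 1))⁻¹ • a d • u)
      rw [smul_smul, smul_smul, ← ha, ← ha]
      congr 3
      · rw [pow_succ']
      · rw [pow_succ']
        group
    have hend : s m (a d • u) = s 0 (a d • u) := by
      show a (d ^ m) • h0 (a (d ^ m)⁻¹ • a d • u) = a (d ^ 0) • h0 (a (d ^ 0)⁻¹ • a d • u)
      rw [← hd', smul_smul]
      show h0 ((a (d ^ m) * a (d ^ m)⁻¹) • _) = _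
      rw [← ha, mul_inv_cancel, pow_zero, inv_one, ha1, one_smul, one_smul]
    rw [hh1, hh1, smul_smul, hcc, mul_smul]
    congr 1
    rw [Finset.smul_sum, Finset.sum_congr rfl fun i _ => hs i]
    have := (Finset.sum_range_succ (fun i => s i (a d • u)) m).symm.trans
      (Finset.sum_range_succ' (fun i => s i (a d • u)) m)
    rw [hend] at this
    exact add_right_cancel this
  refine h M N f g hf ⟨h1, fun c u => ?_, ?_, fun u => ?_⟩
  · rw [hh1, hh1, smul_smul, hcc, mul_smul]
    congr 1
    rw [Finset.smul_sum]
    refine Finset.sum_congr rfl fun i _ => ?_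
    show a (d ^ i) • h0 (a (d ^ i)⁻¹ • _ • u) = _ • a (d ^ i) • h0 (a (d ^ i)⁻¹ • u)
    rw [smul_smul, hcc, mul_smul, hc, smul_smul, smul_smul, hcc]
  · have hle : Subgroup.zpowers d ≤
        { carrier := {x | ∀ u, h1 (a x • u) = a x • h1 u}
          mul_mem' := fun {x y} hx hy u => by rw [ha, mul_smul, mul_smul, hx, hy]
          one_mem' := fun u => by rw [ha1, one_smul, one_smul]
          inv_mem' := fun {x} hx u => by
            have h2 := hx (a x⁻¹ • u)
            rw [smul_smul, ← ha, mul_inv_cancel, ha1, one_smul] at h2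
            rw [h2, smul_smul, ← ha, inv_mul_cancel, ha1, one_smul] } :=
      (Subgroup.zpowers_le).2 hstep
    exact fun x => hle x.2
  · rw [hh1, map_smul, map_sum]
    have : ∀ i, f (s i u) = g u := fun i => by
      show f (a (d ^ i) • h0 (a (d ^ i)⁻¹ • u)) = g u
      rw [map_smul, hfg, map_smul, smul_smul, ← ha, mul_inv_cancel, ha1, one_smul]
    rw [Finset.sum_congr rfl fun i _ => this i, Finset.sum_const, Finset.card_range,
      ← Nat.cast_smul_eq_nsmul (MonoidAlgebra k Γ), smul_smul,
      ← map_natCast (algebraMap k (MonoidAlgebra k Γ)), ← map_mul, inv_mul_cancel₀ hm, map_one,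
      one_smul]

variable [Fintype Γ]

/-- The sum over cosets on the representation coinduced from a restriction. -/
lemma exists_coind_sum {W : Type} [AddCommGroup W] [Module k W] (ρ : Representation k Γ W)
    (D : Subgroup Γ) (τ : Representation k D W) (hτ : ∀ d : D, τ d = ρ d) :
    ∃ ε : Representation.coindV D.subtype τ →ₗ[k] W,
      (∀ g φ, ε (Representation.coind D.subtype τ g φ) = ρ g (ε φ)) ∧
      (∀ u, ε (coindUnit τ u) = u) ∧
      ∀ φ, ε φ = ∑ x : Γ ⧸ D, ρ x.out (φ.1 x.out⁻¹) := by
  let F : (Representation.coindV D.subtype τ) → Γ → W := fun φ g => ρ g (φ.1 g⁻¹)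
  have hF : ∀ φ g, ∀ d ∈ D, F φ (g * d) = F φ g := fun φ g d hd => by
    have h1 : φ.1 (d⁻¹ * g⁻¹) = ρ d⁻¹ (φ.1 g⁻¹) := by
      rw [← hτ ⟨d⁻¹, D.inv_mem hd⟩]
      exact φ.2 ⟨d⁻¹, D.inv_mem hd⟩ g⁻¹
    show ρ (g * d) (φ.1 (g * d)⁻¹) = ρ g (φ.1 g⁻¹)
    rw [mul_inv_rev, h1, map_mul, Module.End.mul_apply, Representation.self_inv_apply]
  refine ⟨{ toFun := fun φ => ∑ x : Γ ⧸ D, F φ x.out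
            map_add' := fun φ ψ => by
              rw [← Finset.sum_add_distrib]
              exact Finset.sum_congr rfl fun x _ => map_add (ρ x.out) _ _
            map_smul' := fun c φ => by
              rw [RingHom.id_apply, Finset.smul_sum]
              exact Finset.sum_congr rfl fun x _ => map_smul (ρ x.out) _ _ },
    fun g φ => ?_, fun u => ?_, fun φ => rfl⟩
  · show ∑ x : Γ ⧸ D, F (Representation.coind D.subtype τ g φ) x.out =
      ρ g (∑ x : Γ ⧸ D, F φ x.out)
    rw [map_sum, ← sum_coset_smul (hF (Representation.coind D.subtype τ g φ)) g]
    refine Finset.sum_congr rfl fun x _ => ?_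
    show ρ (g * x.out) (φ.1 ((g * x.out)⁻¹ * g)) = ρ g (ρ x.out (φ.1 (x.out)⁻¹))
    rw [map_mul, Module.End.mul_apply, mul_inv_rev, inv_mul_cancel_right]
  · show ∑ x : Γ ⧸ D, F (coindUnit τ u) x.out = u
    rw [Finset.sum_eq_single ((1 : Γ) : Γ ⧸ D), apply_out_eq (hF _)]
    · show ρ 1 ((coindUnit τ u : Γ → W) 1⁻¹) = u
      rw [coindUnit_apply, dif_pos (D.inv_mem D.one_mem), map_one, Module.End.one_apply, hτ]
      show ρ (1⁻¹) u = u
      rw [inv_one, map_one, Module.End.one_apply]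
    · intro x _ hx
      show ρ x.out ((coindUnit τ u : Γ → W) x.out⁻¹) = 0
      rw [coindUnit_apply, dif_neg, map_zero]
      intro hmem
      refine hx ?_
      rw [← x.out_eq']
      exact QuotientGroup.eq.2 (by rwa [mul_one])
    · exact fun h => absurd (@Finset.mem_univ _ (_) _) h

lemma exists_trace_of_coind_section {W : Type} [AddCommGroup W] [Module k W]
    (ρ : Representation k Γ W) (D : Subgroup Γ) (τ : Representation k D W)
    (hτ : ∀ d : D, τ d = ρ d) (H : W →ₗ[k] Representation.coindV D.subtype τ)
    (hH : ∀ g u, H (ρ g u) = Representation.coind D.subtype τ g (H u))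
    (hs : ∀ u, ∑ x : Γ ⧸ D, ρ x.out ((H u).1 x.out⁻¹) = u) :
    ∃ θ : W →ₗ[k] W, (∀ d ∈ D, ρ.linHom ρ d θ = θ) ∧ qtr (ρ.linHom ρ) D θ = LinearMap.id := by
  let θ : W →ₗ[k] W :=
    (LinearMap.proj (1 : Γ)) ∘ₗ (Representation.coindV D.subtype τ).subtype ∘ₗ H
  have hθ : ∀ g u, θ (ρ g u) = (H u).1 g := fun g u => by
    show (H (ρ g u)).1 1 = _
    rw [hH]
    show (H u).1 (1 * g) = _
    rw [one_mul]
  refine ⟨θ, fun d hd => LinearMap.ext fun u => ?_, LinearMap.ext fun u => ?_⟩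
  · rw [Representation.linHom_apply]
    show ρ d (θ (ρ d⁻¹ u)) = (H u).1 1
    rw [hθ, ← mul_one d⁻¹]
    have h1 : (H u).1 (d⁻¹ * 1) = ρ d⁻¹ ((H u).1 1) := by
      rw [← hτ ⟨d⁻¹, D.inv_mem hd⟩]
      exact (H u).2 ⟨d⁻¹, D.inv_mem hd⟩ 1
    rw [h1, Representation.self_inv_apply]
  · refine Eq.trans ?_ (hs u)
    rw [qtr, LinearMap.sum_apply]
    refine Finset.sum_congr rfl fun x _ => ?_
    rw [Representation.linHom_apply]
    show ρ x.out (θ (ρ x.out⁻¹ u)) = ρ x.out ((H u).1 x.out⁻¹)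
    rw [hθ]

omit [Fintype Γ] in
lemma asModuleEquiv_rp {V : Type} [AddCommGroup V] [Module k V] (ρ : Representation k Γ V) (g : Γ)
    (y : ρ.asModule) : ρ.asModuleEquiv (rp k Γ ρ.asModule g y) = ρ g (ρ.asModuleEquiv y) := by
  obtain ⟨v, rfl⟩ := ρ.asModuleEquiv.symm.surjective y
  rw [rp_asModule, LinearEquiv.apply_symm_apply, LinearEquiv.apply_symm_apply]

lemma RelProj.exists_trace {W : Type} [AddCommGroup W] [Module k W] [Module (MonoidAlgebra k Γ) W]
    [IsScalarTower k (MonoidAlgebra k Γ) W] {D : Subgroup Γ} (h : RelProj k Γ D W) :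
    ∃ θ : W →ₗ[k] W, (∀ d ∈ D, (rp k Γ W).linHom (rp k Γ W) d θ = θ) ∧
      qtr ((rp k Γ W).linHom (rp k Γ W)) D θ = LinearMap.id := by
  obtain ⟨τ, hτ⟩ : ∃ τ : Representation k D W, ∀ d : D, τ d = rp k Γ W d :=
    ⟨MonoidHom.comp (rp k Γ W) D.subtype, fun _ => rfl⟩
  obtain ⟨ε, hε, hunit, hsum⟩ := exists_coind_sum (rp k Γ W) D τ hτ
  obtain ⟨C, hC⟩ : ∃ C, C = Representation.coind D.subtype τ := ⟨_, rfl⟩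
  rw [← hC] at hε
  obtain ⟨e, he⟩ : ∃ e : C.asModule →ₗ[k] W, ∀ y, e y = ε (C.asModuleEquiv y) :=
    ⟨ε ∘ₗ C.asModuleEquiv.toLinearMap, fun _ => rfl⟩
  have he' : ∀ g y, e (rp k Γ C.asModule g y) = rp k Γ W g (e y) := fun g y => by
    rw [he, he, asModuleEquiv_rp, hε]
  obtain ⟨f, hf⟩ : ∃ f : C.asModule →ₗ[MonoidAlgebra k Γ] W, ∀ y, f y = ε (C.asModuleEquiv y) :=
    ⟨linOf (k := k) (N := Γ) (Y := C.asModule) (Z := W) e he', he⟩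
  have hfe : ∀ u, f (C.asModuleEquiv.symm (coindUnit τ u)) = u := fun u => by
    rw [hf, LinearEquiv.apply_symm_apply, hunit]
  have hc : ∀ (c : k) (u : W),
      C.asModuleEquiv.symm (coindUnit τ (algebraMap k (MonoidAlgebra k Γ) c • u)) =
        algebraMap k (MonoidAlgebra k Γ) c • C.asModuleEquiv.symm (coindUnit τ u) := fun c u => by
    rw [algebraMap_smul, algebraMap_smul, map_smul, map_smul]
  have hd : ∀ (d : D) (u : W), C.asModuleEquiv.symm (coindUnit τ (MonoidAlgebra.of k Γ d • u)) =
      MonoidAlgebra.of k Γ d • C.asModuleEquiv.symm (coindUnit τ u) := fun d u => by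
    refine Eq.trans ?_ (rp_apply (k := k) (N := Γ) (d : Γ) (C.asModuleEquiv.symm (coindUnit τ u)))
    rw [← rp_apply, rp_asModule]
    congr 1
    rw [hC]
    refine Subtype.ext (funext fun x => ?_)
    show (coindUnit τ (rp k Γ W d u) : Γ → W) x = (coindUnit τ u : Γ → W) (x * d)
    rw [coindUnit_apply, coindUnit_apply]
    by_cases hx : x ∈ D
    · have hx' : x * d ∈ D := D.mul_mem hx d.2
      rw [dif_pos hx, dif_pos hx', hτ, hτ]
      show rp k Γ W x (rp k Γ W d u) = rp k Γ W (x * d) u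
      rw [map_mul, Module.End.mul_apply]
    · have hx' : x * d ∉ D := fun h' => hx ((D.mul_mem_cancel_right d.2).1 h')
      rw [dif_neg hx, dif_neg hx']
  obtain ⟨h', hh'⟩ := h ⟨C.asModule⟩ ⟨W⟩ f LinearMap.id (fun u => ⟨_, hfe u⟩)
    ⟨C.asModuleEquiv.symm.toAddMonoidHom.comp (coindUnit τ).toAddMonoidHom, hc, hd, hfe⟩
  have hH : ∀ g u, C.asModuleEquiv (h' (rp k Γ W g u)) = C g (C.asModuleEquiv (h' u)) :=
    fun g u => by
      rw [map_rp k Γ h', asModuleEquiv_rp]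
  subst hC
  refine exists_trace_of_coind_section (rp k Γ W) D τ hτ
    ((Representation.coind D.subtype τ).asModuleEquiv.toLinearMap ∘ₗ h'.restrictScalars k)
    hH fun u => ?_
  rw [← hsum]
  exact (hf _).symm.trans (hh' u)

end RelProjective

/-! ### The action of a central idempotent -/

section Idempotent

open scoped Classical

variable {k : Type} [Field k] {Γ : Type} [Group Γ] [Fintype Γ]

lemma wact_coeff {V : Type} [AddCommGroup V] [Module k V] [Module (MonoidAlgebra k Γ) V]
    [IsScalarTower k (MonoidAlgebra k Γ) V] (b : MonoidAlgebra k Γ) (u : V) :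
    wact (fun g => b.coeff g) (rp k Γ V) u = b • u := by
  have hb : b = ∑ g : Γ, MonoidAlgebra.single g (b.coeff g) := by
    conv_lhs => rw [← MonoidAlgebra.sum_coeff_single b]
    rw [Finsupp.sum_fintype]
    simp
  conv_rhs => rw [hb]
  rw [wact, LinearMap.sum_apply, Finset.sum_smul]
  refine Finset.sum_congr rfl fun g _ => ?_
  rw [LinearMap.smul_apply, rp_apply, ← smul_assoc, MonoidAlgebra.of_apply,
    MonoidAlgebra.smul_single, smul_eq_mul, mul_one]

lemma wact_coeff_eq_id {V : Type} [AddCommGroup V] [Module k V] [Module (MonoidAlgebra k Γ) V]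
    [IsScalarTower k (MonoidAlgebra k Γ) V] {b : MonoidAlgebra k Γ}
    (h : LiesIn (MonoidAlgebra k Γ) b V) : wact (fun g => b.coeff g) (rp k Γ V) = LinearMap.id :=
  LinearMap.ext fun u => (wact_coeff b u).trans (h u)

lemma exists_trace_of_relProj {b : MonoidAlgebra k Γ} (hb : IsCentralIdem (MonoidAlgebra k Γ) b)
    {D : Subgroup Γ} (h : ∀ U : BModule k (MonoidAlgebra k Γ),
      LiesIn (MonoidAlgebra k Γ) b ↥U → RelProj k Γ D ↥U)
    (V : Type) [AddCommGroup V] [Module k V] [Module (MonoidAlgebra k Γ) V]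
    [IsScalarTower k (MonoidAlgebra k Γ) V] :
    ∃ θ : V →ₗ[k] V, (∀ d ∈ D, (rp k Γ V).linHom (rp k Γ V) d θ = θ) ∧
      qtr ((rp k Γ V).linHom (rp k Γ V)) D θ = wact (fun g => b.coeff g) (rp k Γ V) := by
  obtain ⟨W, hW⟩ : ∃ W, W = blockComp (MonoidAlgebra k Γ) b hb.2 V := ⟨_, rfl⟩
  have hmem : ∀ v, v ∈ W ↔ b • v = v := fun v => by rw [hW]; exact Iff.rfl
  have hproj : ∀ v, b • v ∈ W := fun v => by rw [hmem, smul_smul, hb.1]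
  obtain ⟨θ, hθ, hθ1⟩ := (h ⟨W⟩ fun u => Subtype.ext ((hmem _).1 u.2)).exists_trace
  let P : V →ₗ[MonoidAlgebra k Γ] W :=
    { toFun := fun v => ⟨b • v, hproj v⟩
      map_add' := fun u v => Subtype.ext (smul_add b u v)
      map_smul' := fun a v => Subtype.ext (by
        show b • a • v = a • b • v
        rw [smul_smul, smul_smul, hb.2]) }
  let Θ : V →ₗ[k] V := W.subtype.restrictScalars k ∘ₗ θ ∘ₗ P.restrictScalars k
  have hΘ : ∀ g v, (rp k Γ V).linHom (rp k Γ V) g Θ v =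
      ((rp k Γ W).linHom (rp k Γ W) g θ (P v) : W) := fun g v => by
    rw [Representation.linHom_apply, Representation.linHom_apply]
    show rp k Γ V g (W.subtype (θ (P (rp k Γ V g⁻¹ v)))) =
      W.subtype (rp k Γ W g (θ (rp k Γ W g⁻¹ (P v))))
    rw [map_rp k Γ P, map_rp k Γ W.subtype]
  refine ⟨Θ, fun d hd => LinearMap.ext fun v => ?_, LinearMap.ext fun v => ?_⟩
  · rw [hΘ, hθ d hd]
    rfl
  · rw [wact_coeff, qtr, LinearMap.sum_apply, Finset.sum_congr rfl fun x _ => hΘ _ _,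
      ← Submodule.coe_sum, ← LinearMap.sum_apply]
    exact congrArg Subtype.val (LinearMap.congr_fun hθ1 (P v))

lemma hasTraces_of_relProj {b : MonoidAlgebra k Γ} (hb : IsCentralIdem (MonoidAlgebra k Γ) b)
    {t : Γ} (h : ∀ U : BModule k (MonoidAlgebra k Γ),
      LiesIn (MonoidAlgebra k Γ) b ↥U → RelProj k Γ (Subgroup.zpowers t) ↥U) :
    HasTraces k t fun g => b.coeff g := by
  intro V _ _ ρ
  let _ : Module (MonoidAlgebra k Γ) V := Module.compHom V ρ.asAlgebraHom.toRingHom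
  have hsm : ∀ (a : MonoidAlgebra k Γ) (v : V), a • v = ρ.asAlgebraHom a v := fun _ _ => rfl
  have : IsScalarTower k (MonoidAlgebra k Γ) V := ⟨fun c a v => by
    rw [hsm, hsm, map_smul, LinearMap.smul_apply]⟩
  have hρ : rp k Γ V = ρ := MonoidHom.ext fun g => LinearMap.ext fun v => by
    rw [rp_apply, hsm, MonoidAlgebra.of_apply, Representation.asAlgebraHom_single_one]
  have := exists_trace_of_relProj hb h V
  rwa [hρ] at this

omit [Fintype Γ] in
lemma coeff_map_of_mapDomain {b : MonoidAlgebra k Γ} {α : Γ ≃* Γ}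
    (h : MonoidAlgebra.mapDomainRingHom k (α : Γ →* Γ) b = b) (g : Γ) :
    b.coeff (α g) = b.coeff g := by
  have h1 : (MonoidAlgebra.mapDomainRingEquiv k α b).coeff (α g) = b.coeff g := by
    rw [MonoidAlgebra.coeff_mapDomainRingEquiv]
    simp
  rw [← h1]
  exact congrArg (fun x : MonoidAlgebra k Γ => x.coeff (α g)) h.symm

omit [Fintype Γ] in
lemma mapDomain_eq_conj {Λ : Type} [Group Λ] (f α : Γ →* Λ) (x : Λ)
    (hα : ∀ g, α g = x⁻¹ * f g * x) (a : MonoidAlgebra k Γ) :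
    MonoidAlgebra.mapDomainRingHom k α a =
      MonoidAlgebra.of k Λ x⁻¹ * MonoidAlgebra.mapDomainRingHom k f a * MonoidAlgebra.of k Λ x := by
  refine MonoidAlgebra.induction_on (motive := fun a => MonoidAlgebra.mapDomainRingHom k α a =
    MonoidAlgebra.of k Λ x⁻¹ * MonoidAlgebra.mapDomainRingHom k f a * MonoidAlgebra.of k Λ x)
    a (fun g => ?_) (fun a c ha hc => ?_) (fun c a ha => ?_)
  · simp [MonoidAlgebra.of_apply, MonoidAlgebra.mapDomain_single, MonoidAlgebra.single_mul_single,
      hα]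
  · rw [map_add, map_add, ha, hc, mul_add, add_mul]
  · have h1 := map_smul (MonoidAlgebra.mapDomainAlgHom k k α) c a
    have h2 := map_smul (MonoidAlgebra.mapDomainAlgHom k k f) c a
    refine h1.trans ((congrArg (c • ·) ha).trans ?_)
    refine Eq.trans ?_ (congrArg (MonoidAlgebra.of k Λ x⁻¹ * · * MonoidAlgebra.of k Λ x) h2.symm)
    show c • _ = _ * (c • MonoidAlgebra.mapDomainRingHom k f a) * _
    rw [mul_smul_comm, smul_mul_assoc]

omit [Fintype Γ] in
lemma mapDomain_eq_of_commute {Λ : Type} [Group Λ] {f α : Γ →* Λ} {x : Λ}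
    (hα : ∀ g, α g = x⁻¹ * f g * x) {b : MonoidAlgebra k Γ}
    (hx : Commute (MonoidAlgebra.of k Λ x) (MonoidAlgebra.mapDomainRingHom k f b)) :
    MonoidAlgebra.mapDomainRingHom k α b = MonoidAlgebra.mapDomainRingHom k f b := by
  rw [mapDomain_eq_conj f α x hα, mul_assoc, ← hx.eq, ← mul_assoc, ← map_mul, inv_mul_cancel,
    map_one, one_mul]

omit [Fintype Γ] in
lemma coeff_conj {b : MonoidAlgebra k Γ} (hb : ∀ a, a * b = b * a) (g h : Γ) :
    b.coeff (g * h * g⁻¹) = b.coeff h := by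
  refine coeff_map_of_mapDomain (α := MulAut.conj g) ?_ h
  have hid : MonoidAlgebra.mapDomainRingHom k (MonoidHom.id Γ) b = b := by simp
  have := mapDomain_eq_of_commute (k := k) (f := MonoidHom.id Γ)
    (α := (MulAut.conj g : Γ ≃* Γ).toMonoidHom) (x := g⁻¹) (b := b) (fun h => by simp) (by
      rw [hid]; exact hb _)
  exact this.trans hid

end Idempotent

/-! ### Stability under conjugation -/

section ConjStable

variable {k : Type} [Field k] {Gt : Type} [Group Gt] {G : Subgroup Gt} [G.Normal]

/-- Conjugation on a normal subgroup as an automorphism. -/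
def conjEquiv (Gt : Type) [Group Gt] (G : Subgroup Gt) [G.Normal] (x : Gt) : ↥G ≃* ↥G :=
  { conjHom Gt G x with
    invFun := conjHom Gt G x⁻¹
    left_inv := fun g => Subtype.ext (by
      show x⁻¹⁻¹ * (x⁻¹ * ↑g * x) * x⁻¹ = g
      group)
    right_inv := fun g => Subtype.ext (by
      show x⁻¹ * (x⁻¹⁻¹ * ↑g * x⁻¹) * x = g
      group) }

lemma coeff_conjEquiv {b : MonoidAlgebra k ↥G} {x : Gt}
    (hx : Commute (MonoidAlgebra.of k Gt x) (MapAlong k G.subtype b)) (g : ↥G) :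
    b.coeff (conjEquiv Gt G x g) = b.coeff g := by
  refine coeff_map_of_mapDomain ?_ g
  have h := mapDomain_eq_of_commute (k := k) (f := G.subtype)
    (α := G.subtype.comp (conjHom Gt G x)) (fun g => rfl) hx
  refine MonoidAlgebra.mapDomain_injective (f := G.subtype) Subtype.val_injective ?_
  refine Eq.trans ?_ h
  exact (RingHom.congr_fun (MonoidAlgebra.mapDomainRingHom_comp G.subtype (conjHom Gt G x)) b).symm

variable {U : Type} [AddCommGroup U] [Module k U] [Module (MonoidAlgebra k ↥G) U]
  [IsScalarTower k (MonoidAlgebra k ↥G) U]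

lemma mapAlong_of {A B : Type} [Group A] [Group B] (f : A →* B) (g : A) :
    MapAlong k f (MonoidAlgebra.of k A g) = MonoidAlgebra.of k B (f g) := by
  simp [MapAlong, MonoidAlgebra.mapDomain_single]

lemma mapAlong_smul {A B : Type} [Group A] [Group B] (f : A →* B) (c : k)
    (a : MonoidAlgebra k A) : MapAlong k f (c • a) = c • MapAlong k f a :=
  map_smul (MonoidAlgebra.mapDomainAlgHom k k f) c a

lemma isStableAt_iff {x : Gt} :
    IsStableAt k Gt G x U ↔ TwStable k (conjEquiv Gt G x : ↥G →* ↥G) U := by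
  constructor
  · rintro ⟨ψ, hψ⟩
    refine ⟨{ ψ with
      map_smul' := fun c u => ?_ }, fun g u => ?_⟩
    · show ψ (c • u) = c • ψ u
      have := hψ (c • 1) u
      rwa [mapAlong_smul, map_one, smul_assoc, smul_assoc, one_smul, one_smul] at this
    · rw [rp_apply, rp_apply]
      show ψ (MonoidAlgebra.of k ↥G (conjHom Gt G x g) • u) = MonoidAlgebra.of k ↥G g • ψ u
      rw [← hψ, mapAlong_of]
  · rintro ⟨ψ, hψ⟩
    refine ⟨ψ.toAddEquiv, fun a => ?_⟩
    show ∀ u, ψ (MapAlong k (conjHom Gt G x) a • u) = a • ψ u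
    refine MonoidAlgebra.induction_on (motive := fun a =>
      ∀ u, ψ (MapAlong k (conjHom Gt G x) a • u) = a • ψ u) a (fun g u => ?_)
      (fun a c ha hc u => ?_) (fun c a ha u => ?_)
    · have := hψ g u
      rw [rp_apply, rp_apply] at this
      rw [mapAlong_of]
      exact this
    · rw [map_add, add_smul, map_add, ha, hc, add_smul]
    · rw [mapAlong_smul, smul_assoc, map_smul, ha, smul_assoc]

end ConjStable

lemma exists_pow_orderOf_eq {p : ℕ} (hp : p.Prime) {Γ : Type} [Group Γ] [Finite Γ] (d : Γ) :
    ∃ m j, ¬ p ∣ m ∧ orderOf (d ^ m) = p ^ j := by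
  obtain ⟨j, m, hm, hd⟩ := Nat.exists_eq_pow_mul_and_not_dvd (orderOf_pos d).ne' p hp.ne_one
  have hm0 : m ≠ 0 := by
    rintro rfl
    exact hm (dvd_zero p)
  refine ⟨m, j, hm, ?_⟩
  rw [orderOf_pow_of_dvd hm0 (hd ▸ dvd_mul_left m _), hd, Nat.mul_div_cancel _ hm0.bot_lt]

/-- For a `G̃`-stable block `B` of `kG` with cyclic defect groups,
if every simple `B`-module is `G̃`-stable then every indecomposable `B`-module is
`G̃`-stable. -/
theorem statement_12 (k : Type) [Field k] [IsAlgClosed k]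
    (p : ℕ) [Fact p.Prime] [CharP k p]
    (Gt : Type) [Group Gt] [Finite Gt] (G : Subgroup Gt) [G.Normal]
    (b : MonoidAlgebra k ↥G) (hb : IsBlockIdem (MonoidAlgebra k ↥G) b)
    (hstable : ∀ x : Gt, Commute (MonoidAlgebra.of k Gt x) (MapAlong k G.subtype b))
    (D : Subgroup ↥G) (hD : IsDefectGroup k ↥G b D) (hcyc : IsCyclic ↥D)
    (hsimple : ∀ S : BModule k (MonoidAlgebra k ↥G),
        IsSimpleModule (MonoidAlgebra k ↥G) ↥S → LiesIn (MonoidAlgebra k ↥G) b ↥S →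
        IsGtStable k Gt G ↥S) :
    ∀ U : BModule k (MonoidAlgebra k ↥G),
      Module.Finite (MonoidAlgebra k ↥G) ↥U → LiesIn (MonoidAlgebra k ↥G) b ↥U →
      IndecMod (MonoidAlgebra k ↥G) ↥U → IsGtStable k Gt G ↥U := by
  intro U hUfin hUb hU x
  let _ : Fintype ↥G := Fintype.ofFinite _
  obtain ⟨d, rfl⟩ := D.isCyclic_iff_exists_zpowers_eq_top.1 hcyc
  obtain ⟨m, j, hm, ht⟩ := exists_pow_orderOf_eq (Fact.out : p.Prime) d
  have hT : HasTraces k (d ^ m) fun g => b.coeff g := hasTraces_of_relProj hb.2.1 fun W hW =>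
    (hD.1 W hW).zpowers_pow ((CharP.cast_eq_zero_iff k p m).not.2 hm)
  have : Module.Finite k (MonoidAlgebra k ↥G) := inferInstance
  have : Module.Finite k ↥U := Module.Finite.trans (MonoidAlgebra k ↥G) ↥U
  have := hU.1
  obtain ⟨M, hM, -⟩ := (eq_top_or_exists_le_coatom (⊥ : Submodule (MonoidAlgebra k ↥G) ↥U)
    ).resolve_left bot_ne_top
  have hS : IsSimpleModule (MonoidAlgebra k ↥G) (↥U ⧸ M) := isSimpleModule_iff_isCoatom.2 hM
  have hSb : LiesIn (MonoidAlgebra k ↥G) b (↥U ⧸ M) := fun y => by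
    obtain ⟨u, rfl⟩ := M.mkQ_surjective y
    rw [← map_smul, hUb]
  have hSst : IsStableAt k Gt G x (↥U ⧸ M) := hsimple ⟨↥U ⧸ M⟩ hS hSb x
  exact isStableAt_iff.2 (twStable_of_simple_quotient ht (fun g h => coeff_conj hb.2.1.2 g h) hT
    (coeff_conjEquiv (hstable x)) (wact_coeff_eq_id hUb) (wact_coeff_eq_id hSb) hU
    M.mkQ_surjective (isStableAt_iff.1 hSst))

end Paper
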